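/- Let f : D² → M_{m×k}(ℂ) be a rational matrix function, i.e., there exist a matrix polynomial P(z,ζ) with m×k complex matrix coefficients and a scalar complex polynomial q(z,ζ) with q(z,ζ) ≠ 0 for all (z,ζ) ∈ D², such that f(z,ζ) = P(z,ζ)/q(z,ζ) on D². Suppose f is symmetric (f(z,ζ) = f(ζ,z) on D²) and ‖f(z,ζ)‖ ≤ 1 for all (z,ζ) ∈ D². Then there exist a finite-dimensional complex Hilbert space H and operators A₁, A₂ ∈ B(H), B : ℂᵏ → H, C : H → ℂᵐ, D : ℂᵏ → ℂᵐ such that M = [[A₁, A₂, B], [A₂, A₁, B], [C, C, D]] : H ⊕ H ⊕ ℂᵏ → H ⊕ H ⊕ ℂᵐ is a contraction and f(z,ζ) = D + [C C]·diag(zI_H, ζI_H)·(I − [[A₁,A₂],[A₂,A₁]]·diag(zI_H, ζI_H))⁻¹·[B; B] for all (z,ζ) ∈ D². -/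

import Mathlib

noncomputable section

open ContinuousLinearMap MvPolynomial

/-- The open bidisk `𝔻² = {(z,ζ) : |z| < 1, |ζ| < 1}`. -/
def bidisk : Set (ℂ × ℂ) := {w : ℂ × ℂ | ‖w.1‖ < 1 ∧ ‖w.2‖ < 1}

/-- A rectangular complex matrix viewed as a continuous linear map between the corresponding
Euclidean (Hilbert) spaces; its operator norm is the usual operator norm of the matrix. -/
def matCLM {m k : ℕ} (M : Matrix (Fin m) (Fin k) ℂ) :
    EuclideanSpace ℂ (Fin k) →L[ℂ] EuclideanSpace ℂ (Fin m) :=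
  LinearMap.toContinuousLinearMap (Matrix.toEuclideanLin M)

section Defs

variable {H U Y : Type*}
  [NormedAddCommGroup H] [NormedSpace ℂ H]
  [NormedAddCommGroup U] [NormedSpace ℂ U]
  [NormedAddCommGroup Y] [NormedSpace ℂ Y]

/-- The block operator `[[A₁, A₂], [A₂, A₁]]` acting on `H ⊕ H`. -/
def symBlock (A₁ A₂ : H →L[ℂ] H) : (H × H) →L[ℂ] (H × H) :=
  (A₁.coprod A₂).prod (A₂.coprod A₁)

/-- The block diagonal operator `diag(z I_H, ζ I_H)` acting on `H ⊕ H`. -/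
def diagOp (z ζ : ℂ) : (H × H) →L[ℂ] (H × H) :=
  (z • ContinuousLinearMap.id ℂ H).prodMap (ζ • ContinuousLinearMap.id ℂ H)

/-- The colligation `M = [[A₁,A₂,B],[A₂,A₁,B],[C,C,D]] : H ⊕ H ⊕ U → H ⊕ H ⊕ Y` is a
contraction (with respect to the Hilbert space direct sum norms). -/
def SymColligationContractive (A₁ A₂ : H →L[ℂ] H) (B : U →L[ℂ] H) (C : H →L[ℂ] Y)
    (D : U →L[ℂ] Y) : Prop :=
  ∀ (h₁ h₂ : H) (u : U),
    ‖A₁ h₁ + A₂ h₂ + B u‖ ^ 2 + ‖A₂ h₁ + A₁ h₂ + B u‖ ^ 2 + ‖C h₁ + C h₂ + D u‖ ^ 2 ≤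
      ‖h₁‖ ^ 2 + ‖h₂‖ ^ 2 + ‖u‖ ^ 2

/-- The transfer function
`D + [C C] ⬝ diag(zI,ζI) ⬝ (I - [[A₁,A₂],[A₂,A₁]] ⬝ diag(zI,ζI))⁻¹ ⬝ [B;B]`. -/
def symTransfer (A₁ A₂ : H →L[ℂ] H) (B : U →L[ℂ] H) (C : H →L[ℂ] Y) (D : U →L[ℂ] Y)
    (z ζ : ℂ) : U →L[ℂ] Y :=
  D + (C.coprod C) ∘L diagOp z ζ ∘L
    Ring.inverse (1 - symBlock A₁ A₂ * diagOp z ζ) ∘L (B.prod B)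

end Defs

set_option linter.all false

section Part1
open scoped Polynomial

theorem exists_order_of_not_sumSq (E : Type*) [Field E] (h : ¬ IsSumSq (-1 : E)) :
    ∃ lo : LinearOrder E, IsStrictOrderedRing E := by
  classical
  let s : Set (Subsemiring E) := {P | (∀ a, a * a ∈ P) ∧ (-1 : E) ∉ P}
  let P0 : Subsemiring E :=
    { carrier := {x | IsSumSq x}
      mul_mem' := fun ha hb => IsSumSq.mul ha hb
      one_mem' := by simpa using IsSumSq.mul_self (1 : E)
      add_mem' := fun ha hb => IsSumSq.add ha hb
      zero_mem' := IsSumSq.zero }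
  have hP0 : P0 ∈ s := ⟨fun a => IsSumSq.mul_self a, h⟩
  obtain ⟨P, -, hPs, hmax⟩ := zorn_le_nonempty₀ s (by
    intro c hc hch y hy
    refine ⟨sSup c, ⟨fun a => ?_, ?_⟩, fun z hz => le_sSup hz⟩
    · exact (le_sSup hy) ((hc hy).1 a)
    · rw [Subsemiring.mem_sSup_of_directedOn ⟨y, hy⟩ hch.directedOn]
      rintro ⟨z, hz, hz1⟩
      exact (hc hz).2 hz1) P0 hP0
  have hsq := hPs.1
  have hm1 := hPs.2
  have htot : ∀ a, a ∈ P ∨ -a ∈ P := by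
    intro a
    by_contra! hcon
    obtain ⟨ha, hna⟩ := hcon
    let Q : Subsemiring E :=
      { carrier := {z | ∃ x ∈ P, ∃ y ∈ P, z = x + (-a) * y}
        mul_mem' := by
          rintro _ _ ⟨x, hx, y, hy, rfl⟩ ⟨x', hx', y', hy', rfl⟩
          exact ⟨x * x' + (a * a) * (y * y'),
            P.add_mem (P.mul_mem hx hx') (P.mul_mem (hsq a) (P.mul_mem hy hy')),
            x * y' + x' * y, P.add_mem (P.mul_mem hx hy') (P.mul_mem hx' hy), by ring⟩
        one_mem' := ⟨1, P.one_mem, 0, P.zero_mem, by ring⟩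
        add_mem' := by
          rintro _ _ ⟨x, hx, y, hy, rfl⟩ ⟨x', hx', y', hy', rfl⟩
          exact ⟨x + x', P.add_mem hx hx', y + y', P.add_mem hy hy', by ring⟩
        zero_mem' := ⟨0, P.zero_mem, 0, P.zero_mem, by ring⟩ }
    have hPQ : P ≤ Q := fun x hx => ⟨x, hx, 0, P.zero_mem, by ring⟩
    have hQs : Q ∈ s := by
      refine ⟨fun b => hPQ (hsq b), ?_⟩
      rintro ⟨x, hx, y, hy, hxy⟩
      have hy0 : y ≠ 0 := by
        rintro rfl
        apply hm1
        rw [hxy]; simpa using hx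
      apply ha
      have : a = (1 + x) * y * (y⁻¹ * y⁻¹) := by
        field_simp
        linear_combination hxy
      rw [this]
      exact P.mul_mem (P.mul_mem (P.add_mem P.one_mem hx) hy) (hsq _)
    exact hna (hmax hQs hPQ ⟨0, P.zero_mem, 1, P.one_mem, by ring⟩)
  let K : RingCone E :=
    { P with
      eq_zero_of_mem_of_neg_mem' := by
        intro a ha hna
        by_contra h0
        apply hm1
        have : (-1 : E) = a * (-a) * (a⁻¹ * a⁻¹) := by field_simp
        rw [this]
        exact P.mul_mem (P.mul_mem ha hna) (hsq _) }
  haveI : HasMemOrNegMem K := ⟨fun a => htot a⟩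
  letI lo : LinearOrder E := LinearOrder.mkOfAddGroupCone K
  haveI : IsOrderedRing E := IsOrderedRing.mkOfCone K
  exact ⟨lo, IsOrderedRing.toIsStrictOrderedRing E⟩

end Part1

section Part2
open scoped Polynomial

namespace Curve
open ArchimedeanClass

variable {E : Type} [Field E] [LinearOrder E] [IsStrictOrderedRing E]

def toOrd (φ : ℝ →+* E) : ℝ →+*o E :=
  { φ with
    monotone' := by
      intro a b hab
      have : b = a + Real.sqrt (b - a) * Real.sqrt (b - a) := by
        rw [Real.mul_self_sqrt (by linarith)]; ring
      rw [this]
      simp only [RingHom.toMonoidHom_eq_coe, OneHom.toFun_eq_coe, MonoidHom.toOneHom_coe, MonoidHom.coe_coe, map_add, map_mul]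
      nlinarith [mul_self_nonneg (φ (Real.sqrt (b-a)))] }

@[simp] lemma toOrd_apply (φ : ℝ →+* E) (r : ℝ) : toOrd φ r = φ r := rfl

lemma mk_real (φ : ℝ →+* E) (r : ℝ) (hr : r ≠ 0) : mk (φ r) = 0 :=
  mk_map_of_archimedean' (toOrd φ) hr

lemma mk_real_nonneg (φ : ℝ →+* E) (r : ℝ) : 0 ≤ mk (φ r) :=
  mk_map_nonneg_of_archimedean (toOrd φ) r

lemma mk_eval_nonneg (φ : ℝ →+* E) (s : E) (hs : 0 ≤ mk s) (a : ℝ[X]) :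
    0 ≤ mk (a.eval₂ φ s) := by
  rw [Polynomial.eval₂_eq_sum_range]
  apply AddValuation.map_le_sum (addValuation E)
  intro i _
  simp only [addValuation_apply, mk_mul, mk_pow]
  exact add_nonneg (mk_real_nonneg _ _) (nsmul_nonneg hs _)

/-- evaluation near zero -/
lemma eval_lead (φ : ℝ →+* E) (s : E) (hs : 0 < mk s) (b : ℝ[X]) :
    0 < mk (b.eval₂ φ s - φ (b.coeff 0)) := by
  have h1 : b.eval₂ φ s - φ (b.coeff 0) = (b.divX).eval₂ φ s * s := by
    conv_lhs => rw [← Polynomial.divX_mul_X_add b]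
    simp [Polynomial.eval₂_add, Polynomial.eval₂_mul]
  rw [h1, mk_mul]
  exact lt_of_lt_of_le hs (le_add_of_nonneg_left (mk_eval_nonneg φ s hs.le _))

lemma mk_of_close {x y : E} (h : 0 < mk (x - y)) (hy : mk y = 0) : mk x = 0 := by
  have : x = y + (x - y) := by ring
  rw [this, mk_add_eq_mk_left (by rw [hy]; exact h), hy]

lemma factor_X (a : ℝ[X]) (ha : a ≠ 0) : ∃ m b, a = Polynomial.X ^ m * b ∧ b.coeff 0 ≠ 0 := by
  obtain ⟨b, hb, hb2⟩ := Polynomial.exists_eq_pow_rootMultiplicity_mul_and_not_dvd a ha 0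
  refine ⟨_, b, by simpa using hb, fun h => hb2 ?_⟩
  simpa [Polynomial.X_dvd_iff] using h

lemma mk_eval (φ : ℝ →+* E) (s : E) (hs : 0 < mk s) (a : ℝ[X]) (ha : a ≠ 0) :
    ∃ m : ℕ, mk (a.eval₂ φ s) = mk (s ^ m) := by
  obtain ⟨m, b, rfl, hb⟩ := factor_X a ha
  refine ⟨m, ?_⟩
  rw [Polynomial.eval₂_mul, mk_mul, mk_of_close (eval_lead φ s hs b) (mk_real φ _ hb)]
  simp

lemma two_terms {ι : Type} [DecidableEq ι] (S : Finset ι) (x : ι → E) (h0 : ∑ i ∈ S, x i = 0)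
    (hne : ∃ i ∈ S, x i ≠ 0) : ∃ i ∈ S, ∃ j ∈ S, i ≠ j ∧ x i ≠ 0 ∧ mk (x i) = mk (x j) := by
  obtain ⟨i0, hi0, hx0⟩ := hne
  obtain ⟨i, hi, hmin⟩ := Finset.exists_min_image S (fun i => mk (x i)) ⟨i0, hi0⟩
  have hxi : x i ≠ 0 := by
    intro h
    have := hmin i0 hi0
    rw [h, mk_zero, top_le_iff, mk_eq_top_iff] at this
    exact hx0 this
  by_contra! hcon
  have h1 : mk (x i) < addValuation E (∑ j ∈ S.erase i, x j) := by
    apply AddValuation.map_lt_sum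
    · rw [Ne, mk_eq_top_iff]; exact hxi
    · intro j hj
      rw [Finset.mem_erase] at hj
      exact lt_of_le_of_ne (hmin j hj.2) (hcon i hi j hj.2 (Ne.symm hj.1) hxi)
  rw [← Finset.add_sum_erase S x hi] at h0
  have h2 : ∑ j ∈ S.erase i, x j = - x i := by linear_combination h0
  rw [h2] at h1
  simp at h1

def Alg (φ : ℝ →+* E) (n : ℕ) (τ : E) : Prop :=
  ∀ e : E, ∃ a : ℕ → ℝ[X], (∃ j ∈ Finset.range (n+1), a j ≠ 0) ∧
    ∑ j ∈ Finset.range (n+1), (a j).eval₂ φ τ * e ^ j = 0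

lemma exists_inf (φ : ℝ →+* E) (n : ℕ) (τ : E) (hτ : ∀ r : ℝ, τ ≠ φ r) (h : Alg φ n τ) :
    ∃ ω : E, ω ≠ 0 ∧ 0 < mk ω ∧ Alg φ n ω := by
  by_cases h0 : 0 ≤ mk τ
  · refine ⟨τ - φ (stdPart τ), sub_ne_zero.2 (hτ _), mk_sub_stdPart_pos (toOrd φ) h0, ?_⟩
    intro e
    obtain ⟨a, ⟨j, hj, hja⟩, hs⟩ := h e
    refine ⟨fun j => (a j).comp (Polynomial.X + Polynomial.C (stdPart τ)), ⟨j, hj, ?_⟩, ?_⟩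
    · intro hc
      rw [Polynomial.comp_eq_zero_iff] at hc
      rcases hc with hc | ⟨-, hc⟩
      · exact hja hc
      · have := congrArg (fun p => Polynomial.coeff p 1) hc
        simp at this
    · rw [← hs]
      apply Finset.sum_congr rfl
      intro j _
      simp [Polynomial.eval₂_comp]
  · push Not at h0
    have hτ0 : τ ≠ 0 := by simpa using hτ 0
    refine ⟨τ⁻¹, inv_ne_zero hτ0, ?_, ?_⟩
    · rw [mk_inv]
      exact LinearOrderedAddCommGroupWithTop.neg_pos.2 (Or.inl h0)
    intro e
    obtain ⟨a, ⟨j, hj, hja⟩, hs⟩ := h e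
    letI : Invertible τ := invertibleOfNonzero hτ0
    set N := (Finset.range (n+1)).sup (fun j => (a j).natDegree) with hN
    refine ⟨fun j => (a j).reflect N, ⟨j, hj, by simpa using hja⟩, ?_⟩
    have : (∑ j ∈ Finset.range (n+1), ((a j).reflect N).eval₂ φ τ⁻¹ * e ^ j) * τ ^ N = 0 := by
      rw [← hs, Finset.sum_mul]
      apply Finset.sum_congr rfl
      intro j hj
      rw [← Polynomial.eval₂_reflect_mul_pow φ τ N (a j) (Finset.le_sup (f := fun j => (a j).natDegree) hj), invOf_eq_inv]
      ring
    exact (mul_eq_zero.1 this).resolve_right (pow_ne_zero _ hτ0)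

lemma exists_int (φ : ℝ →+* E) (n : ℕ) (ω : E) (hω0 : ω ≠ 0) (hω : 0 < mk ω) (h : Alg φ n ω)
    (e : E) (he : e ≠ 0) : ∃ l : ℤ, mk (e ^ (n.factorial)) = mk (ω ^ l) := by
  obtain ⟨a, ⟨j0, hj0, hja⟩, hs⟩ := h e
  have hne : ∃ i ∈ Finset.range (n+1), (a i).eval₂ φ ω * e ^ i ≠ 0 := by
    refine ⟨j0, hj0, mul_ne_zero ?_ (pow_ne_zero _ he)⟩
    obtain ⟨m, hm⟩ := mk_eval φ ω hω _ hja
    intro hc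
    rw [hc, mk_zero] at hm
    exact pow_ne_zero m hω0 (mk_eq_top_iff.1 hm.symm)
  obtain ⟨i, hi, j, hj, hij, hx, hv⟩ := two_terms _ _ hs hne
  have key : ∀ i j, i < j → j ≤ n → (a i).eval₂ φ ω * e ^ i ≠ 0 →
      mk ((a i).eval₂ φ ω * e ^ i) = mk ((a j).eval₂ φ ω * e ^ j) →
      ∃ l : ℤ, mk (e ^ (n.factorial)) = mk (ω ^ l) := by
    intro i j hij hjn hx hv
    have hai : a i ≠ 0 := by rintro h; simp [h] at hx
    have haj : a j ≠ 0 := by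
      rintro h; rw [h] at hv
      simp only [Polynomial.eval₂_zero, zero_mul, mk_zero, mk_eq_top_iff] at hv
      exact hx hv
    obtain ⟨mi, hmi⟩ := mk_eval φ ω hω _ hai
    obtain ⟨mj, hmj⟩ := mk_eval φ ω hω _ haj
    have h1 : mk (e ^ (j - i)) = mk (ω ^ ((mi : ℤ) - mj)) := by
      rw [mk_mul, mk_mul, hmi, hmj, ← mk_mul, ← mk_mul] at hv
      have e1 : e ^ (j - i) = (ω ^ mj * e ^ j) * (ω ^ mj * e ^ i)⁻¹ := by
        rw [show e ^ j = e ^ (j-i) * e ^ i by rw [← pow_add]; congr 1; omega]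
        field_simp
      have e2 : ω ^ ((mi : ℤ) - mj) = (ω ^ mi * e ^ i) * (ω ^ mj * e ^ i)⁻¹ := by
        rw [zpow_sub₀ hω0]; simp only [zpow_natCast]; field_simp
      rw [e1, e2, mk_mul, mk_mul _ (ω ^ mj * e ^ i)⁻¹, hv]
    have hd : (j - i) ∣ n.factorial := Nat.dvd_factorial (by omega) (by omega)
    obtain ⟨c, hc⟩ := hd
    refine ⟨((mi : ℤ) - mj) * c, ?_⟩
    rw [hc, pow_mul, mk_pow, h1, zpow_mul, zpow_natCast, mk_pow]
  rcases lt_or_gt_of_ne hij with h1 | h1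
  · exact key i j h1 (by simpa [Nat.lt_succ_iff] using hj) hx hv
  · refine key j i h1 (by simpa [Nat.lt_succ_iff] using hi) ?_ hv.symm
    intro hc
    rw [hc, mk_zero, mk_eq_top_iff] at hv
    exact hx hv

lemma mk_eq_zero_of_pow {x : E} {n : ℕ} (hn : n ≠ 0) (h : mk (x ^ n) = 0) : mk x = 0 := by
  have hn1 : 1 ≤ n := Nat.one_le_iff_ne_zero.2 hn
  rw [mk_pow] at h
  rcases le_total 0 (mk x) with h1 | h1
  · apply le_antisymm _ h1
    calc mk x = 1 • mk x := (one_nsmul _).symm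
      _ ≤ n • mk x := nsmul_le_nsmul_left h1 hn1
      _ = 0 := h
  · apply le_antisymm h1
    calc (0:ArchimedeanClass E) = n • mk x := h.symm
      _ ≤ 1 • mk x := by
        obtain ⟨k, rfl⟩ := Nat.exists_eq_add_of_le hn1
        rw [add_nsmul]
        exact add_le_of_nonpos_right (nsmul_nonpos h1 _)
      _ = _ := one_nsmul _

lemma mk_eq_iff_div {x y : E} (hy : y ≠ 0) : mk x = mk y ↔ mk (x * y⁻¹) = 0 := by
  constructor
  · intro h
    rw [mk_mul, h, ← mk_mul, mul_inv_cancel₀ hy, ArchimedeanClass.mk_one]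
  · intro h
    have : x = (x * y⁻¹) * y := by field_simp
    rw [this, mk_mul, h, zero_add]

lemma zpow_pos_iff {x : E} (hx : x ≠ 0) (h : 0 < mk x) (l : ℤ) : 0 ≤ mk (x ^ l) ↔ 0 ≤ l := by
  constructor
  · intro h1
    by_contra! hl
    obtain ⟨k, rfl⟩ : ∃ k : ℕ, l = -((k : ℤ) + 1) := ⟨(-l-1).toNat, by omega⟩
    have h2 : 0 < mk (x ^ (k+1)) := by
      rw [pow_succ, mk_mul, mk_pow]
      exact lt_of_lt_of_le h (le_add_of_nonneg_left (nsmul_nonneg h.le _))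
    have h3 : mk (x ^ (-((k:ℤ)+1))) + mk (x ^ (k+1)) = 0 := by
      rw [← mk_mul, show x ^ (-((k:ℤ)+1)) * x ^ (k+1) = 1 by
        rw [zpow_neg, ← Nat.cast_succ, zpow_natCast]; exact inv_mul_cancel₀ (pow_ne_zero _ hx), ArchimedeanClass.mk_one]
    have h4 : 0 < mk (x ^ (-((k:ℤ)+1))) + mk (x ^ (k+1)) :=
      lt_of_lt_of_le h2 (le_add_of_nonneg_left h1)
    exact absurd h3 h4.ne'
  · intro hl
    obtain ⟨k, rfl⟩ := Int.eq_ofNat_of_zero_le hl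
    rw [zpow_natCast, mk_pow]; exact nsmul_nonneg h.le _

/-- uniformizer -/
lemma exists_unif (φ : ℝ →+* E) (n : ℕ) (ω : E) (hω0 : ω ≠ 0) (hω : 0 < mk ω) (h : Alg φ n ω) :
    ∃ s : E, 0 < s ∧ 0 < mk s ∧ ∀ e : E, e ≠ 0 → ∃ l : ℤ, mk e = mk (s ^ l) := by
  classical
  set D := n.factorial with hD
  have hD0 : D ≠ 0 := Nat.factorial_ne_zero n
  have hI := exists_int φ n ω hω0 hω h
  have hex : ∃ k : ℕ, 0 < k ∧ ∃ s : E, s ≠ 0 ∧ mk (s ^ D) = mk (ω ^ k) :=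
    ⟨D, Nat.pos_of_ne_zero hD0, ω, hω0, rfl⟩
  obtain ⟨hk0, s, hs0, hsk⟩ := Nat.find_spec hex
  set k := Nat.find hex with hk
  have hdiv : ∀ e : E, e ≠ 0 → ∃ l : ℤ, mk e = mk (s ^ l) := by
    intro e he
    obtain ⟨l, hl⟩ := hI e he
    have hmod : l % k = 0 := by
      by_contra hne
      have h1 : 0 ≤ l % k := Int.emod_nonneg _ (by positivity)
      have h2 : l % k < k := Int.emod_lt_of_pos _ (by exact_mod_cast hk0)
      refine Nat.find_min hex (m := (l % k).toNat) (by omega) ⟨by omega, e * (s ^ (l / k))⁻¹, ?_, ?_⟩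
      · exact mul_ne_zero he (inv_ne_zero (zpow_ne_zero _ hs0))
      · rw [← zpow_natCast ω, Int.toNat_of_nonneg h1, Int.emod_def, zpow_sub₀ hω0, div_eq_mul_inv,
          mul_pow, mk_mul, mk_mul, hl, inv_pow, mk_inv, mk_inv]
        congr 2
        rw [← zpow_natCast (s ^ _), ← zpow_mul, mul_comm, zpow_mul, mk_zpow, zpow_natCast, hsk, ← mk_zpow,
          ← zpow_natCast ω, ← zpow_mul]
    refine ⟨l / k, ?_⟩
    rw [mk_eq_iff_div (zpow_ne_zero _ hs0)]
    apply mk_eq_zero_of_pow hD0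
    rw [mul_pow, mk_mul, hl, inv_pow, ← mk_mul, ← mk_eq_iff_div (pow_ne_zero _ (zpow_ne_zero _ hs0))]
    rw [← zpow_natCast (s ^ _), ← zpow_mul, mul_comm, zpow_mul, mk_zpow _ (s ^ _), zpow_natCast, hsk, ← mk_zpow,
          ← zpow_natCast ω, ← zpow_mul, Int.mul_ediv_cancel' (Int.dvd_of_emod_eq_zero hmod)]
  have hpos : 0 < mk s := by
    by_contra! hle
    have h1 : mk (s ^ D) ≤ 0 := by rw [mk_pow]; exact nsmul_nonpos hle _
    rw [hsk] at h1
    obtain ⟨j, hj⟩ : ∃ j, k = j + 1 := ⟨k - 1, by omega⟩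
    rw [hj, pow_succ, mk_mul, mk_pow] at h1
    exact absurd (lt_of_lt_of_le hω (le_add_of_nonneg_left (nsmul_nonneg hω.le j))) (not_lt.2 h1)
  refine ⟨|s|, abs_pos.2 hs0, by simpa using hpos, fun e he => ?_⟩
  obtain ⟨l, hl⟩ := hdiv e he
  exact ⟨l, by rw [hl, mk_zpow, mk_zpow, mk_abs]⟩

lemma approx_fin (φ : ℝ →+* E) (s : E) (hs : 0 < s) (hs' : 0 < mk s)
    (hu : ∀ e : E, e ≠ 0 → ∃ l : ℤ, mk e = mk (s ^ l)) (N : ℕ) :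
    ∀ e : E, 0 ≤ mk e → ∃ g : ℝ[X], mk (s ^ N) ≤ mk (e - g.eval₂ φ s) := by
  induction N with
  | zero => intro e he; exact ⟨0, by simpa using he⟩
  | succ N ih =>
    intro e he
    have h1 := mk_sub_stdPart_pos (toOrd φ) he
    set c := stdPart e
    rw [toOrd_apply] at h1
    have h2 : 0 ≤ mk ((e - φ c) * s⁻¹) := by
      by_cases h0 : e - φ c = 0
      · simp [h0]
      obtain ⟨l, hl⟩ := hu _ h0
      rw [mk_mul, hl, ← mk_mul, ← zpow_sub_one₀ hs.ne', zpow_pos_iff hs.ne' hs']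
      rw [hl] at h1
      have h3 := (zpow_pos_iff hs.ne' hs' l).1 h1.le
      rcases h3.lt_or_eq with h3 | h3
      · omega
      · rw [← h3] at h1; simp at h1
    obtain ⟨g, hg⟩ := ih _ h2
    refine ⟨Polynomial.C c + Polynomial.X * g, ?_⟩
    have : e - (Polynomial.C c + Polynomial.X * g).eval₂ φ s = ((e - φ c) * s⁻¹ - g.eval₂ φ s) * s := by
      simp only [Polynomial.eval₂_add, Polynomial.eval₂_mul, Polynomial.eval₂_C, Polynomial.eval₂_X]
      field_simp
      ring
    rw [this, pow_succ, mk_mul, mk_mul]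
    gcongr

lemma exists_pow_small (s : E) (hs : 0 < s) (hs' : 0 < mk s)
    (hu : ∀ e : E, e ≠ 0 → ∃ l : ℤ, mk e = mk (s ^ l)) (e : E) (he : e ≠ 0) :
    ∃ N : ℕ, ∀ M ≥ N, mk e < mk (s ^ M) := by
  obtain ⟨l, hl⟩ := hu e he
  refine ⟨(l+1).toNat, fun M hM => ?_⟩
  rw [hl]
  have : s ^ M = s ^ l * s ^ ((M : ℤ) - l - 1) * s := by
    rw [← zpow_add₀ hs.ne', ← zpow_add_one₀ hs.ne', ← zpow_natCast]; congr 1; ring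
  rw [this, mk_mul, mk_mul]
  have h1 : 0 ≤ mk (s ^ ((M : ℤ) - l - 1)) := (zpow_pos_iff hs.ne' hs' _).2 (by omega)
  have h2 : mk (s^l) ≠ ⊤ := by rw [Ne, mk_eq_top_iff]; exact zpow_ne_zero _ hs.ne'
  have h3 : 0 < mk (s ^ ((M : ℤ) - l - 1)) + mk s := lt_of_lt_of_le hs' (le_add_of_nonneg_left h1)
  rw [add_assoc]
  refine lt_of_le_of_ne (le_add_of_nonneg_right h3.le) ?_
  intro hc
  have : mk (s^l) + 0 = mk (s^l) + (mk (s ^ ((M : ℤ) - l - 1)) + mk s) := by rw [add_zero]; exact hc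
  exact h3.ne (add_left_cancel_of_ne_top h2 this)

lemma approx (φ : ℝ →+* E) (s : E) (hs : 0 < s) (hs' : 0 < mk s)
    (hu : ∀ e : E, e ≠ 0 → ∃ l : ℤ, mk e = mk (s ^ l)) (e δ : E) (hδ : 0 < δ) :
    ∃ L0 : ℕ, ∀ L ≥ L0, ∃ g : ℝ[X], |g.eval₂ φ s / s ^ L - e| < δ := by
  obtain ⟨L0, hL0⟩ : ∃ L0 : ℕ, ∀ L ≥ L0, 0 ≤ mk (e * s ^ L) := by
    by_cases he : e = 0
    · exact ⟨0, by simp [he]⟩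
    obtain ⟨l, hl⟩ := hu e he
    refine ⟨(-l).toNat, fun L hL => ?_⟩
    rw [mk_mul, hl, ← mk_mul, ← zpow_natCast, ← zpow_add₀ hs.ne', zpow_pos_iff hs.ne' hs']
    omega
  refine ⟨L0, fun L hL => ?_⟩
  obtain ⟨N, hN⟩ := exists_pow_small s hs hs' hu (δ * s ^ L) (by positivity)
  obtain ⟨g, hg⟩ := approx_fin φ s hs hs' hu N _ (hL0 L hL)
  refine ⟨g, ?_⟩
  have h1 := lt_of_lt_of_le (hN N le_rfl) hg
  rw [← mk_abs (e * s^L - _)] at h1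
  have h2 := lt_of_mk_lt_mk_of_nonneg h1 (by positivity)
  rw [show g.eval₂ φ s / s ^ L - e = - ((e * s ^ L - g.eval₂ φ s) / s ^ L) by field_simp; ring, abs_neg,
    abs_div, abs_of_pos (pow_pos hs L), div_lt_iff₀ (pow_pos hs L)]
  exact h2

lemma neg_transfer (φ : ℝ →+* E) (s : E) (hs : 0 < s) (hs' : 0 < mk s) (Q : ℝ[X])
    (hQ : Q.eval₂ φ s < 0) : ∃ ε : ℝ, 0 < ε ∧ Q.eval ε < 0 := by
  have hQ0 : Q ≠ 0 := by rintro rfl; simp at hQ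
  obtain ⟨m, b, rfl, hb⟩ := factor_X Q hQ0
  have h1 : b.eval₂ φ s < 0 := by
    rw [Polynomial.eval₂_mul, Polynomial.eval₂_pow, Polynomial.eval₂_X] at hQ
    by_contra! h
    exact absurd hQ (not_lt.2 (by positivity))
  have h2 := eval_lead φ s hs' b
  have hb0 : b.coeff 0 < 0 := by
    by_contra! h
    have hpos : 0 < φ (b.coeff 0) := by
      have : 0 < b.coeff 0 := lt_of_le_of_ne h (Ne.symm hb)
      have h3 := (toOrd φ).monotone' this.le
      refine lt_of_le_of_ne (by simpa using h3) ?_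
      exact fun hc => hb ((map_eq_zero φ).1 hc.symm)
    have h4 : mk (φ (b.coeff 0)) < mk (b.eval₂ φ s - φ (b.coeff 0)) := by rw [mk_real φ _ hb]; exact h2
    have h5 : mk (φ (b.coeff 0)) < mk (-(b.eval₂ φ s - φ (b.coeff 0))) := by rwa [mk_neg]
    have := lt_of_mk_lt_mk_of_nonneg h5 hpos.le
    linarith
  have hc : Filter.Tendsto (fun x => b.eval x) (nhdsWithin 0 (Set.Ioi 0)) (nhds (b.eval 0)) :=
    (b.continuous.tendsto 0).mono_left nhdsWithin_le_nhds
  rw [← Polynomial.coeff_zero_eq_eval_zero] at hc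
  have := (hc.eventually (gt_mem_nhds hb0)).and self_mem_nhdsWithin
  obtain ⟨ε, h3, h4⟩ := this.exists
  refine ⟨ε, h4, ?_⟩
  rw [Polynomial.eval_mul, Polynomial.eval_pow, Polynomial.eval_X]
  exact mul_neg_of_pos_of_neg (pow_pos h4 m) h3

/-- clear denominators after substitution -/
lemma clear1 (a : ℝ[X]) : ∃ D0 : ℕ, ∀ D ≥ D0, ∀ w h : ℝ[X], ∃ Q : ℝ[X], ∀ (F : Type) [Field F]
    (φ : ℝ →+* F) (s : F), w.eval₂ φ s ≠ 0 →
      Q.eval₂ φ s = (w.eval₂ φ s) ^ D * a.eval₂ φ (h.eval₂ φ s / w.eval₂ φ s) := by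
  induction a using Polynomial.induction_on with
  | C a => exact ⟨0, fun D _ w h => ⟨w ^ D * Polynomial.C a, fun F _ φ s hw => by simp [Polynomial.eval₂_mul, Polynomial.eval₂_pow]⟩⟩
  | add p q hp hq =>
    obtain ⟨D1, h1⟩ := hp
    obtain ⟨D2, h2⟩ := hq
    refine ⟨max D1 D2, fun D hD w h => ?_⟩
    obtain ⟨Q1, hQ1⟩ := h1 D (le_trans (le_max_left _ _) hD) w h
    obtain ⟨Q2, hQ2⟩ := h2 D (le_trans (le_max_right _ _) hD) w h
    exact ⟨Q1 + Q2, fun F _ φ s hw => by rw [Polynomial.eval₂_add, hQ1 F φ s hw, hQ2 F φ s hw, Polynomial.eval₂_add]; ring⟩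
  | monomial n a ih =>
    refine ⟨n + 1, fun D hD w h => ⟨Polynomial.C a * h ^ (n+1) * w ^ (D - (n+1)), fun F _ φ s hw => ?_⟩⟩
    obtain ⟨k, rfl⟩ := Nat.exists_eq_add_of_le hD
    simp only [Polynomial.eval₂_mul, Polynomial.eval₂_pow, Polynomial.eval₂_C, Polynomial.eval₂_X, Nat.add_sub_cancel_left]
    rw [pow_add _ (n+1) k, div_pow]
    field_simp

lemma clear2 (p : ℝ[X][X]) : ∃ D0 : ℕ, ∀ D ≥ D0, ∀ w h g : ℝ[X], ∃ Q : ℝ[X], ∀ (F : Type) [Field F]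
    (φ : ℝ →+* F) (s : F), w.eval₂ φ s ≠ 0 →
      Q.eval₂ φ s = (w.eval₂ φ s) ^ D * p.eval₂ (Polynomial.eval₂RingHom φ (h.eval₂ φ s / w.eval₂ φ s))
        (g.eval₂ φ s / w.eval₂ φ s) := by
  induction p using Polynomial.induction_on' with
  | add p q hp hq =>
    obtain ⟨D1, h1⟩ := hp
    obtain ⟨D2, h2⟩ := hq
    refine ⟨max D1 D2, fun D hD w h g => ?_⟩
    obtain ⟨Q1, hQ1⟩ := h1 D (le_trans (le_max_left _ _) hD) w h g
    obtain ⟨Q2, hQ2⟩ := h2 D (le_trans (le_max_right _ _) hD) w h g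
    exact ⟨Q1 + Q2, fun F _ φ s hw => by rw [Polynomial.eval₂_add, hQ1 F φ s hw, hQ2 F φ s hw, Polynomial.eval₂_add]; ring⟩
  | monomial n a =>
    obtain ⟨D1, h1⟩ := clear1 a
    refine ⟨D1 + n, fun D hD w h g => ?_⟩
    obtain ⟨Q1, hQ1⟩ := h1 (D - n) (by omega) w h
    refine ⟨Q1 * g ^ n, fun F _ φ s hw => ?_⟩
    obtain ⟨k, hk⟩ : ∃ k, D = k + n := ⟨D - n, by omega⟩
    rw [Polynomial.eval₂_mul, hQ1 F φ s hw, hk, Polynomial.eval₂_pow, Polynomial.eval₂_monomial]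
    simp only [Nat.add_sub_cancel, Polynomial.coe_eval₂RingHom]
    rw [pow_add _ k n, div_pow]
    field_simp

theorem curve_lemma (φ : ℝ →+* E) (n : ℕ) (τ : E) (hτ : ∀ r : ℝ, τ ≠ φ r) (h : Alg φ n τ)
    (p : ℝ[X][X]) (ξ : E) (hp : p.eval₂ (Polynomial.eval₂RingHom φ τ) ξ < 0) :
    ∃ x t : ℝ, p.evalEval t x < 0 := by
  obtain ⟨ω, hω0, hω, hA⟩ := exists_inf φ n τ hτ h
  obtain ⟨s, hs, hs', hu⟩ := exists_unif φ n ω hω0 hω hA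
  letI : TopologicalSpace E := Preorder.topology E
  haveI : OrderTopology E := ⟨rfl⟩
  have hcont : Continuous (fun z : E × E => p.eval₂ (Polynomial.eval₂RingHom φ z.2) z.1) := by
    simp_rw [Polynomial.eval₂_eq_sum_range, Polynomial.coe_eval₂RingHom, Polynomial.eval₂_eq_sum_range]
    fun_prop
  have hopen := (hcont.continuousAt (x := (ξ, τ))).eventually (gt_mem_nhds (a := (0:E)) (by simpa using hp))
  rw [nhds_prod_eq] at hopen
  have hb : (nhds ξ ×ˢ nhds τ).HasBasis _ _ := (nhds_basis_abs_sub_lt ξ).prod (nhds_basis_abs_sub_lt τ)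
  obtain ⟨⟨d1, d2⟩, ⟨hd1, hd2⟩, hsub⟩ := hb.eventually_iff.1 hopen
  obtain ⟨L1, hL1⟩ := approx φ s hs hs' hu ξ d1 hd1
  obtain ⟨L2, hL2⟩ := approx φ s hs hs' hu τ d2 hd2
  obtain ⟨g, hg⟩ := hL1 (max L1 L2) (le_max_left _ _)
  obtain ⟨k, hk⟩ := hL2 (max L1 L2) (le_max_right _ _)
  set L := max L1 L2
  have hneg := hsub (x := (g.eval₂ φ s / s ^ L, k.eval₂ φ s / s ^ L)) ⟨hg, hk⟩
  simp only at hneg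
  obtain ⟨D0, hD0⟩ := clear2 p
  obtain ⟨Q, hQ⟩ := hD0 (2 * D0) (by omega) (Polynomial.X ^ L) k g
  have hw : (Polynomial.X ^ L : ℝ[X]).eval₂ φ s = s ^ L := by simp
  have h1 := hQ E φ s (by rw [hw]; positivity)
  rw [hw] at h1
  have h2 : Q.eval₂ φ s < 0 := by
    rw [h1]; exact mul_neg_of_pos_of_neg (by positivity) hneg
  obtain ⟨ε, hε, hQε⟩ := neg_transfer φ s hs hs' Q h2
  have h3 := hQ ℝ (RingHom.id ℝ) ε (by simp [hε.ne'])
  refine ⟨g.eval ε / ε ^ L, k.eval ε / ε ^ L, ?_⟩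
  have h4 : p.evalEval (k.eval ε / ε ^ L) (g.eval ε / ε ^ L) = p.eval₂ (Polynomial.eval₂RingHom (RingHom.id ℝ) (k.eval ε / ε ^ L)) (g.eval ε / ε ^ L) := by
    rw [← Polynomial.eval₂_evalRingHom]; rfl
  rw [h4]
  by_contra! hcon
  simp only [Polynomial.eval₂_id, Polynomial.eval_pow, Polynomial.eval_X] at h3
  rw [h3] at hQε
  have : 0 ≤ (ε ^ L) ^ (2 * D0) * p.eval₂ (Polynomial.eval₂RingHom (RingHom.id ℝ) (k.eval ε / ε ^ L)) (g.eval ε / ε ^ L) := mul_nonneg (by positivity) hcon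
  exact absurd hQε (not_lt.2 this)

end Curve

end Part2

section Part3
open scoped Polynomial

/-- one variable psd polynomial is a hermitian square -/
theorem one_var_sq : ∀ (n : ℕ) (a : ℝ[X]), a.natDegree ≤ n → (∀ t, 0 ≤ a.eval t) →
    ∃ h : ℂ[X], a.map (algebraMap ℝ ℂ) = h * h.map (starRingEnd ℂ) := by
  intro n
  induction n using Nat.strong_induction_on with
  | _ n ih =>
  intro a hn ha
  by_cases ha0 : a = 0
  · exact ⟨0, by simp [ha0]⟩
  by_cases hd : a.natDegree = 0
  · obtain ⟨c, rfl⟩ := Polynomial.natDegree_eq_zero.1 hd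
    have hc : 0 ≤ c := by simpa using ha 0
    refine ⟨Polynomial.C (Real.sqrt c : ℂ), ?_⟩
    rw [Polynomial.map_C, Polynomial.map_C, Complex.conj_ofReal, ← Polynomial.C_mul, ← Complex.ofReal_mul,
      Real.mul_self_sqrt hc]
    rfl
  · have hdeg : 0 < (a.map (algebraMap ℝ ℂ)).degree := by
      rw [Polynomial.degree_map]; exact Polynomial.natDegree_pos_iff_degree_pos.1 (Nat.pos_of_ne_zero hd)
    obtain ⟨z, hz⟩ := Complex.exists_root hdeg
    have hz' : Polynomial.aeval z a = 0 := by
      rw [Polynomial.IsRoot, Polynomial.eval_map] at hz; exact hz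
    have main : ∀ r b : ℝ[X], a = r * b → (0 < r.natDegree) → (∀ t, 0 ≤ r.eval t) →
        (∃ h : ℂ[X], r.map (algebraMap ℝ ℂ) = h * h.map (starRingEnd ℂ)) →
        ∃ h : ℂ[X], a.map (algebraMap ℝ ℂ) = h * h.map (starRingEnd ℂ) := by
      rintro r b hrb hr hrp ⟨h1, hh1⟩
      have hr0 : r ≠ 0 := by rintro rfl; simp at hr
      have hb0 : b ≠ 0 := by rintro rfl; simp at hrb; exact ha0 hrb
      have hbd : b.natDegree < n := by
        have := congrArg Polynomial.natDegree hrb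
        rw [Polynomial.natDegree_mul hr0 hb0] at this
        omega
      have hbp : ∀ t, 0 ≤ b.eval t := by
        have hdense : Dense {t : ℝ | r.eval t ≠ 0} := by
          have hf : {t : ℝ | r.eval t = 0}.Finite := by
            refine (r.roots.toFinset.finite_toSet).subset ?_
            intro t ht
            simp [hr0]; exact ht
          have : {t : ℝ | r.eval t ≠ 0} = {t : ℝ | r.eval t = 0}ᶜ := rfl
          rw [this]
          exact hf.countable.dense_compl ℝ
        have hcl : IsClosed {t : ℝ | 0 ≤ b.eval t} := isClosed_le continuous_const b.continuous
        have hsub : {t : ℝ | r.eval t ≠ 0} ⊆ {t : ℝ | 0 ≤ b.eval t} := by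
          intro t ht
          have h1 := ha t
          rw [hrb, Polynomial.eval_mul] at h1
          exact nonneg_of_mul_nonneg_right h1 (lt_of_le_of_ne (hrp t) (Ne.symm ht))
        intro t
        have := hcl.closure_subset_iff.2 hsub (hdense t)
        exact this
      obtain ⟨h2, hh2⟩ := ih _ hbd b le_rfl hbp
      refine ⟨h1 * h2, ?_⟩
      rw [hrb, Polynomial.map_mul, hh1, hh2, Polynomial.map_mul]; ring
    by_cases him : z.im = 0
    · obtain ⟨x, rfl⟩ : ∃ x : ℝ, z = x := ⟨z.re, by apply Complex.ext <;> simp [him]⟩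
      have hx : a.IsRoot x := by
        have h1 : Polynomial.aeval (algebraMap ℝ ℂ x) a = 0 := hz'
        rw [Polynomial.aeval_algebraMap_apply] at h1
        simpa using h1
      obtain ⟨b, hb⟩ := Polynomial.dvd_iff_isRoot.2 hx
      have hbx : b.IsRoot x := by
        by_contra hne
        have hne' : b.eval x ≠ 0 := hne
        have hc : ContinuousAt (fun t => b.eval t) x := b.continuous.continuousAt
        rcases lt_or_gt_of_ne hne' with h1 | h1
        · have := hc.eventually (gt_mem_nhds h1)
          have h2 : ∀ᶠ t in nhdsWithin x (Set.Ioi x), b.eval t < 0 := this.filter_mono nhdsWithin_le_nhds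
          obtain ⟨t, h3, h4⟩ := (h2.and self_mem_nhdsWithin).exists
          have h5 := ha t
          rw [hb] at h5
          simp only [Polynomial.eval_mul, Polynomial.eval_sub, Polynomial.eval_X, Polynomial.eval_C] at h5
          have : x < t := h4
          nlinarith
        · have := hc.eventually (lt_mem_nhds h1)
          have h2 : ∀ᶠ t in nhdsWithin x (Set.Iio x), 0 < b.eval t := this.filter_mono nhdsWithin_le_nhds
          obtain ⟨t, h3, h4⟩ := (h2.and self_mem_nhdsWithin).exists
          have h5 := ha t
          rw [hb] at h5
          simp only [Polynomial.eval_mul, Polynomial.eval_sub, Polynomial.eval_X, Polynomial.eval_C] at h5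
          have : t < x := h4
          nlinarith
      obtain ⟨c, hc⟩ := Polynomial.dvd_iff_isRoot.2 hbx
      refine main ((Polynomial.X - Polynomial.C x) ^ 2) c (by rw [hb, hc]; ring) ?_ ?_ ⟨Polynomial.X - Polynomial.C (x : ℂ), ?_⟩
      · rw [Polynomial.natDegree_pow, Polynomial.natDegree_X_sub_C]; norm_num
      · intro t; simp only [Polynomial.eval_pow]; positivity
      · simp [sq]
    · obtain ⟨c, hc⟩ := Polynomial.quadratic_dvd_of_aeval_eq_zero_im_ne_zero a hz' him
      refine main _ c hc ?_ ?_ ⟨Polynomial.X - Polynomial.C z, ?_⟩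
      · have : (Polynomial.X ^ 2 - Polynomial.C (2 * z.re) * Polynomial.X + Polynomial.C (‖z‖ ^ 2) : ℝ[X]).natDegree = 2 := by
          compute_degree!
        rw [this]; norm_num
      · intro t
        have : ‖z‖ ^ 2 = z.re ^ 2 + z.im ^ 2 := by rw [Complex.sq_norm, Complex.normSq_apply]; ring
        simp only [Polynomial.eval_add, Polynomial.eval_sub, Polynomial.eval_mul, Polynomial.eval_pow, Polynomial.eval_X, Polynomial.eval_C, this]
        nlinarith [sq_nonneg (t - z.re), sq_nonneg z.im]
      · have h1 : (algebraMap ℝ ℂ (2 * z.re)) = z + (starRingEnd ℂ) z := by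
          rw [Complex.add_conj]; simp
        have h2 : (algebraMap ℝ ℂ (‖z‖^2)) = z * (starRingEnd ℂ) z := by
          rw [Complex.mul_conj, Complex.normSq_eq_norm_sq]; simp
        simp only [Polynomial.map_add, Polynomial.map_sub, Polynomial.map_mul, Polynomial.map_pow, Polynomial.map_X, Polynomial.map_C]
        rw [h1, h2]
        simp only [map_add, map_mul]
        ring

theorem one_var_sos (a : ℝ[X]) (ha : ∀ t, 0 ≤ a.eval t) : IsSumSq a := by
  obtain ⟨h, hh⟩ := one_var_sq _ a le_rfl ha
  -- real and imaginary parts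
  let u : ℝ[X] := ∑ i ∈ Finset.range (h.natDegree + 1), Polynomial.monomial i (h.coeff i).re
  let v : ℝ[X] := ∑ i ∈ Finset.range (h.natDegree + 1), Polynomial.monomial i (h.coeff i).im
  have huv : h = u.map (algebraMap ℝ ℂ) + Polynomial.C Complex.I * v.map (algebraMap ℝ ℂ) := by
    conv_lhs => rw [h.as_sum_range]
    simp only [u, v, Polynomial.map_sum, Polynomial.map_monomial, Finset.mul_sum, ← Finset.sum_add_distrib,
      Polynomial.C_mul_monomial, ← map_add]
    refine Finset.sum_congr rfl fun i _ => ?_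
    congr 1
    conv_lhs => rw [← Complex.re_add_im (h.coeff i)]
    simp [mul_comm]
  have hc : ∀ w : ℝ[X], (w.map (algebraMap ℝ ℂ)).map (starRingEnd ℂ) = w.map (algebraMap ℝ ℂ) := by
    intro w
    rw [Polynomial.map_map]; congr 1; ext x; simp
  have h2 : a = u * u + v * v := by
    apply Polynomial.map_injective (algebraMap ℝ ℂ) (algebraMap ℝ ℂ).injective
    rw [hh, huv]
    simp only [Polynomial.map_add, Polynomial.map_mul, hc, Polynomial.map_C, Complex.conj_I]
    have : (Polynomial.C Complex.I * Polynomial.C Complex.I : ℂ[X]) = -1 := by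
      rw [← Polynomial.C_mul, Complex.I_mul_I]; simp
    simp only [Polynomial.C_neg]
    linear_combination (-(v.map (algebraMap ℝ ℂ))^2) * this
  rw [h2]
  exact (IsSumSq.mul_self u).add (IsSumSq.mul_self v)

end Part3

section Part4
open scoped Polynomial

lemma finite_zero_of_ne (r : ℝ[X]) (hr0 : r ≠ 0) : Dense {t : ℝ | r.eval t ≠ 0} := by
  have hf : {t : ℝ | r.eval t = 0}.Finite := by
    refine (r.roots.toFinset.finite_toSet).subset ?_
    intro t ht
    simp [hr0]; exact ht
  have : {t : ℝ | r.eval t ≠ 0} = {t : ℝ | r.eval t = 0}ᶜ := rfl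
  rw [this]
  exact hf.countable.dense_compl ℝ

lemma nonneg_of_dense {b : ℝ → ℝ} (hb : Continuous b) {S : Set ℝ} (hS : Dense S) (h : ∀ t ∈ S, 0 ≤ b t) (t : ℝ) :
    0 ≤ b t := by
  have hcl : IsClosed {t : ℝ | 0 ≤ b t} := isClosed_le continuous_const hb
  exact hcl.closure_subset_iff.2 (fun t ht => h t ht) (hS t)

lemma psd_of_dense (Z P : ℝ[X][X]) (hZ : Z ≠ 0)
    (h : ∀ t x, Z.evalEval t x ≠ 0 → 0 ≤ P.evalEval t x) (t x : ℝ) : 0 ≤ P.evalEval t x := by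
  have h1 : ∀ t, Z.leadingCoeff.eval t ≠ 0 → ∀ x, 0 ≤ P.evalEval t x := by
    intro t ht x
    have hne : Z.map (Polynomial.evalRingHom t) ≠ 0 := by
      intro hc
      apply ht
      have := congrArg (fun q => Polynomial.coeff q Z.natDegree) hc
      simpa [Polynomial.coeff_map] using this
    have := nonneg_of_dense (b := fun x => (P.map (Polynomial.evalRingHom t)).eval x)
      (Polynomial.continuous _) (finite_zero_of_ne _ hne) (fun x hx => by
        rw [Polynomial.map_evalRingHom_eval]
        apply h
        rw [← Polynomial.map_evalRingHom_eval]; exact hx) x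
    rwa [Polynomial.map_evalRingHom_eval] at this
  exact nonneg_of_dense (b := fun t => P.evalEval t x) (Polynomial.continuous _)
    (finite_zero_of_ne _ (Polynomial.leadingCoeff_ne_zero.2 hZ)) (fun t ht => h1 t ht x) t

abbrev KR := FractionRing ℝ[X]
abbrev iR : ℝ[X] →+* KR := algebraMap ℝ[X] KR

lemma iR_inj : Function.Injective iR := IsFractionRing.injective _ _

def PSDK (p : KR[X]) : Prop := ∃ d : ℝ[X], d ≠ 0 ∧ ∃ P : ℝ[X][X],
  P.map iR = Polynomial.C (iR d) ^ 2 * p ∧ ∀ t x, 0 ≤ P.evalEval t x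

lemma PSDK.add {p q : KR[X]} (hp : PSDK p) (hq : PSDK q) : PSDK (p + q) := by
  obtain ⟨d, hd, P, hP, h1⟩ := hp
  obtain ⟨e, he, Q, hQ, h2⟩ := hq
  refine ⟨d * e, mul_ne_zero hd he, Polynomial.C e ^ 2 * P + Polynomial.C d ^ 2 * Q, ?_, fun t x => ?_⟩
  · simp only [Polynomial.map_add, Polynomial.map_mul, Polynomial.map_pow, Polynomial.map_C, hP, hQ, map_mul]
    ring
  · simp only [Polynomial.evalEval_add, Polynomial.evalEval_mul, Polynomial.evalEval_pow]
    have := h1 t x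
    have := h2 t x
    positivity

lemma PSDK.mul {p q : KR[X]} (hp : PSDK p) (hq : PSDK q) : PSDK (p * q) := by
  obtain ⟨d, hd, P, hP, h1⟩ := hp
  obtain ⟨e, he, Q, hQ, h2⟩ := hq
  refine ⟨d * e, mul_ne_zero hd he, P * Q, ?_, fun t x => ?_⟩
  · simp only [Polynomial.map_mul, hP, hQ, map_mul]
    ring
  · simp only [Polynomial.evalEval_mul]
    exact mul_nonneg (h1 t x) (h2 t x)

lemma clearK (p : KR[X]) : ∃ d : ℝ[X], d ≠ 0 ∧ ∃ P : ℝ[X][X], P.map iR = Polynomial.C (iR d) * p := by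
  obtain ⟨b, hb, h⟩ := IsLocalization.integerNormalization_spec (nonZeroDivisors ℝ[X]) p
  refine ⟨b, nonZeroDivisors.ne_zero hb, _, h.trans ?_⟩
  rw [Algebra.smul_def]
  rfl

lemma PSDK.sq (p : KR[X]) : PSDK (p * p) := by
  obtain ⟨d, hd, P, hP⟩ := clearK p
  refine ⟨d, hd, P * P, ?_, fun t x => ?_⟩
  · rw [Polynomial.map_mul, hP]; ring
  · rw [Polynomial.evalEval_mul]; exact mul_self_nonneg _

lemma PSDK.of_sumSq {p : KR[X]} (h : IsSumSq p) : PSDK p := by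
  induction h with
  | zero => simpa using PSDK.sq 0
  | sq_add a hs ih => exact (PSDK.sq a).add ih

lemma PSDK.of_sq_mul {p h : KR[X]} (hh : h ≠ 0) (hp : PSDK (h ^ 2 * p)) : PSDK p := by
  obtain ⟨d, hd, P, hP, h1⟩ := hp
  obtain ⟨e, he, Q, hQ⟩ := clearK p
  obtain ⟨g, hg, H, hH⟩ := clearK h
  refine ⟨e, he, Polynomial.C e * Q, ?_, ?_⟩
  · rw [Polynomial.map_mul, hQ, Polynomial.map_C]; ring
  have hH0 : H ≠ 0 := by
    rintro rfl
    rw [Polynomial.map_zero, eq_comm, mul_eq_zero, Polynomial.C_eq_zero] at hH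
    rcases hH with h | h
    · exact hg (iR_inj (by simpa using h))
    · exact hh h
  have key : (Polynomial.C d * H) ^ 2 * (Polynomial.C e * Q) = (Polynomial.C g * Polynomial.C e) ^ 2 * P := by
    apply Polynomial.map_injective iR iR_inj
    simp only [Polynomial.map_mul, Polynomial.map_pow, Polynomial.map_C, hP, hQ, hH]
    ring
  apply psd_of_dense (Polynomial.C d * H) _ (mul_ne_zero (by simpa using hd) hH0)
  intro t x hne
  have h2 := congrArg (Polynomial.evalEval t x) key
  rw [Polynomial.evalEval_mul, Polynomial.evalEval_pow, Polynomial.evalEval_mul (p := (Polynomial.C g * Polynomial.C e) ^ 2), Polynomial.evalEval_pow (p := Polynomial.C g * Polynomial.C e)] at h2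
  have h3 : 0 < (Polynomial.evalEval t x (Polynomial.C d * H)) ^ 2 := by positivity
  have h4 := mul_nonneg (sq_nonneg (Polynomial.evalEval t x (Polynomial.C g * Polynomial.C e))) (h1 t x)
  rw [← h2] at h4
  exact nonneg_of_mul_nonneg_right h4 h3

lemma not_PSDK_neg_one : ¬ PSDK (-1) := by
  rintro ⟨d, hd, P, hP, h1⟩
  have : P = - (Polynomial.C d)^2 := by
    apply Polynomial.map_injective iR iR_inj
    simp only [hP, Polynomial.map_neg, Polynomial.map_pow, Polynomial.map_C]
    ring
  obtain ⟨t, ht⟩ := (finite_zero_of_ne d hd).nonempty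
  have h2 := h1 t 0
  rw [this] at h2
  rw [Polynomial.evalEval_neg, Polynomial.evalEval_pow, Polynomial.evalEval_C] at h2
  have : 0 < (d.eval t)^2 := by have : d.eval t ≠ 0 := ht; positivity
  linarith

def SOSK (p : KR[X]) : Prop := ∃ g : KR[X], g ≠ 0 ∧ IsSumSq (g * g * p)

lemma exists_neg_near {E : Type} [Field E] [LinearOrder E] [IsStrictOrderedRing E] (p w : E[X]) (ξ : E)
    (hw : p = (Polynomial.X - Polynomial.C ξ) * w) (hwξ : w.eval ξ ≠ 0) : ∃ ξ' : E, p.eval ξ' < 0 := by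
  letI : TopologicalSpace E := Preorder.topology E
  haveI : OrderTopology E := ⟨rfl⟩
  have hc : ContinuousAt (fun x => w.eval x) ξ := w.continuous.continuousAt
  rcases lt_or_gt_of_ne hwξ with h1 | h1
  · obtain ⟨δ, hδ, hsub⟩ := (nhds_basis_abs_sub_lt ξ).eventually_iff.1 (hc.eventually (gt_mem_nhds h1))
    refine ⟨ξ + δ / 2, ?_⟩
    have h2 := hsub (x := ξ + δ / 2) (by simp [abs_of_pos (half_pos hδ), hδ])
    rw [hw]
    simp only [Polynomial.eval_mul, Polynomial.eval_sub, Polynomial.eval_X, Polynomial.eval_C, add_sub_cancel_left]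
    exact mul_neg_of_pos_of_neg (half_pos hδ) h2
  · obtain ⟨δ, hδ, hsub⟩ := (nhds_basis_abs_sub_lt ξ).eventually_iff.1 (hc.eventually (lt_mem_nhds h1))
    refine ⟨ξ - δ / 2, ?_⟩
    have h2 := hsub (x := ξ - δ / 2) (by
      show |ξ - δ/2 - ξ| < δ
      rw [show ξ - δ/2 - ξ = -(δ/2) by ring, abs_neg, abs_of_pos (half_pos hδ)]; exact half_lt_self hδ)
    rw [hw]
    simp only [Polynomial.eval_mul, Polynomial.eval_sub, Polynomial.eval_X, Polynomial.eval_C]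
    exact mul_neg_of_neg_of_pos (by linarith [half_pos hδ]) h2

lemma contra_of_order {E : Type} [Field E] [LinearOrder E] [IsStrictOrderedRing E] [Algebra KR E] [FiniteDimensional KR E]
    (p : KR[X]) (ξ' : E) (hξ' : (p.map (algebraMap KR E)).eval ξ' < 0) (hp : PSDK p) : False := by
  let j : KR →+* E := algebraMap KR E
  obtain ⟨d, hd, P, hP, hpsd⟩ := hp
  let φ : ℝ →+* E := j.comp (iR.comp Polynomial.C)
  let τ : E := j (iR Polynomial.X)
  have hev : Polynomial.eval₂RingHom φ τ = j.comp iR := by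
    apply Polynomial.ringHom_ext
    · intro a; simp [φ]
    · simp [τ]
  have hneg : P.eval₂ (Polynomial.eval₂RingHom φ τ) ξ' < 0 := by
    rw [hev, ← Polynomial.eval₂_map, hP, Polynomial.eval₂_mul, Polynomial.eval₂_pow, Polynomial.eval₂_C, ← Polynomial.eval_map]
    refine mul_neg_of_pos_of_neg ?_ hξ'
    have : j (iR d) ≠ 0 := by
      rw [Ne, map_eq_zero]
      intro h; exact hd (iR_inj (by simpa using h))
    positivity
  have hτ : ∀ r : ℝ, τ ≠ φ r := by
    intro r h
    have h1 : j (iR (Polynomial.X)) = j (iR (Polynomial.C r)) := h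
    have h2 := iR_inj (j.injective h1)
    have := congrArg (fun q => Polynomial.coeff q 1) h2
    simp at this
  have hAlg : Curve.Alg φ (Module.finrank KR E) τ := by
    intro e
    have h_integral : IsIntegral KR e := Algebra.IsIntegral.isIntegral e
    obtain ⟨b, hb, M, hM⟩ := clearK (minpoly KR e)
    have hm0 : minpoly KR e ≠ 0 := minpoly.ne_zero h_integral
    have hM0 : M ≠ 0 := by
      rintro rfl
      rw [Polynomial.map_zero, eq_comm, mul_eq_zero, Polynomial.C_eq_zero] at hM
      rcases hM with h | h
      · exact hb (iR_inj (by simpa using h))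
      · exact hm0 h
    have hMd : M.natDegree < Module.finrank KR E + 1 := by
      have h1 : M.natDegree = (minpoly KR e).natDegree := by
        rw [← Polynomial.natDegree_map_eq_of_injective iR_inj, hM, Polynomial.natDegree_C_mul]
        intro h; exact hb (iR_inj (by simpa using h))
      have := minpoly.natDegree_le (A := KR) e
      omega
    refine ⟨fun i => M.coeff i, ⟨M.natDegree, by simpa using hMd, by simpa using hM0⟩, ?_⟩
    have h2 : M.eval₂ (j.comp iR) e = 0 := by
      rw [← Polynomial.eval₂_map, hM, Polynomial.eval₂_mul]
      have : Polynomial.eval₂ j e (minpoly KR e) = 0 := minpoly.aeval KR e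
      rw [this, mul_zero]
    rw [Polynomial.eval₂_eq_sum_range' _ hMd, ← hev] at h2
    exact h2
  obtain ⟨x, t, hxt⟩ := Curve.curve_lemma φ _ τ hτ hAlg P ξ' hneg
  exact absurd hxt (not_lt.2 (hpsd t x))

/-- the order case -/
lemma neg_of_order (p π ρ : KR[X]) (hπ : Irreducible π) (hpi : p = π * ρ) (hnd : ¬ π ∣ ρ)
    (hp : PSDK p) : IsSumSq (-1 : AdjoinRoot π) := by
  haveI : Fact (Irreducible π) := ⟨hπ⟩
  by_contra hns
  obtain ⟨lo, hord⟩ := exists_order_of_not_sumSq (AdjoinRoot π) hns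
  let E := AdjoinRoot π
  let j : KR →+* E := AdjoinRoot.of π
  let ξ : E := AdjoinRoot.root π
  -- continuity argument
  have hroot : (p.map j).IsRoot ξ := by
    rw [hpi, Polynomial.map_mul, Polynomial.IsRoot, Polynomial.eval_mul, Polynomial.eval_map, AdjoinRoot.eval₂_root, zero_mul]
  obtain ⟨w, hw⟩ := Polynomial.dvd_iff_isRoot.2 hroot
  have hwξ : w.eval ξ ≠ 0 := by
    have h1 : (Polynomial.derivative (p.map j)).eval ξ = w.eval ξ := by
      rw [hw]; simp
    have h2 : (Polynomial.derivative (p.map j)).eval ξ = ((Polynomial.derivative π).map j).eval ξ * (ρ.map j).eval ξ := by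
      rw [hpi, Polynomial.map_mul, Polynomial.derivative_mul, Polynomial.derivative_map, Polynomial.eval_add,
        Polynomial.eval_mul, Polynomial.eval_mul, Polynomial.eval_map (p := π), AdjoinRoot.eval₂_root]
      ring
    rw [← h1, h2]
    have hmk : ∀ q : KR[X], (q.map j).eval ξ = AdjoinRoot.mk π q := by
      intro q
      rw [Polynomial.eval_map, ← AdjoinRoot.aeval_eq]; rfl
    rw [hmk, hmk]
    refine mul_ne_zero ?_ ?_
    · rw [Ne, AdjoinRoot.mk_eq_zero]
      intro hdvd
      have hsep : π.Separable := hπ.separable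
      have := hsep.isUnit_of_dvd' dvd_rfl hdvd
      exact hπ.not_isUnit this
    · rw [Ne, AdjoinRoot.mk_eq_zero]; exact hnd
  obtain ⟨ξ', hξ'⟩ := exists_neg_near (E := AdjoinRoot π) (p.map j) w ξ hw hwξ
  haveI : FiniteDimensional KR (AdjoinRoot π) := (AdjoinRoot.powerBasis hπ.ne_zero).finite
  exact contra_of_order (E := AdjoinRoot π) p ξ' hξ' hp

lemma lift_sumSq (π : KR[X]) (hd : π.natDegree ≠ 0) {e : AdjoinRoot π} (he : IsSumSq e) :
    ∃ S : KR[X], IsSumSq S ∧ S.natDegree ≤ 2 * (π.natDegree - 1) ∧ AdjoinRoot.mk π S = e := by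
  induction he with
  | zero => exact ⟨0, IsSumSq.zero, by simp, by simp⟩
  | sq_add a hs ih =>
    obtain ⟨S, h1, h2, h3⟩ := ih
    obtain ⟨a', rfl⟩ := AdjoinRoot.mk_surjective a
    refine ⟨(a' % π) * (a' % π) + S, IsSumSq.sq_add _ h1, ?_, ?_⟩
    · refine (Polynomial.natDegree_add_le _ _).trans (max_le ?_ h2)
      have h4 := Polynomial.natDegree_mod_lt a' hd
      refine Polynomial.natDegree_mul_le.trans ?_
      omega
    · have h5 : AdjoinRoot.mk π (a' % π) = AdjoinRoot.mk π a' := by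
        rw [AdjoinRoot.mk_eq_mk]
        exact ⟨-(a' / π), by linear_combination EuclideanDomain.div_add_mod a' π⟩
      rw [map_add, map_mul, h5, h3]

lemma isSumSq_map {A B : Type} [CommRing A] [CommRing B] (g : A →+* B) {a : A} (h : IsSumSq a) : IsSumSq (g a) := by
  induction h with
  | zero => rw [map_zero]; exact IsSumSq.zero
  | sq_add a hs ih => rw [map_add, map_mul]; exact IsSumSq.sq_add _ ih

theorem hilbert17 : ∀ (n : ℕ) (p : KR[X]), p.natDegree ≤ n → PSDK p → SOSK p := by
  intro n
  induction n using Nat.strong_induction_on with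
  | _ n ih =>
  intro p hn hp
  by_cases hp0 : p = 0
  · exact ⟨1, one_ne_zero, by rw [hp0, mul_zero]; exact IsSumSq.zero⟩
  by_cases hd : p.natDegree = 0
  · obtain ⟨c, rfl⟩ := Polynomial.natDegree_eq_zero.1 hd
    obtain ⟨d, hd, P, hP, h1⟩ := hp
    have hPd : P.natDegree = 0 := by
      rw [← Polynomial.natDegree_map_eq_of_injective iR_inj, hP, ← Polynomial.C_pow, ← Polynomial.C_mul, Polynomial.natDegree_C]
    obtain ⟨a, rfl⟩ := Polynomial.natDegree_eq_zero.1 hPd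
    have ha : IsSumSq a := one_var_sos a (fun t => by have := h1 t 0; rwa [Polynomial.evalEval_C] at this)
    have hd' : iR d ≠ 0 := fun h => hd (iR_inj (by simpa using h))
    refine ⟨Polynomial.C (iR d), by simpa using hd', ?_⟩
    rw [← pow_two, ← hP, Polynomial.map_C]
    exact isSumSq_map Polynomial.C (isSumSq_map iR ha)
  · obtain ⟨π, hπ, ρ, hρ⟩ := Polynomial.exists_irreducible_of_natDegree_pos (Nat.pos_of_ne_zero hd)
    have hρ0 : ρ ≠ 0 := by rintro rfl; simp at hρ; exact hp0 hρ
    have hπd : 0 < π.natDegree := hπ.natDegree_pos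
    have hdeg : p.natDegree = π.natDegree + ρ.natDegree := by
      rw [hρ, Polynomial.natDegree_mul hπ.ne_zero hρ0]
    by_cases hdvd : π ∣ ρ
    · obtain ⟨r, hr⟩ := hdvd
      have hr0 : r ≠ 0 := by rintro rfl; simp at hr; exact hρ0 hr
      have hdr : ρ.natDegree = π.natDegree + r.natDegree := by
        rw [hr, Polynomial.natDegree_mul hπ.ne_zero hr0]
      have hpr : p = π ^ 2 * r := by rw [hρ, hr]; ring
      obtain ⟨g, hg, hs⟩ := ih r.natDegree (by omega) r le_rfl (PSDK.of_sq_mul hπ.ne_zero (hpr ▸ hp))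
      refine ⟨g, hg, ?_⟩
      rw [show g * g * p = (π * π) * (g * g * r) by rw [hpr]; ring]
      exact (IsSumSq.mul_self π).mul hs
    · obtain ⟨S, hS, hSd, hSe⟩ := lift_sumSq π hπd.ne' (neg_of_order p π ρ hπ hρ hdvd hp)
      have hσs : IsSumSq (1 + S) := by
        have := IsSumSq.sq_add (1:KR[X]) hS
        simpa using this
      obtain ⟨g, hg⟩ : π ∣ 1 + S := by
        rw [← AdjoinRoot.mk_eq_zero, map_add, hSe, map_one]; ring
      have hσ0 : 1 + S ≠ 0 := by
        intro h
        apply not_PSDK_neg_one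
        have : S = -1 := by linear_combination h
        rw [← this]; exact PSDK.of_sumSq hS
      have hg0 : g ≠ 0 := by rintro rfl; rw [mul_zero] at hg; exact hσ0 hg
      have hgd : g.natDegree < π.natDegree := by
        have h1 := congrArg Polynomial.natDegree hg
        rw [Polynomial.natDegree_mul hπ.ne_zero hg0] at h1
        have h2 : (1 + S).natDegree ≤ 2 * (π.natDegree - 1) :=
          (Polynomial.natDegree_add_le _ _).trans (max_le (by simp) hSd)
        omega
      have hps : PSDK (π ^ 2 * (ρ * g)) := by
        have := hp.mul (PSDK.of_sumSq hσs)
        rwa [show p * (1 + S) = π ^ 2 * (ρ * g) by rw [hg, hρ]; ring] at this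
      have hps' := PSDK.of_sq_mul hπ.ne_zero hps
      obtain ⟨G, hG, hGs⟩ := ih (ρ * g).natDegree (by rw [Polynomial.natDegree_mul hρ0 hg0]; omega) _ le_rfl hps'
      refine ⟨G * g, mul_ne_zero hG hg0, ?_⟩
      rw [show G * g * (G * g) * p = (1 + S) * (G * G * (ρ * g)) by rw [hg, hρ]; ring]
      exact hσs.mul hGs

theorem hilbert17' (P : ℝ[X][X]) (h : ∀ t x, 0 ≤ P.evalEval t x) : SOSK (P.map iR) :=
  hilbert17 _ _ le_rfl ⟨1, one_ne_zero, P, by simp, h⟩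

end Part4

section Part5
open scoped Polynomial
open Matrix
open scoped ComplexOrder

instance polyStarRing {R : Type} [CommRing R] [StarRing R] : StarRing R[X] where
  star p := p.map (starRingEnd R)
  star_involutive p := by
    ext n; simp [Polynomial.coeff_map]
  star_mul p q := by
    show Polynomial.map _ _ = _
    rw [Polynomial.map_mul, mul_comm]
  star_add p q := Polynomial.map_add _

lemma polyStar_def {R : Type} [CommRing R] [StarRing R] (p : R[X]) : star p = p.map (starRingEnd R) := rfl

lemma polyStar_coeff {R : Type} [CommRing R] [StarRing R] (p : R[X]) (n : ℕ) : (star p).coeff n = star (p.coeff n) := by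
  rw [polyStar_def, Polynomial.coeff_map]; rfl

lemma polyStar_C {R : Type} [CommRing R] [StarRing R] (a : R) : star (Polynomial.C a) = Polynomial.C (star a) := by
  rw [polyStar_def, Polynomial.map_C]; rfl

lemma polyStar_X {R : Type} [CommRing R] [StarRing R] : star (Polynomial.X : R[X]) = Polynomial.X := by
  rw [polyStar_def, Polynomial.map_X]

lemma polyStar_eval {R : Type} [CommRing R] [StarRing R] (p : R[X]) (x : R) : (star p).eval (star x) = star (p.eval x) := by
  rw [polyStar_def, Polynomial.eval_map]
  exact (Polynomial.hom_eval₂ p (RingHom.id R) (starRingEnd R) x).symm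

lemma polyStar_natDegree {R : Type} [CommRing R] [StarRing R] (p : R[X]) : (star p).natDegree = p.natDegree := by
  rw [polyStar_def]
  exact Polynomial.natDegree_map_eq_of_injective (star_injective) p

instance fracStarRing {A : Type} [CommRing A] [IsDomain A] [StarRing A] : StarRing (FractionRing A) where
  star x := IsFractionRing.ringEquivOfRingEquiv (K := FractionRing A) (L := FractionRing A) (starRingAut (R := A)) x
  star_involutive x := by
    obtain ⟨a, b, hb, rfl⟩ := IsFractionRing.div_surjective A x
    simp only [map_div₀, IsFractionRing.ringEquivOfRingEquiv_algebraMap, starRingAut_apply, star_star]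
  star_mul p q := by rw [map_mul, mul_comm]
  star_add p q := map_add _ _ _

lemma fracStar_algebraMap {A : Type} [CommRing A] [IsDomain A] [StarRing A] (a : A) :
    star (algebraMap A (FractionRing A) a) = algebraMap A (FractionRing A) (star a) :=
  IsFractionRing.ringEquivOfRingEquiv_algebraMap _ _

lemma psd_row_zero {n : ℕ} (M : Matrix (Fin (n+1)) (Fin (n+1)) ℂ) (hM : M.PosSemidef) (h0 : M 0 0 = 0) (c) : M 0 c = 0 := by
  have h := (hM.dotProduct_mulVec_zero_iff (Pi.single 0 1)).1 (by simp [h0])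
  have h2 := congrFun h c
  simp at h2
  rw [← hM.isHermitian.apply, h2, star_zero]

/-- scaled Schur complement -/
def schurC {R : Type} [CommRing R] {n : ℕ} (M : Matrix (Fin (n+1)) (Fin (n+1)) R) : Matrix (Fin n) (Fin n) R :=
  Matrix.of fun c d => M 0 0 * M c.succ d.succ - M c.succ 0 * M 0 d.succ

lemma psd_schurC {n : ℕ} (M : Matrix (Fin (n+1)) (Fin (n+1)) ℂ) (hM : M.PosSemidef) : (schurC M).PosSemidef := by
  by_cases h0 : M 0 0 = 0
  · have : schurC M = 0 := by
      ext c d; simp [schurC, h0, psd_row_zero M hM h0]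
    rw [this]; exact Matrix.PosSemidef.zero
  · let K : Matrix (Fin (n+1)) (Fin n) ℂ := Matrix.of fun i d => Fin.cases (- M 0 d.succ) (fun j => if j = d then M 0 0 else 0) i
    have hh := fun i j => hM.isHermitian.apply i j
    have hK : schurC M = (M 0 0)⁻¹ • (Kᴴ * M * K) := by
      ext c d
      simp only [Matrix.smul_apply, Matrix.mul_apply, Fin.sum_univ_succ, K, Matrix.conjTranspose_apply, schurC, Matrix.of_apply]
      simp [Finset.sum_add_distrib, hh, apply_ite]
      field_simp
      ring
    rw [hK]
    have h1 : 0 ≤ M 0 0 := hM.diag_nonneg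
    exact (hM.conjTranspose_mul_mul_same K).smul (inv_nonneg.2 h1)

theorem matrix_sos {R F S : Type} [CommRing R] [StarRing R] [Field F] [StarRing F] (ι : R →+* F)
    (hι : Function.Injective ι) (hιs : ∀ r, ι (star r) = star (ι r))
    (ev : S → R →+* ℂ) (hevs : ∀ s r, ev s (star r) = star (ev s r))
    (hsep : ∀ r, (∀ s, ev s r = 0) → r = 0) (b : Prop)
    (hsc : ∀ r : R, star r = r → (∀ s, 0 ≤ ev s r) → ∃ (J : Type) (_ : Fintype J) (h : J → F),
      (b → Subsingleton J) ∧ ι r = ∑ j, star (h j) * h j) :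
    ∀ (n : ℕ) (T : Matrix (Fin n) (Fin n) R), (∀ s, (T.map (ev s)).PosSemidef) →
    ∃ (J : Type) (_ : Fintype J) (_ : DecidableEq J) (H : Matrix J (Fin n) F), Hᴴ * H = T.map ι ∧
      (b → ∀ y : J → F, y ᵥ* H = 0 → y = 0) := by
  intro n
  induction n with
  | zero =>
    intro T hT
    exact ⟨Empty, inferInstance, inferInstance, 0, by ext i; exact i.elim0, fun _ y _ => Subsingleton.elim _ _⟩
  | succ n ih =>
    intro T hT
    have hTh : ∀ i j, star (T i j) = T j i := by
      intro i j
      apply sub_eq_zero.1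
      apply hsep
      intro s
      rw [map_sub, hevs, sub_eq_zero]
      exact (hT s).isHermitian.apply j i
    by_cases h0 : T 0 0 = 0
    · have hrow : ∀ c, T 0 c = 0 := by
        intro c
        apply hsep
        intro s
        exact psd_row_zero _ (hT s) (by simp [h0]) c
      have hcol : ∀ c, T c 0 = 0 := by intro c; rw [← hTh, hrow, star_zero]
      obtain ⟨J, _, _, H, hH, hb⟩ := ih (T.submatrix Fin.succ Fin.succ) (fun s => (hT s).submatrix Fin.succ)
      refine ⟨J, inferInstance, inferInstance, Matrix.of fun i c => Fin.cases 0 (fun c => H i c) c, ?_, ?_⟩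
      · ext c d
        rw [Matrix.mul_apply]
        simp only [Matrix.conjTranspose_apply, Matrix.of_apply, Matrix.map_apply]
        refine Fin.cases ?_ (fun c => ?_) c
        · simp [hrow]
        · refine Fin.cases ?_ (fun d => ?_) d
          · simp [hcol]
          · have := congrFun (congrFun hH c) d
            simpa [Matrix.mul_apply] using this
      · intro hb' y hy
        apply hb hb'
        ext c
        have := congrFun hy c.succ
        simpa [Matrix.vecMul, dotProduct] using this
    · have h0' : ι (T 0 0) ≠ 0 := fun h => h0 (hι (by simpa using h))
      obtain ⟨K, _, h, hKb, hK⟩ := hsc (T 0 0) (hTh 0 0) (fun s => (hT s).diag_nonneg)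
      obtain ⟨J, _, _, H, hH, hb⟩ := ih (schurC T) (fun s => by
        have : (schurC T).map (ev s) = schurC (T.map (ev s)) := by
          ext c d; simp [schurC]
        rw [this]; exact psd_schurC _ (hT s))
      have hst : star (ι (T 0 0)) = ι (T 0 0) := by rw [← hιs, hTh]
      let G : Matrix (K ⊕ (K × J)) (Fin (n+1)) F := Matrix.of fun i c => Sum.elim (fun j => h j * ι (T 0 c) / ι (T 0 0))
        (fun p => Fin.cases 0 (fun c => h p.1 * H p.2 c / ι (T 0 0)) c) i
      classical
      refine ⟨K ⊕ (K × J), inferInstance, inferInstance, G, ?_, ?_⟩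
      · ext c d
        rw [Matrix.mul_apply, Fintype.sum_sum_type, Fintype.sum_prod_type]
        simp only [Matrix.conjTranspose_apply, Matrix.of_apply, Matrix.map_apply, G, Sum.elim_inl, Sum.elim_inr]
        have e1 : ∑ j, star (h j * ι (T 0 c) / ι (T 0 0)) * (h j * ι (T 0 d) / ι (T 0 0)) = ι (T c 0) * ι (T 0 d) / ι (T 0 0) := by
          have : ∀ j, star (h j * ι (T 0 c) / ι (T 0 0)) * (h j * ι (T 0 d) / ι (T 0 0)) =
              (star (h j) * h j) * (ι (T c 0) * ι (T 0 d) / (ι (T 0 0))^2) := by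
            intro j
            rw [star_div₀, star_mul, hst, ← hιs, hTh]
            field_simp
          rw [Finset.sum_congr rfl (fun j _ => this j), ← Finset.sum_mul, ← hK]
          field_simp
        rw [e1]
        refine Fin.cases ?_ (fun c => ?_) c
        · simp; field_simp
        · refine Fin.cases ?_ (fun d => ?_) d
          · simp; field_simp
          · have e2 := congrFun (congrFun hH c) d
            simp only [Matrix.mul_apply, Matrix.conjTranspose_apply, Matrix.of_apply, Matrix.map_apply, schurC, map_sub, map_mul] at e2
            simp only [Fin.cases_succ]
            have : ∀ j i, star (h j * H i c / ι (T 0 0)) * (h j * H i d / ι (T 0 0)) =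
              (star (h j) * h j) * ((star (H i c) * H i d) / (ι (T 0 0))^2) := by
              intro j i
              rw [star_div₀, star_mul, hst]
              field_simp
            simp_rw [this, ← Finset.mul_sum, ← Finset.sum_mul, ← hK, ← Finset.sum_div, e2]
            field_simp
            ring
      · intro hb' y hy
        haveI := hKb hb'
        have hex : ∃ j, h j ≠ 0 := by
          by_contra hc
          push Not at hc
          apply h0'
          rw [hK]; simp [hc]
        obtain ⟨j, hj⟩ := hex
        have hall : ∀ i, i = j := fun i => Subsingleton.elim _ _
        letI : Unique K := ⟨⟨j⟩, hall⟩
        have hdef : (default : K) = j := rfl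
        have hy1 : y (Sum.inl j) = 0 := by
          have := congrFun hy 0
          simp only [Matrix.vecMul, dotProduct, Fintype.sum_sum_type, Fintype.sum_prod_type, G, Matrix.of_apply] at this
          simpa [hj, h0', hdef] using this
        have hy2 : (fun i => y (Sum.inr (j, i))) = 0 := by
          apply hb hb'
          ext c
          have := congrFun hy c.succ
          simp only [Matrix.vecMul, dotProduct, Fintype.sum_sum_type, Fintype.sum_prod_type, G, Matrix.of_apply] at this
          simp only [Fintype.sum_unique, hdef, hy1, Sum.elim_inr, Fin.cases_succ, zero_mul, zero_add, Pi.zero_apply] at this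
          have e3 : ∀ i, y (Sum.inr (j, i)) * (h j * H i c / ι (T 0 0)) = (y (Sum.inr (j, i)) * H i c) * (h j / ι (T 0 0)) := by
            intro i; ring
          simp_rw [e3, ← Finset.sum_mul] at this
          rcases mul_eq_zero.1 this with h | h
          · exact h
          · exact absurd h (div_ne_zero hj h0')
        ext i
        rcases i with i | ⟨i, i'⟩
        · rw [hall i, hy1]; rfl
        · rw [hall i]; exact congrFun hy2 i'

end Part5

section Part6
open scoped Polynomial
open Matrix
open scoped ComplexOrder

abbrev rc : ℝ[X] →+* ℂ[X] := Polynomial.mapRingHom (algebraMap ℝ ℂ)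

lemma rc_inj : Function.Injective rc := Polynomial.map_injective _ (algebraMap ℝ ℂ).injective

lemma real_lift (p : ℂ[X]) (h : star p = p) : ∃ a : ℝ[X], rc a = p := by
  have : p ∈ (Polynomial.mapRingHom (algebraMap ℝ ℂ)).range := by
    rw [Polynomial.mem_map_range]
    intro n
    have h1 : star (p.coeff n) = p.coeff n := by rw [← polyStar_coeff, h]
    exact ⟨(p.coeff n).re, Complex.conj_eq_iff_re.1 h1⟩
  exact this

lemma real_lift2 (p : ℂ[X][X]) (h : star p = p) : ∃ a : ℝ[X][X], a.map rc = p := by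
  have : p ∈ (Polynomial.mapRingHom rc).range := by
    rw [Polynomial.mem_map_range]
    intro n
    have h1 : star (p.coeff n) = p.coeff n := by rw [← polyStar_coeff, h]
    exact real_lift _ h1
  exact this

lemma poly_zero_of_real (p : ℂ[X]) (h : ∀ t : ℝ, p.eval (t : ℂ) = 0) : p = 0 := by
  apply Polynomial.eq_zero_of_infinite_isRoot
  refine Set.Infinite.mono (s := Set.range ((↑) : ℝ → ℂ)) ?_ (Set.infinite_range_of_injective Complex.ofReal_injective)
  rintro _ ⟨t, rfl⟩
  exact h t

abbrev kC := FractionRing ℂ[X]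

/-- evaluation homs -/
abbrev ev1 (t : ℝ) : ℂ[X] →+* ℂ := Polynomial.evalRingHom (t : ℂ)
abbrev ev2 (s : ℝ × ℝ) : ℂ[X][X] →+* ℂ := Polynomial.evalEvalRingHom (s.1 : ℂ) (s.2 : ℂ)

lemma ev1_star (t : ℝ) (r : ℂ[X]) : ev1 t (star r) = star (ev1 t r) := by
  have := polyStar_eval r (t : ℂ)
  simpa using this

lemma polyStar_evalEval (r : ℂ[X][X]) (t x : ℂ) : (star r).evalEval (star t) (star x) = star (r.evalEval t x) := by
  unfold Polynomial.evalEval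
  rw [← polyStar_eval, ← polyStar_eval, polyStar_C]

lemma ev2_star (s : ℝ × ℝ) (r : ℂ[X][X]) : ev2 s (star r) = star (ev2 s r) := by
  have := polyStar_evalEval r (s.1 : ℂ) (s.2 : ℂ)
  simpa using this

lemma ev2_sep (r : ℂ[X][X]) (h : ∀ s, ev2 s r = 0) : r = 0 := by
  have h1 : ∀ t : ℝ, r.map (Polynomial.evalRingHom (t : ℂ)) = 0 := by
    intro t
    apply poly_zero_of_real
    intro x
    rw [Polynomial.map_evalRingHom_eval]
    exact h (t, x)
  ext1 n
  apply poly_zero_of_real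
  intro t
  have := congrArg (fun q => Polynomial.coeff q n) (h1 t)
  simpa [Polynomial.coeff_map] using this

theorem matrix_sos1 (n : ℕ) (T : Matrix (Fin n) (Fin n) ℂ[X]) (hT : ∀ s, (T.map (ev1 s)).PosSemidef) :
    ∃ (J : Type) (_ : Fintype J) (_ : DecidableEq J) (H : Matrix J (Fin n) kC), Hᴴ * H = T.map (algebraMap ℂ[X] kC) ∧
      (∀ y : J → kC, y ᵥ* H = 0 → y = 0) := by
  obtain ⟨J, i1, i2, H, h1, h2⟩ := matrix_sos (algebraMap ℂ[X] kC) (IsFractionRing.injective _ _)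
    (fun r => (fracStar_algebraMap r).symm) ev1 ev1_star (fun r h => poly_zero_of_real r h) True (by
    intro r hr hpos
    obtain ⟨a, rfl⟩ := real_lift r hr
    have ha : ∀ t, 0 ≤ a.eval t := by
      intro t
      have := hpos t
      simp only [ev1, rc, Polynomial.coe_mapRingHom, Polynomial.coe_evalRingHom] at this
      rw [show (t : ℂ) = algebraMap ℝ ℂ t from rfl, Polynomial.eval_map_algebraMap, Polynomial.aeval_algebraMap_apply] at this
      simpa using this
    obtain ⟨h, hh⟩ := one_var_sq _ a le_rfl ha
    refine ⟨Unit, inferInstance, fun _ => algebraMap ℂ[X] kC h, fun _ => inferInstance, ?_⟩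
    simp only [Finset.univ_unique, Finset.sum_const, Finset.card_singleton, one_smul]
    rw [fracStar_algebraMap, ← map_mul, mul_comm, polyStar_def, ← hh]
    rfl) n T hT
  exact ⟨J, i1, i2, H, h1, h2 trivial⟩

lemma isSumSq_fintype {A : Type} [CommRing A] {s : A} (h : IsSumSq s) : ∃ (J : Type) (_ : Fintype J) (g : J → A), s = ∑ j, g j * g j := by
  induction h with
  | zero => exact ⟨Empty, inferInstance, fun _ => 0, by simp⟩
  | sq_add a hs ih =>
    obtain ⟨J, _, g, rfl⟩ := ih
    exact ⟨Option J, inferInstance, fun o => o.elim a g, by simp [Fintype.sum_option]⟩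

def κ : KR →+* kC := IsFractionRing.map (K := KR) (L := kC) rc_inj

lemma κ_alg (a : ℝ[X]) : κ (iR a) = algebraMap ℂ[X] kC (rc a) := by
  unfold κ IsFractionRing.map
  exact IsLocalization.map_eq (M := nonZeroDivisors ℝ[X]) (T := nonZeroDivisors ℂ[X]) _ _

lemma star_rc (a : ℝ[X]) : star (rc a) = rc a := by
  ext n
  rw [polyStar_coeff]
  simp [rc, Polynomial.coeff_map]

lemma κ_star (a : KR) : star (κ a) = κ a := by
  obtain ⟨a, b, hb, rfl⟩ := IsFractionRing.div_surjective ℝ[X] a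
  rw [map_div₀, star_div₀]
  erw [κ_alg, κ_alg]
  rw [fracStar_algebraMap, fracStar_algebraMap, star_rc, star_rc]

lemma κ_map_star (p : KR[X]) : star (p.map κ) = p.map κ := by
  ext1 n
  rw [polyStar_coeff, Polynomial.coeff_map, κ_star]

abbrev Fr := FractionRing kC[X]

def ι2 : ℂ[X][X] →+* Fr := (algebraMap kC[X] Fr).comp (Polynomial.mapRingHom (algebraMap ℂ[X] kC))

lemma ι2_inj : Function.Injective ι2 :=
  (IsFractionRing.injective kC[X] Fr).comp (Polynomial.map_injective _ (IsFractionRing.injective _ _))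

lemma map_star_alg (r : ℂ[X][X]) : (star r).map (algebraMap ℂ[X] kC) = star (r.map (algebraMap ℂ[X] kC)) := by
  ext1 n
  rw [polyStar_coeff, Polynomial.coeff_map, Polynomial.coeff_map, polyStar_coeff, fracStar_algebraMap]

lemma ι2_star (r : ℂ[X][X]) : ι2 (star r) = star (ι2 r) := by
  simp only [ι2, RingHom.comp_apply]
  rw [fracStar_algebraMap]
  congr 1
  exact map_star_alg r

theorem matrix_sos2 (n : ℕ) (T : Matrix (Fin n) (Fin n) ℂ[X][X]) (hT : ∀ s, (T.map (ev2 s)).PosSemidef) :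
    ∃ (J : Type) (_ : Fintype J) (_ : DecidableEq J) (H : Matrix J (Fin n) Fr), Hᴴ * H = T.map ι2 := by
  obtain ⟨J, i1, i2, H, h1, h2⟩ := matrix_sos ι2 ι2_inj ι2_star ev2 ev2_star ev2_sep False (by
    intro r hr hpos
    obtain ⟨a, rfl⟩ := real_lift2 r hr
    have ha : ∀ t x, 0 ≤ a.evalEval t x := by
      intro t x
      have := hpos (t, x)
      have e : ev2 (t, x) (a.map rc) = ((a.evalEval t x : ℝ) : ℂ) := by
        have h1 : (ev2 (t, x)).comp (Polynomial.mapRingHom rc) = (algebraMap ℝ ℂ).comp (Polynomial.evalEvalRingHom t x) := by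
          apply Polynomial.ringHom_ext'
          · apply Polynomial.ringHom_ext
            · intro c; simp [Polynomial.evalEval_C]
            · simp [Polynomial.evalEval_C]
          · simp
        exact congrArg (fun φ : ℝ[X][X] →+* ℂ => φ a) h1
      rw [e] at this
      exact_mod_cast this
    obtain ⟨g, hg, hs⟩ := hilbert17' a ha
    obtain ⟨J, _, h, hh⟩ := isSumSq_fintype hs
    let ψ : KR[X] →+* Fr := (algebraMap kC[X] Fr).comp (Polynomial.mapRingHom κ)
    have hψi : Function.Injective ψ := (IsFractionRing.injective kC[X] Fr).comp (Polynomial.map_injective _ κ.injective)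
    have hψs : ∀ p, star (ψ p) = ψ p := by
      intro p
      simp only [ψ, RingHom.comp_apply]
      rw [fracStar_algebraMap]
      congr 1
      exact κ_map_star p
    have hψa : ι2 (a.map rc) = ψ (a.map iR) := by
      simp only [ι2, ψ, RingHom.comp_apply, Polynomial.coe_mapRingHom, Polynomial.map_map]
      congr 2
      exact RingHom.ext (fun x => (κ_alg x).symm)
    have hg0 : ψ g ≠ 0 := fun h => hg (hψi (by simpa using h))
    refine ⟨J, inferInstance, fun j => ψ (h j) / ψ g, False.elim, ?_⟩
    simp_rw [star_div₀, hψs]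
    have := congrArg ψ hh
    simp only [map_mul, map_sum] at this
    have e : ∀ j, ψ (h j) / ψ g * (ψ (h j) / ψ g) = ψ (h j) * ψ (h j) / (ψ g * ψ g) := by intro j; field_simp
    simp_rw [e, ← Finset.sum_div, ← this, hψa]
    field_simp) n T hT
  exact ⟨J, i1, i2, H, h1⟩

end Part6

section Part7
open scoped Polynomial
open Matrix
open scoped ComplexOrder

lemma lat {A F : Type} [CommRing A] [IsDomain A] [IsPrincipalIdealRing A] [Field F] [Algebra A F] [IsFractionRing A F]
    {J r : Type} [Fintype J] [DecidableEq J] [Fintype r] (Q : Matrix J r F) (R : Matrix r J F) (hQR : Q * R = 1) :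
    ∃ (S S' : Matrix J J F) (Y : Matrix r J A) (Z : Matrix J r A), S * S' = 1 ∧ S' * S = 1 ∧
      S = Q * Y.map (algebraMap A F) ∧ Q = S * Z.map (algebraMap A F) := by
  let M : Submodule A (J → F) := Submodule.span A (Set.range fun j : r => fun i => Q i j)
  haveI hM : Submodule.IsLattice F M := by
    refine ⟨Submodule.fg_span (Set.finite_range _), ?_⟩
    rw [eq_top_iff]
    intro v _
    have : v = ∑ j, ((R *ᵥ v) j) • (fun i => Q i j) := by
      have h1 : v = Q *ᵥ (R *ᵥ v) := by rw [Matrix.mulVec_mulVec, hQR, Matrix.one_mulVec]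
      nth_rewrite 1 [h1]
      ext i
      simp [Matrix.mulVec, dotProduct, Finset.sum_apply, mul_comm]
    rw [this]
    exact Submodule.sum_mem _ (fun j _ => Submodule.smul_mem _ _ (Submodule.subset_span (Submodule.subset_span ⟨j, rfl⟩)))
  haveI : Module.Free A M := Submodule.IsLattice.free F M
  haveI : Module.Finite A M := Submodule.IsLattice.finite F M
  have hfr : Module.finrank A M = Fintype.card J := Submodule.IsLattice.finrank_of_pi F M
  let b : Module.Basis J A M := (Module.finBasisOfFinrankEq A M hfr).reindex (Fintype.equivFin J).symm
  let S : Matrix J J F := Matrix.of fun i j => (b j : J → F) i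
  have hY : ∀ j, ∃ c : r → A, ∑ l, c l • (fun i => Q i l) = (b j : J → F) := fun j =>
    (Submodule.mem_span_range_iff_exists_fun A).1 (b j).2
  choose Y hY using hY
  have hq : ∀ l : r, (fun i => Q i l) ∈ M := fun l => Submodule.subset_span ⟨l, rfl⟩
  let Z : Matrix J r A := Matrix.of fun j l => b.repr ⟨_, hq l⟩ j
  have hQ : Q = S * Z.map (algebraMap A F) := by
    ext i l
    have h1 := b.sum_repr ⟨_, hq l⟩
    have h2 := congrFun (congrArg Subtype.val h1) i
    simp only [Submodule.coe_sum, Submodule.coe_smul, Finset.sum_apply, Pi.smul_apply] at h2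
    rw [← h2, Matrix.mul_apply]
    refine Finset.sum_congr rfl (fun j _ => ?_)
    simp [S, Z, Algebra.smul_def, mul_comm]
  have hS : S * (Z.map (algebraMap A F) * R) = 1 := by rw [← Matrix.mul_assoc, ← hQ, hQR]
  refine ⟨S, Z.map (algebraMap A F) * R, Matrix.of fun l j => Y j l, Z, hS, mul_eq_one_comm.1 hS, ?_, hQ⟩
  ext i j
  have := congrFun (hY j) i
  simp only [Finset.sum_apply, Pi.smul_apply] at this
  rw [Matrix.mul_apply]
  simp only [S, Matrix.of_apply, ← this, Matrix.map_apply, Algebra.smul_def, mul_comm]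

end Part7

section Part8
open scoped Polynomial
open Matrix
open scoped ComplexOrder

def MInt (A : Type) {F : Type} [CommRing A] [Field F] [Algebra A F] {m n : Type} (M : Matrix m n F) : Prop :=
  ∃ N : Matrix m n A, M = N.map (algebraMap A F)

section
variable {A F : Type} [CommRing A] [Field F] [Algebra A F] {m n l : Type}

lemma MInt.map (N : Matrix m n A) : MInt A (N.map (algebraMap A F)) := ⟨N, rfl⟩

lemma MInt.mul [Fintype n] {M : Matrix m n F} {N : Matrix n l F} (hM : MInt A M) (hN : MInt A N) : MInt A (M * N) := by
  obtain ⟨M, rfl⟩ := hM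
  obtain ⟨N, rfl⟩ := hN
  exact ⟨M * N, by rw [Matrix.map_mul]⟩

lemma MInt.add {M : Matrix m n F} {N : Matrix m n F} (hM : MInt A M) (hN : MInt A N) : MInt A (M + N) := by
  obtain ⟨M, rfl⟩ := hM
  obtain ⟨N, rfl⟩ := hN
  exact ⟨M + N, by ext; simp⟩

lemma MInt.sub {M : Matrix m n F} {N : Matrix m n F} (hM : MInt A M) (hN : MInt A N) : MInt A (M - N) := by
  obtain ⟨M, rfl⟩ := hM
  obtain ⟨N, rfl⟩ := hN
  exact ⟨M - N, by ext; simp⟩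

lemma MInt.fromRows {M : Matrix m n F} {N : Matrix l n F} (hM : MInt A M) (hN : MInt A N) : MInt A (Matrix.fromRows M N) := by
  obtain ⟨M, rfl⟩ := hM
  obtain ⟨N, rfl⟩ := hN
  refine ⟨Matrix.fromRows M N, ?_⟩
  ext i j
  rcases i with i | i <;> simp

lemma MInt.fromCols {M : Matrix n m F} {N : Matrix n l F} (hM : MInt A M) (hN : MInt A N) : MInt A (Matrix.fromCols M N) := by
  obtain ⟨M, rfl⟩ := hM
  obtain ⟨N, rfl⟩ := hN
  refine ⟨Matrix.fromCols M N, ?_⟩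
  ext i j
  rcases j with i | i <;> simp

lemma MInt.star [StarRing A] [StarRing F] (hs : ∀ a : A, algebraMap A F (star a) = star (algebraMap A F a))
   {M : Matrix m n F} (hM : MInt A M) : MInt A (Mᴴ) := by
  obtain ⟨M, rfl⟩ := hM
  exact ⟨Mᴴ, by ext i j; simp [hs]⟩

lemma MInt.one [DecidableEq m] : MInt A (1 : Matrix m m F) := ⟨1, by simp⟩
end

theorem unimod {A F : Type} [CommRing A] [IsDomain A] [IsPrincipalIdealRing A] [Field F] [Algebra A F] [IsFractionRing A F]
    [StarRing A] [StarRing F] (hs : ∀ a : A, algebraMap A F (star a) = star (algebraMap A F a))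
    {J n : Type} [Fintype J] [DecidableEq J] [Fintype n] [DecidableEq n] (H : Matrix J n F) (hT : MInt A (Hᴴ * H)) :
    ∃ (S S' : Matrix J J F), S * S' = 1 ∧ S' * S = 1 ∧ MInt A (S' * H) ∧ MInt A (Sᴴ * S) ∧ MInt A (S' * S'ᴴ) := by
  obtain ⟨W, W', Y1, Z1, hWW', hW'W, hW, hQ1⟩ := lat (A := A) (Matrix.fromCols (1 : Matrix J J F) H) (Matrix.fromRows 1 0)
    (by rw [Matrix.fromCols_mul_fromRows]; simp)
  have hZ1 : W' * Matrix.fromCols (1 : Matrix J J F) H = Z1.map (algebraMap A F) := by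
    rw [hQ1, ← Matrix.mul_assoc, hW'W, Matrix.one_mul]
  rw [Matrix.mul_fromCols, Matrix.mul_one] at hZ1
  have hW'i : MInt A W' := ⟨Z1.toCols₁, by
    ext i j
    have := congrFun (congrFun hZ1 i) (Sum.inl j)
    simpa using this⟩
  have hW'H : MInt A (W' * H) := ⟨Z1.toCols₂, by
    ext i j
    have := congrFun (congrFun hZ1 i) (Sum.inr j)
    simpa using this⟩
  have hWe : ∃ (Ya : Matrix J J F) (Yb : Matrix n J F), MInt A Ya ∧ MInt A Yb ∧ W = Ya + H * Yb := by
    refine ⟨(Y1.map (algebraMap A F)).toRows₁, (Y1.map (algebraMap A F)).toRows₂, ⟨Y1.toRows₁, rfl⟩, ⟨Y1.toRows₂, rfl⟩, ?_⟩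
    rw [hW]
    nth_rewrite 1 [← Matrix.fromRows_toRows (Y1.map (algebraMap A F))]
    rw [Matrix.fromCols_mul_fromRows, Matrix.one_mul]
  obtain ⟨S, S', Y, Z, hSS', hS'S, hS, hQ2⟩ := lat (A := A) (Matrix.fromCols H W'ᴴ) (Matrix.fromRows 0 Wᴴ)
    (by rw [Matrix.fromCols_mul_fromRows, ← Matrix.conjTranspose_mul, hWW']; simp)
  have hZ : S' * Matrix.fromCols H W'ᴴ = Z.map (algebraMap A F) := by
    rw [hQ2, ← Matrix.mul_assoc, hS'S, Matrix.one_mul]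
  rw [Matrix.mul_fromCols] at hZ
  have hS'H : MInt A (S' * H) := ⟨Z.toCols₁, by
    ext i j
    have := congrFun (congrFun hZ i) (Sum.inl j)
    simpa using this⟩
  have hS'W : MInt A (S' * W'ᴴ) := ⟨Z.toCols₂, by
    ext i j
    have := congrFun (congrFun hZ i) (Sum.inr j)
    simpa using this⟩
  refine ⟨S, S', hSS', hS'S, hS'H, ?_, ?_⟩
  · have : Sᴴ * S = (Y.map (algebraMap A F))ᴴ * (((Matrix.fromCols H W'ᴴ)ᴴ * Matrix.fromCols H W'ᴴ) * Y.map (algebraMap A F)) := by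
      rw [hS, Matrix.conjTranspose_mul]; simp only [Matrix.mul_assoc]
    rw [this]
    refine ((MInt.map Y).star hs).mul (MInt.mul ?_ (MInt.map Y))
    rw [Matrix.conjTranspose_fromCols_eq_fromRows_conjTranspose, Matrix.fromRows_mul, Matrix.mul_fromCols, Matrix.mul_fromCols,
      ← Matrix.conjTranspose_mul, Matrix.conjTranspose_conjTranspose]
    exact (hT.fromCols (hW'H.star hs)).fromRows (hW'H.fromCols (hW'i.mul (hW'i.star hs)))
  · obtain ⟨Ya, Yb, hYa, hYb, hWe⟩ := hWe
    have hE : MInt A (W' * S'ᴴ) := by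
      have := hS'W.star hs
      rwa [Matrix.conjTranspose_mul, Matrix.conjTranspose_conjTranspose] at this
    have hV : S'ᴴ = W * (W' * S'ᴴ) := by rw [← Matrix.mul_assoc, hWW', Matrix.one_mul]
    set E := W' * S'ᴴ with hEdef
    have hL : Ya * E = S'ᴴ - H * (Yb * E) := by
      rw [hV, hWe, Matrix.add_mul]; simp only [Matrix.mul_assoc, add_sub_cancel_right]
    set L := Ya * E with hLdef
    have hLi : MInt A L := hYa.mul hE
    have hHL : MInt A (Hᴴ * L) := by
      rw [hL, Matrix.mul_sub, ← Matrix.mul_assoc, ← Matrix.conjTranspose_mul]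
      exact (hS'H.star hs).sub (hT.mul (hYb.mul hE))
    have hWL : MInt A (Wᴴ * L) := by
      rw [hWe, Matrix.conjTranspose_add, Matrix.add_mul, Matrix.conjTranspose_mul, Matrix.mul_assoc]
      exact ((hYa.star hs).mul hLi).add ((hYb.star hs).mul hHL)
    have h1 : S' * S'ᴴ = (S' * W'ᴴ) * (Wᴴ * L) + (S' * H) * (Yb * E) := by
      have e1 : (S' * W'ᴴ) * (Wᴴ * L) = S' * L := by
        rw [Matrix.mul_assoc, ← Matrix.mul_assoc W'ᴴ, ← Matrix.conjTranspose_mul, hWW', Matrix.conjTranspose_one, Matrix.one_mul]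
      rw [e1, Matrix.mul_assoc S' H, ← Matrix.mul_add, hL, sub_add_cancel]
    rw [h1]
    exact (hS'W.mul hWL).add (hS'H.mul (hYb.mul hE))

end Part8

section Part9
open scoped Polynomial
open Matrix
open scoped ComplexOrder

lemma coeff_prod_top {k ι : Type} [CommRing k] (s : Finset ι) (f : ι → k[X]) (m : ι → ℕ)
    (h : ∀ i ∈ s, (f i).natDegree ≤ m i) :
    (∏ i ∈ s, f i).coeff (∑ i ∈ s, m i) = ∏ i ∈ s, (f i).coeff (m i) ∧ (∏ i ∈ s, f i).natDegree ≤ ∑ i ∈ s, m i := by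
  classical
  induction s using Finset.induction_on with
  | empty => simp
  | insert a s ha ih =>
    have ih' := ih (fun i hi => h i (Finset.mem_insert_of_mem hi))
    have h1 := h a (Finset.mem_insert_self _ _)
    rw [Finset.prod_insert ha, Finset.sum_insert ha, Finset.prod_insert ha]
    refine ⟨?_, Polynomial.natDegree_mul_le.trans (add_le_add h1 ih'.2)⟩
    rw [Polynomial.coeff_mul_add_eq_of_natDegree_le h1 ih'.2, ih'.1]

lemma coeff_det_top {k J : Type} [CommRing k] [Fintype J] [DecidableEq J] (P : Matrix J J k[X]) (m : J → ℕ)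
    (h : ∀ i j, (P i j).natDegree ≤ m j) :
    P.det.coeff (∑ j, m j) = (Matrix.of fun i j => (P i j).coeff (m j)).det := by
  rw [Matrix.det_apply, Matrix.det_apply, Polynomial.finset_sum_coeff]
  refine Finset.sum_congr rfl (fun σ _ => ?_)
  rw [Polynomial.coeff_smul, (coeff_prod_top _ _ _ (fun i _ => h (σ i) i)).1]
  rfl

def colDeg {k J : Type} [CommRing k] [Fintype J] (P : Matrix J J k[X]) (j : J) : ℕ :=
  Finset.univ.sup fun i => (P i j).natDegree

lemma le_colDeg {k J : Type} [CommRing k] [Fintype J] (P : Matrix J J k[X]) (i j : J) : (P i j).natDegree ≤ colDeg P j :=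
  Finset.le_sup (f := fun i => (P i j).natDegree) (Finset.mem_univ i)

lemma coeff_conj_mul {k J : Type} [CommRing k] [StarRing k] [Fintype J] (P : Matrix J J k[X]) (m : J → ℕ)
    (h : ∀ i j, (P i j).natDegree ≤ m j) (j l : J) :
    ((Pᴴ * P) j l).coeff (m j + m l) = ∑ i, star ((P i j).coeff (m j)) * (P i l).coeff (m l) ∧
    ((Pᴴ * P) j l).natDegree ≤ m j + m l := by
  rw [Matrix.mul_apply, Polynomial.finset_sum_coeff]
  constructor
  · refine Finset.sum_congr rfl (fun i _ => ?_)
    rw [Matrix.conjTranspose_apply, Polynomial.coeff_mul_add_eq_of_natDegree_le (by rw [polyStar_natDegree]; exact h i j) (h i l),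
      polyStar_coeff]
  · refine Polynomial.natDegree_sum_le_of_forall_le _ _ (fun i _ => ?_)
    rw [Matrix.conjTranspose_apply]
    exact Polynomial.natDegree_mul_le.trans (add_le_add (by rw [polyStar_natDegree]; exact h i j) (h i l))

theorem reduce {k : Type} [Field k] [StarRing k] {J : Type} [Fintype J] [DecidableEq J]
    (haniso : ∀ c : J → k, ∑ i, star (c i) * c i = 0 → c = 0)
    (P0 : Matrix J J k[X]) (d : k[X]) (hd : d ≠ 0) (Γ Γ' : Matrix J J k[X]) (h : P0ᴴ * P0 = (star d * d) • Γ)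
    (hΓ : Γ * Γ' = 1) :
    ∃ (U U' : Matrix J J k[X]) (E E' : Matrix J J k), U * U' = 1 ∧ Uᴴ * Γ * U = (Eᴴ * E).map Polynomial.C ∧ E * E' = 1 := by
  have hsd : star d * d ≠ 0 := mul_ne_zero (star_ne_zero.2 hd) hd
  have hex : ∃ n, ∃ U U' : Matrix J J k[X], U * U' = 1 ∧ ∑ j, colDeg (P0 * U) j = n := ⟨_, 1, 1, by simp, rfl⟩
  classical
  obtain ⟨U, U', hU, hn⟩ := Nat.find_spec hex
  have hmin := fun n hn => Nat.find_min hex (m := n) hn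
  rw [← hn] at hmin
  set P := P0 * U with hP
  have hΓP : Pᴴ * P = (star d * d) • (Uᴴ * Γ * U) := by
    rw [hP, Matrix.conjTranspose_mul, Matrix.mul_assoc, ← Matrix.mul_assoc P0ᴴ, h]
    simp [Matrix.mul_assoc]
  set Δ := Uᴴ * Γ * U with hΔ
  have hΔu : IsUnit Δ.det := by
    have h1 : IsUnit U.det := Matrix.isUnit_iff_isUnit_det _ |>.1 (IsUnit.of_mul_eq_one _ hU)
    have h2 : IsUnit Γ.det := Matrix.isUnit_iff_isUnit_det _ |>.1 (IsUnit.of_mul_eq_one _ hΓ)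
    rw [hΔ, Matrix.det_mul, Matrix.det_mul, Matrix.det_conjTranspose]
    exact (h1.star.mul h2).mul h1
  have hdet : star P.det * P.det = (star d * d) ^ Fintype.card J * Δ.det := by
    rw [← Matrix.det_conjTranspose, ← Matrix.det_mul, hΓP, Matrix.det_smul]
  have hP0 : P.det ≠ 0 := by
    intro h0
    rw [h0, mul_zero] at hdet
    exact mul_ne_zero (pow_ne_zero _ hsd) hΔu.ne_zero hdet.symm
  let m := colDeg P
  let ℓ : Matrix J J k := Matrix.of fun i j => (P i j).coeff (m j)
  have hm : ∀ i j, (P i j).natDegree ≤ m j := fun i j => le_colDeg P i j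
  have hℓ : ℓ.det ≠ 0 := by
    intro h0
    obtain ⟨c, hc0, hc⟩ := Matrix.exists_mulVec_eq_zero_iff.2 h0
    have hne : (Finset.univ.filter fun j => c j ≠ 0).Nonempty := by
      obtain ⟨j, hj⟩ := Function.ne_iff.1 hc0
      exact ⟨j, by simpa using hj⟩
    obtain ⟨i, hi, hmax⟩ := Finset.exists_max_image _ m hne
    have hci : c i ≠ 0 := by simpa using hi
    let V : Matrix J J k[X] := (1 : Matrix J J k[X]).updateCol i (fun j => Polynomial.C (c j) * Polynomial.X ^ (m i - m j))
    have hVdet : V.det = Polynomial.C (c i) := by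
      have h2 : Matrix.cramer (1 : Matrix J J k[X]) (fun j => Polynomial.C (c j) * Polynomial.X ^ (m i - m j)) i =
          Polynomial.C (c i) * Polynomial.X ^ (m i - m i) := by
        rw [Matrix.cramer_one]; rfl
      rw [Matrix.cramer_apply] at h2
      rw [show V.det = _ from h2]; simp
    have hVu : IsUnit V := by
      rw [Matrix.isUnit_iff_isUnit_det, hVdet]
      exact (isUnit_iff_ne_zero.2 hci).map Polynomial.C
    obtain ⟨V', hV'⟩ := hVu.exists_right_inv
    have hcol : ∀ r j, j ≠ i → (P * V) r j = P r j := by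
      intro r j hj
      rw [Matrix.mul_apply, Finset.sum_eq_single j]
      · simp [V, Matrix.updateCol_apply, hj]
      · intro b _ hb; simp [V, Matrix.updateCol_apply, hj, Matrix.one_apply, hb]
      · simp
    have hcoli : ∀ r, (P * V) r i = ∑ j, P r j * (Polynomial.C (c j) * Polynomial.X ^ (m i - m j)) := by
      intro r
      rw [Matrix.mul_apply]
      simp [V, Matrix.updateCol_apply]
    have hterm : ∀ r j, (P r j * (Polynomial.C (c j) * Polynomial.X ^ (m i - m j))).natDegree ≤ m i ∧
        (P r j * (Polynomial.C (c j) * Polynomial.X ^ (m i - m j))).coeff (m i) = ℓ r j * c j := by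
      intro r j
      by_cases hcj : c j = 0
      · simp [hcj]
      · have hle : m j ≤ m i := hmax j (by simpa using hcj)
        constructor
        · refine Polynomial.natDegree_mul_le.trans ?_
          have := hm r j
          have h2 := Polynomial.natDegree_C_mul_X_pow_le (c j) (m i - m j)
          omega
        · have h2 := Polynomial.natDegree_C_mul_X_pow_le (c j) (m i - m j)
          have := Polynomial.coeff_mul_add_eq_of_natDegree_le (hm r j) h2
          rw [show m j + (m i - m j) = m i by omega] at this
          rw [this]; simp [ℓ]
    have hnd : ∀ r, ((P * V) r i).natDegree ≤ m i ∧ ((P * V) r i).coeff (m i) = 0 := by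
      intro r
      rw [hcoli]
      constructor
      · exact Polynomial.natDegree_sum_le_of_forall_le _ _ (fun j _ => (hterm r j).1)
      · rw [Polynomial.finset_sum_coeff, Finset.sum_congr rfl (fun j _ => (hterm r j).2)]
        exact congrFun hc r
    have hmi : m i ≠ 0 := by
      intro hmi
      have : (P * V).det = 0 := by
        apply Matrix.det_eq_zero_of_column_eq_zero i
        intro r
        obtain ⟨h1, h2⟩ := hnd r
        rw [hmi] at h1 h2
        rw [Polynomial.eq_C_of_natDegree_le_zero h1, h2, map_zero]
      rw [Matrix.det_mul, hVdet] at this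
      exact mul_ne_zero hP0 (by simpa using hci) this
    have hlt : ∑ j, colDeg (P * V) j < ∑ j, colDeg P j := by
      apply Finset.sum_lt_sum
      · intro j _
        by_cases hj : j = i
        · rw [hj]
          exact Finset.sup_le (fun r _ => (hnd r).1)
        · exact Finset.sup_le (fun r _ => by rw [hcol r j hj]; exact hm r j)
      · refine ⟨i, Finset.mem_univ _, ?_⟩
        show colDeg (P * V) i < m i
        refine (Finset.sup_lt_iff (Nat.pos_of_ne_zero hmi)).2 ?_
        intro r _
        show ((P * V) r i).natDegree < m i
        obtain ⟨h1, h2⟩ := hnd r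
        refine lt_of_le_of_ne h1 (fun he => ?_)
        rw [← he] at h2
        have h3 := Polynomial.leadingCoeff_eq_zero.1 h2
        rw [h3] at he
        exact hmi (by simpa using he.symm)
    apply hmin _ hlt
    refine ⟨U * V, V' * U', ?_, ?_⟩
    · rw [Matrix.mul_assoc, ← Matrix.mul_assoc V, hV', Matrix.one_mul, hU]
    · rw [← Matrix.mul_assoc]
  -- degree bookkeeping
  have hsum : ∑ j, m j ≤ Fintype.card J * d.natDegree := by
    have h1 : ∑ j, m j ≤ P.det.natDegree := by
      apply Polynomial.le_natDegree_of_ne_zero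
      rw [coeff_det_top P m hm]; exact hℓ
    have h2 := congrArg Polynomial.natDegree hdet
    rw [Polynomial.natDegree_mul (star_ne_zero.2 hP0) hP0, Polynomial.natDegree_mul (pow_ne_zero _ hsd) hΔu.ne_zero,
      Polynomial.natDegree_pow, Polynomial.natDegree_mul (star_ne_zero.2 hd) hd, polyStar_natDegree, polyStar_natDegree,
      Polynomial.natDegree_eq_zero_of_isUnit hΔu] at h2
    have h3 : Fintype.card J * (d.natDegree + d.natDegree) = 2 * (Fintype.card J * d.natDegree) := by ring
    omega
  have hge : ∀ j, d.natDegree ≤ m j := by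
    intro j
    obtain ⟨h1, h2⟩ := coeff_conj_mul P m hm j j
    have h3 : (Pᴴ * P) j j ≠ 0 := by
      intro h0
      rw [h0, Polynomial.coeff_zero] at h1
      have h4 := haniso _ h1.symm
      apply hℓ
      exact Matrix.det_eq_zero_of_column_eq_zero j (fun r => congrFun h4 r)
    have h5 : (Pᴴ * P) j j = (star d * d) * Δ j j := by rw [hΓP]; rfl
    rw [h5] at h2 h3
    rw [Polynomial.natDegree_mul hsd (right_ne_zero_of_mul h3), Polynomial.natDegree_mul (star_ne_zero.2 hd) hd, polyStar_natDegree] at h2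
    omega
  have heq : ∀ j, m j = d.natDegree := by
    intro j
    by_contra hne
    have : ∑ j : J, d.natDegree < ∑ j, m j :=
      Finset.sum_lt_sum (fun j _ => hge j) ⟨j, Finset.mem_univ _, lt_of_le_of_ne (hge j) (Ne.symm hne)⟩
    simp at this
    omega
  let a := d.leadingCoeff
  have ha : a ≠ 0 := Polynomial.leadingCoeff_ne_zero.2 hd
  have hℓu : IsUnit (a⁻¹ • ℓ).det := by
    rw [Matrix.det_smul]; exact isUnit_iff_ne_zero.2 (mul_ne_zero (pow_ne_zero _ (inv_ne_zero ha)) hℓ)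
  obtain ⟨E', hE'⟩ := ((Matrix.isUnit_iff_isUnit_det _).2 hℓu).exists_right_inv
  refine ⟨U, U', a⁻¹ • ℓ, E', hU, ?_, hE'⟩
  ext1 j l
  obtain ⟨h1, h2⟩ := coeff_conj_mul P m hm j l
  have h5 : (Pᴴ * P) j l = (star d * d) * Δ j l := by rw [hΓP]; rfl
  rw [h5] at h1 h2
  rw [heq, heq] at h1 h2
  have hnd : (Δ j l).natDegree ≤ 0 := by
    by_cases h0 : Δ j l = 0
    · simp [h0]
    · rw [Polynomial.natDegree_mul hsd h0, Polynomial.natDegree_mul (star_ne_zero.2 hd) hd, polyStar_natDegree] at h2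
      omega
  have hC := Polynomial.eq_C_of_natDegree_le_zero hnd
  rw [Matrix.map_apply, ← hΔ, hC]
  congr 1
  have hdd : (star d * d).coeff (d.natDegree + d.natDegree) = star a * a := by
    rw [Polynomial.coeff_mul_add_eq_of_natDegree_le (by rw [polyStar_natDegree]) le_rfl, polyStar_coeff]
    rfl
  rw [hC, Polynomial.coeff_mul_C, hdd] at h1
  rw [Matrix.mul_apply]
  simp only [Matrix.conjTranspose_apply, Matrix.smul_apply, smul_eq_mul, star_mul, star_inv₀]
  have hsa : star a ≠ 0 := star_ne_zero.2 ha
  have e : ∀ i, star (ℓ i j) * (star a)⁻¹ * (a⁻¹ * ℓ i l) = (star (ℓ i j) * ℓ i l) * ((star a)⁻¹ * a⁻¹) := by intro i; ring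
  simp_rw [e, ← Finset.sum_mul]
  have h6 : ∑ i, star (ℓ i j) * ℓ i l = star a * a * (Δ j l).coeff 0 := by
    rw [h1]; simp only [ℓ, Matrix.of_apply, heq]
  rw [h6]
  field_simp

end Part9

section Part10
open scoped Polynomial
open Matrix
open scoped ComplexOrder

lemma clear_fin {A F : Type} [CommRing A] [IsDomain A] [Field F] [Algebra A F] [IsFractionRing A F] {ι : Type} [Finite ι]
    (f : ι → F) : ∃ d : A, d ≠ 0 ∧ ∃ p : ι → A, ∀ i, algebraMap A F (p i) = algebraMap A F d * f i := by
  obtain ⟨b, hb⟩ := IsLocalization.exist_integer_multiples_of_finite (nonZeroDivisors A) f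
  choose p hp using hb
  refine ⟨b, nonZeroDivisors.coe_ne_zero b, p, fun i => ?_⟩
  rw [hp i, Algebra.smul_def]

theorem cassels {k F : Type} [Field k] [StarRing k] [Field F] [StarRing F] [Algebra k[X] F] [IsFractionRing k[X] F]
    (hs0 : ∀ p : k[X], star (algebraMap k[X] F p) = algebraMap k[X] F (star p))
    {J n : Type} [Fintype J] [DecidableEq J] [Fintype n] [DecidableEq n]
    (haniso : ∀ c : J → k, ∑ i, star (c i) * c i = 0 → c = 0)
    (H : Matrix J n F) (T : Matrix n n k[X]) (hT : Hᴴ * H = T.map (algebraMap k[X] F)) :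
    ∃ (G G' : Matrix J J F) (C : Matrix J n k[X]), G * G' = 1 ∧
      C.map (algebraMap k[X] F) = G * H ∧ Cᴴ * C = T := by
  let a := algebraMap k[X] F
  have ha : Function.Injective a := IsFractionRing.injective _ _
  have hs : ∀ p : k[X], a (star p) = star (a p) := fun p => (hs0 p).symm
  have hmi : ∀ {m l : Type} {M N : Matrix m l k[X]}, M.map a = N.map a → M = N := by
    intro m l M N h
    exact Matrix.map_injective ha h
  have hms : ∀ {m l : Type} (M : Matrix m l k[X]), (Mᴴ).map a = (M.map a)ᴴ := by
    intro m l M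
    ext i j; simp [hs]
  obtain ⟨S, S', hSS', hS'S, ⟨Z, hZ⟩, ⟨Γ, hΓ⟩, ⟨Γ', hΓ'⟩⟩ := unimod (A := k[X]) (F := F) hs H ⟨T, hT⟩
  obtain ⟨d, hd, p, hp⟩ := clear_fin (A := k[X]) (F := F) (fun x : J × J => S x.1 x.2)
  let P0 : Matrix J J k[X] := Matrix.of fun i j => p (i, j)
  have hP0 : P0.map a = a d • S := by
    ext i j; exact hp (i, j)
  have h1 : P0ᴴ * P0 = (star d * d) • Γ := by
    apply hmi
    rw [Matrix.map_mul, hms, hP0, Matrix.conjTranspose_smul, Matrix.smul_mul, Matrix.mul_smul, hΓ]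
    ext i j
    simp only [Matrix.smul_apply, Matrix.map_apply, smul_eq_mul, map_mul, hs]
    show star (a d) * (a d * a (Γ i j)) = _
    ring
  have hΓΓ' : Γ * Γ' = 1 := by
    apply hmi
    rw [Matrix.map_mul, ← hΓ, ← hΓ', Matrix.mul_assoc, ← Matrix.mul_assoc S, hSS', Matrix.one_mul, ← Matrix.conjTranspose_mul, hS'S]
    simp
  obtain ⟨U, U', E, E', hU, hE, hEE'⟩ := reduce haniso P0 d hd Γ Γ' h1 hΓΓ'
  have hU' : U' * U = 1 := mul_eq_one_comm.1 hU
  have hEC : E.map Polynomial.C * E'.map Polynomial.C = 1 := by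
    rw [← Matrix.map_mul, hEE']; simp
  have hECs : (E.map Polynomial.C)ᴴ = (Eᴴ).map Polynomial.C := by
    ext1 i j; simp [polyStar_C]
  refine ⟨(E.map Polynomial.C).map a * U'.map a * S', S * U.map a * (E'.map Polynomial.C).map a, E.map Polynomial.C * U' * Z, ?_, ?_, ?_⟩
  · have e1 : (E.map Polynomial.C).map a * U'.map a * S' * (S * U.map a * (E'.map Polynomial.C).map a) =
      (E.map Polynomial.C).map a * (U'.map a * ((S' * S) * U.map a)) * (E'.map Polynomial.C).map a := by
      simp only [Matrix.mul_assoc]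
    rw [e1, hS'S, Matrix.one_mul, ← Matrix.map_mul, hU']
    rw [Matrix.map_one _ (map_zero _) (map_one _), Matrix.mul_one, ← Matrix.map_mul, hEC, Matrix.map_one _ (map_zero _) (map_one _)]
  · show Matrix.map _ a = _
    rw [Matrix.map_mul, Matrix.map_mul]
    simp only [Matrix.mul_assoc]
    rw [← hZ]
  · have e1 : (E.map Polynomial.C * U' * Z)ᴴ * (E.map Polynomial.C * U' * Z) = Zᴴ * (U'ᴴ * ((E.map Polynomial.C)ᴴ * E.map Polynomial.C) * U') * Z := by
      simp only [Matrix.conjTranspose_mul, Matrix.mul_assoc]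
    have e2 : U'ᴴ * ((E.map Polynomial.C)ᴴ * E.map Polynomial.C) * U' = Γ := by
      rw [hECs, ← Matrix.map_mul, ← hE]
      have : U'ᴴ * (Uᴴ * Γ * U) * U' = (U * U')ᴴ * Γ * (U * U') := by
        simp only [Matrix.conjTranspose_mul, Matrix.mul_assoc]
      rw [this, hU]; simp
    rw [e1, e2]
    apply hmi
    rw [Matrix.map_mul, Matrix.map_mul, hms, ← hT]
    have hZ' : Z.map a = S' * H := hZ.symm
    have hGamTwo : Γ.map a = Sᴴ * S := hΓ.symm
    rw [hZ', hGamTwo]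
    have e3 : (S' * H)ᴴ * (Sᴴ * S) * (S' * H) = Hᴴ * (S * S')ᴴ * (S * S') * H := by
      simp only [Matrix.conjTranspose_mul, Matrix.mul_assoc]
    rw [e3, hSS']; simp

lemma aniso_C {J : Type} [Fintype J] (c : J → ℂ) (h : ∑ i, star (c i) * c i = 0) : c = 0 := by
  have h2 : star c ⬝ᵥ c = 0 := h
  exact dotProduct_star_self_eq_zero.1 h2

lemma aniso_poly {J : Type} [Fintype J] (c : J → ℂ[X]) (h : ∑ i, star (c i) * c i = 0) : c = 0 := by
  have h1 : ∀ t : ℝ, (fun i => ev1 t (c i)) = 0 := by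
    intro t
    apply aniso_C
    have := congrArg (ev1 t) h
    simpa only [map_sum, map_mul, ev1_star, map_zero] using this
  ext1 i
  exact poly_zero_of_real _ (fun t => congrFun (h1 t) i)

lemma aniso_kC {J : Type} [Fintype J] (c : J → kC) (h : ∑ i, star (c i) * c i = 0) : c = 0 := by
  obtain ⟨d, hd, p, hp⟩ := clear_fin (A := ℂ[X]) c
  have hd' : algebraMap ℂ[X] kC d ≠ 0 := fun h => hd (IsFractionRing.injective ℂ[X] kC (by simpa using h))
  have : p = 0 := by
    apply aniso_poly
    apply IsFractionRing.injective ℂ[X] kC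
    rw [map_sum, map_zero]
    simp_rw [map_mul, ← fracStar_algebraMap, hp, star_mul]
    have e : ∀ i, star (c i) * star (algebraMap ℂ[X] kC d) * (algebraMap ℂ[X] kC d * c i) =
      (star (algebraMap ℂ[X] kC d) * algebraMap ℂ[X] kC d) * (star (c i) * c i) := by intro i; ring
    simp_rw [e, ← Finset.mul_sum, h, mul_zero]
  ext1 i
  have h2 := hp i
  rw [this, Pi.zero_apply, map_zero, eq_comm, mul_eq_zero] at h2
  exact h2.resolve_left hd'

/-- L4 -/
theorem sos2_line (n : ℕ) (T : Matrix (Fin n) (Fin n) ℂ[X][X]) (hT : ∀ s, (T.map (ev2 s)).PosSemidef) :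
    ∃ (J : Type) (_ : Fintype J) (H : Matrix J (Fin n) ℂ[X][X]) (b : ℂ[X]), b ≠ 0 ∧
      Hᴴ * H = Polynomial.C (star b * b) • T := by
  obtain ⟨J, i1, i2, H, hH⟩ := matrix_sos2 n T hT
  have hmap : T.map ι2 = (T.map (Polynomial.map (algebraMap ℂ[X] kC))).map (algebraMap kC[X] Fr) := rfl
  obtain ⟨G, G', C, hG, hC, hCC⟩ := cassels (k := kC) (F := Fr) fracStar_algebraMap aniso_kC H _ (hH.trans hmap)
  -- clear denominators
  obtain ⟨b, hb, p, hp⟩ := clear_fin (A := ℂ[X]) (F := kC)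
    (fun x : (J × Fin n) × Fin (Finset.univ.sup (fun x : J × Fin n => (C x.1 x.2).natDegree) + 1) => (C x.1.1 x.1.2).coeff x.2)
  have hpoly : ∀ i j, ∃ q : ℂ[X][X], q.map (algebraMap ℂ[X] kC) = Polynomial.C (algebraMap ℂ[X] kC b) * C i j := by
    intro i j
    have : Polynomial.C (algebraMap ℂ[X] kC b) * C i j ∈ (Polynomial.mapRingHom (algebraMap ℂ[X] kC)).range := by
      rw [Polynomial.mem_map_range]
      intro l
      rw [Polynomial.coeff_C_mul]
      by_cases hl : l < Finset.univ.sup (fun x : J × Fin n => (C x.1 x.2).natDegree) + 1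
      · exact ⟨_, hp ((i, j), ⟨l, hl⟩)⟩
      · have : (C i j).natDegree < l := by
          have := Finset.le_sup (f := fun x : J × Fin n => (C x.1 x.2).natDegree) (Finset.mem_univ (i, j))
          simp only at this
          omega
        rw [Polynomial.coeff_eq_zero_of_natDegree_lt this, mul_zero]
        exact ⟨0, map_zero _⟩
    exact this
  choose q hq using hpoly
  refine ⟨J, i1, Matrix.of q, b, hb, ?_⟩
  have hinj : Function.Injective (Polynomial.map (algebraMap ℂ[X] kC)) := Polynomial.map_injective _ (IsFractionRing.injective _ _)
  ext1 c d
  apply hinj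
  rw [Matrix.mul_apply, Polynomial.map_sum, Matrix.smul_apply, smul_eq_mul, Polynomial.map_mul]
  have h3 := congrFun (congrFun hCC c) d
  rw [Matrix.mul_apply] at h3
  rw [Matrix.map_apply] at h3
  rw [← h3, Finset.mul_sum]
  refine Finset.sum_congr rfl (fun i _ => ?_)
  simp only [Matrix.conjTranspose_apply, Matrix.of_apply, Polynomial.map_mul, map_star_alg, hq, Polynomial.map_C, map_mul, star_mul,
    polyStar_C, ← fracStar_algebraMap]
  ring

end Part10

section Part11
open scoped Polynomial
open Matrix
open scoped ComplexOrder

def mob (n : ℕ) (a b : ℂ[X]) (p : ℂ[X]) : ℂ[X] :=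
  ∑ j ∈ Finset.range (n+1), Polynomial.C (p.coeff j) * a^j * b^(n-j)

lemma mob_eval {n : ℕ} {a b p : ℂ[X]} (hp : p.natDegree ≤ n) {x : ℂ} (hb : b.eval x ≠ 0) :
    (mob n a b p).eval x = (b.eval x)^n * p.eval (a.eval x / b.eval x) := by
  rw [mob, Polynomial.eval_finset_sum, Polynomial.eval_eq_sum_range' (Nat.lt_succ_of_le hp), Finset.mul_sum]
  refine Finset.sum_congr rfl (fun j hj => ?_)
  have : j ≤ n := by simpa [Nat.lt_succ_iff] using hj
  simp only [Polynomial.eval_mul, Polynomial.eval_C, Polynomial.eval_pow]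
  rw [div_pow, ← Nat.sub_add_cancel this, pow_add, Nat.add_sub_cancel]
  field_simp

def mob2 (n : ℕ) (a b : ℂ[X]) (p : ℂ[X][X]) : ℂ[X][X] :=
  ∑ j ∈ Finset.range (n+1), Polynomial.C (mob n a b (p.coeff j)) * (a.map Polynomial.C)^j * (b.map Polynomial.C)^(n-j)

def DB (n : ℕ) (p : ℂ[X][X]) : Prop := p.natDegree ≤ n ∧ ∀ j, (p.coeff j).natDegree ≤ n

lemma DB.mono {n m : ℕ} {p : ℂ[X][X]} (h : DB n p) (hnm : n ≤ m) : DB m p :=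
  ⟨h.1.trans hnm, fun j => (h.2 j).trans hnm⟩

lemma exists_DB (p : ℂ[X][X]) : ∃ n, DB n p := by
  refine ⟨p.natDegree + ∑ j ∈ p.support, (p.coeff j).natDegree, by omega, fun j => ?_⟩
  by_cases hj : j ∈ p.support
  · have := Finset.single_le_sum (f := fun j => (p.coeff j).natDegree) (fun _ _ => Nat.zero_le _) hj
    skip
    omega
  · rw [Polynomial.notMem_support_iff.1 hj]; simp

lemma exists_DB_fin {ι : Type} [Finite ι] (p : ι → ℂ[X][X]) : ∃ n, ∀ i, DB n (p i) := by
  cases nonempty_fintype ι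
  choose n hn using fun i => exists_DB (p i)
  refine ⟨Finset.univ.sup n, fun i => (hn i).mono (Finset.le_sup (Finset.mem_univ i))⟩

lemma exists_deg_fin {ι : Type} [Finite ι] (p : ι → ℂ[X]) : ∃ n, ∀ i, (p i).natDegree ≤ n := by
  cases nonempty_fintype ι
  exact ⟨Finset.univ.sup (fun i => (p i).natDegree), fun i => Finset.le_sup (f := fun i => (p i).natDegree) (Finset.mem_univ i)⟩

lemma evalEval_mapC (a : ℂ[X]) (t x : ℂ) : (a.map Polynomial.C).evalEval t x = a.eval x := by
  simp [Polynomial.evalEval_map_C]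

lemma mob2_eval {n : ℕ} {a b : ℂ[X]} {p : ℂ[X][X]} (hp : DB n p) {t x : ℂ} (ht : b.eval t ≠ 0) (hx : b.eval x ≠ 0) :
    (mob2 n a b p).evalEval t x = (b.eval t)^n * (b.eval x)^n * p.evalEval (a.eval t / b.eval t) (a.eval x / b.eval x) := by
  rw [mob2, Polynomial.evalEval_finset_sum]
  have e : p.evalEval (a.eval t / b.eval t) (a.eval x / b.eval x) =
    ∑ j ∈ Finset.range (n+1), (p.coeff j).eval (a.eval t / b.eval t) * (a.eval x / b.eval x)^j := by
    rw [Polynomial.evalEval, Polynomial.eval_eq_sum_range' (Nat.lt_succ_of_le hp.1), Polynomial.eval_finset_sum]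
    simp
  rw [e, Finset.mul_sum]
  refine Finset.sum_congr rfl (fun j hj => ?_)
  have : j ≤ n := by simpa [Nat.lt_succ_iff] using hj
  simp only [Polynomial.evalEval_mul, Polynomial.evalEval_C, Polynomial.evalEval_pow, evalEval_mapC]
  rw [mob_eval (hp.2 j) ht, div_pow]
  have : b.eval x ^ n = b.eval x ^ (n-j) * b.eval x ^ j := by rw [← pow_add, Nat.sub_add_cancel this]
  rw [this]
  field_simp

/-- Cayley data. -/
def cA : ℂ[X] := Polynomial.X - Polynomial.C Complex.I
def cB : ℂ[X] := Polynomial.X + Polynomial.C Complex.I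
def iA : ℂ[X] := Polynomial.C Complex.I * (1 + Polynomial.X)
def iB : ℂ[X] := 1 - Polynomial.X

lemma cB_ne (s : ℝ) : cB.eval (s:ℂ) ≠ 0 := by
  simp only [cB, Polynomial.eval_add, Polynomial.eval_X, Polynomial.eval_C]
  intro h
  have := congrArg Complex.im h
  simp at this

lemma cayley_circle (s : ℝ) : ‖cA.eval (s:ℂ) / cB.eval (s:ℂ)‖ = 1 := by
  rw [norm_div, div_eq_one_iff_eq (norm_ne_zero_iff.2 (cB_ne s))]
  have : cA.eval (s:ℂ) = star (cB.eval (s:ℂ)) := by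
    simp [cA, cB, sub_eq_add_neg]
  rw [this, norm_star]

lemma cayley_inv {z : ℂ} (hz : ‖z‖ = 1) (h1 : z ≠ 1) :
    ∃ s : ℝ, (iA.eval z / iB.eval z) = s ∧ cA.eval (s:ℂ) / cB.eval (s:ℂ) = z ∧ (1 - z) * cB.eval (s:ℂ) = 2 * Complex.I := by
  have h2 : (1 - z) ≠ 0 := sub_ne_zero.2 h1.symm
  have hzz : z * star z = 1 := by
    have := Complex.mul_conj z
    rw [Complex.normSq_eq_norm_sq, hz] at this
    simpa using this
  have hz0 : z ≠ 0 := by rintro rfl; simp at hz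
  have hst : star z = z⁻¹ := eq_inv_of_mul_eq_one_right hzz
  have hreal : star (Complex.I * (1+z) / (1-z)) = Complex.I * (1+z) / (1-z) := by
    have h3 : z - 1 ≠ 0 := sub_ne_zero.2 h1
    simp only [Complex.star_def, map_div₀, map_mul, map_add, map_sub, map_one, Complex.conj_I]
    rw [← Complex.star_def, hst]
    field_simp
    ring
  obtain ⟨s, hs⟩ := Complex.conj_eq_iff_real.1 hreal
  have e1 : iA.eval z / iB.eval z = Complex.I * (1+z) / (1-z) := by simp [iA, iB]
  have e2 : (1 - z) * cB.eval (s:ℂ) = 2 * Complex.I := by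
    rw [← hs]; simp only [cB, Polynomial.eval_add, Polynomial.eval_X, Polynomial.eval_C]
    field_simp; ring
  refine ⟨s, by rw [e1, hs], ?_, e2⟩
  rw [div_eq_iff (cB_ne s)]
  rw [← hs]; simp only [cA, cB, Polynomial.eval_add, Polynomial.eval_sub, Polynomial.eval_X, Polynomial.eval_C]
  field_simp; ring

lemma outer_flip (p : ℂ[X]) (hp : p ≠ 0) : ∃ p' : ℂ[X], (∀ z : ℂ, ‖z‖ < 1 → p'.eval z ≠ 0) ∧
    ∀ z : ℂ, ‖z‖ = 1 → ‖p'.eval z‖ = ‖p.eval z‖ := by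
  induction hn : p.natDegree using Nat.strong_induction_on generalizing p with
  | _ n ih =>
    by_cases h : ∃ a : ℂ, ‖a‖ < 1 ∧ p.eval a = 0
    · obtain ⟨a, ha, hpa⟩ := h
      obtain ⟨p1, rfl⟩ := Polynomial.dvd_iff_isRoot.2 hpa
      have hp1 : p1 ≠ 0 := right_ne_zero_of_mul hp
      obtain ⟨p', h1, h2⟩ := ih p1.natDegree (by
        rw [← hn, Polynomial.natDegree_mul (left_ne_zero_of_mul hp) hp1]; simp) p1 hp1 rfl
      refine ⟨(1 - Polynomial.C (star a) * Polynomial.X) * p', fun z hz => ?_, fun z hz => ?_⟩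
      · rw [Polynomial.eval_mul]
        refine mul_ne_zero ?_ (h1 z hz)
        simp only [Polynomial.eval_sub, Polynomial.eval_one, Polynomial.eval_mul, Polynomial.eval_C, Polynomial.eval_X]
        intro h
        have h3 : ‖star a * z‖ = 1 := by rw [← sub_eq_zero.1 h, norm_one]
        rw [norm_mul, norm_star] at h3
        nlinarith [norm_nonneg a, norm_nonneg z]
      · rw [Polynomial.eval_mul, Polynomial.eval_mul, norm_mul, norm_mul, h2 z hz]
        congr 1
        simp only [Polynomial.eval_sub, Polynomial.eval_one, Polynomial.eval_mul, Polynomial.eval_C, Polynomial.eval_X]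
        have hzz : z * star z = 1 := by
          have := Complex.mul_conj z
          rw [Complex.normSq_eq_norm_sq, hz] at this
          simpa using this
        have : 1 - star a * z = z * star (z - a) := by rw [star_sub, mul_sub, hzz]; ring
        rw [this, norm_mul, norm_star, hz, one_mul]
    · push Not at h
      exact ⟨p, h, fun _ _ => rfl⟩

abbrev e2 (t x : ℂ) : ℂ[X][X] →+* ℂ := Polynomial.evalEvalRingHom t x
abbrev e1 (t : ℂ) : ℂ[X] →+* ℂ := Polynomial.evalRingHom t

lemma conj_map_ev2 {a n : Type} (E : Matrix a n ℂ[X][X]) (s : ℝ × ℝ) : Eᴴ.map (ev2 s) = (E.map (ev2 s))ᴴ := by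
  ext i j; exact ev2_star s (E j i)

lemma conj_map_ev1 {a n : Type} (E : Matrix a n ℂ[X]) (s : ℝ) : Eᴴ.map (ev1 s) = (E.map (ev1 s))ᴴ := by
  ext i j; exact ev1_star s (E j i)

lemma smul_gram {a n : Type} [Fintype a] (c : ℂ) (E : Matrix a n ℂ) : (c • E)ᴴ * (c • E) = (star c * c) • (Eᴴ * E) := by
  rw [Matrix.conjTranspose_smul, Matrix.smul_mul, Matrix.mul_smul, smul_smul]

lemma star_mul_nonneg (c : ℂ) : 0 ≤ star c * c := star_mul_self_nonneg c

theorem sos2_circle_fin {a b : Type} {n : ℕ} [Fintype a] [Fintype b]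
    (E : Matrix a (Fin n) ℂ[X][X]) (F : Matrix b (Fin n) ℂ[X][X])
    (h : ∀ ζ z : ℂ, ‖ζ‖ = 1 → ‖z‖ = 1 → ((E.map (e2 ζ z))ᴴ * E.map (e2 ζ z) - (F.map (e2 ζ z))ᴴ * F.map (e2 ζ z)).PosSemidef) :
    ∃ (J : Type) (_ : Fintype J) (H : Matrix J (Fin n) ℂ[X][X]) (μ : ℂ[X][X]),
      (∀ ζ z : ℂ, ‖ζ‖ < 1 → ‖z‖ < 1 → e2 ζ z μ ≠ 0) ∧
      ∀ ζ z : ℂ, ‖ζ‖ = 1 → ‖z‖ = 1 → (H.map (e2 ζ z))ᴴ * H.map (e2 ζ z) =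
        (star (e2 ζ z μ) * e2 ζ z μ) • ((E.map (e2 ζ z))ᴴ * E.map (e2 ζ z) - (F.map (e2 ζ z))ᴴ * F.map (e2 ζ z)) := by
  obtain ⟨dE, hdE⟩ := exists_DB_fin (fun x : a × Fin n => E x.1 x.2)
  obtain ⟨dF, hdF⟩ := exists_DB_fin (fun x : b × Fin n => F x.1 x.2)
  obtain ⟨d, hd1, hd2⟩ : ∃ d, (∀ i j, DB d (E i j)) ∧ (∀ i j, DB d (F i j)) :=
    ⟨max dE dF, fun i j => (hdE (i,j)).mono (le_max_left _ _), fun i j => (hdF (i,j)).mono (le_max_right _ _)⟩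
  obtain ⟨E', hE'⟩ : ∃ E' : Matrix a (Fin n) ℂ[X][X], E' = E.map (mob2 d cA cB) := ⟨_, rfl⟩
  obtain ⟨F', hF'⟩ : ∃ F' : Matrix b (Fin n) ℂ[X][X], F' = F.map (mob2 d cA cB) := ⟨_, rfl⟩
  have key : ∀ s : ℝ × ℝ, ∀ ζ z : ℂ, cA.eval (s.1:ℂ) / cB.eval (s.1:ℂ) = ζ → cA.eval (s.2:ℂ) / cB.eval (s.2:ℂ) = z →
      (E'ᴴ * E' - F'ᴴ * F').map (ev2 s) = (star ((cB.eval (s.1:ℂ))^d * (cB.eval (s.2:ℂ))^d) * ((cB.eval (s.1:ℂ))^d * (cB.eval (s.2:ℂ))^d)) •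
        ((E.map (e2 ζ z))ᴴ * E.map (e2 ζ z) - (F.map (e2 ζ z))ᴴ * F.map (e2 ζ z)) := by
    rintro s ζ z rfl rfl
    have h1 : E'.map (ev2 s) = ((cB.eval (s.1:ℂ))^d * (cB.eval (s.2:ℂ))^d) • E.map (e2 (cA.eval (s.1:ℂ) / cB.eval (s.1:ℂ)) (cA.eval (s.2:ℂ) / cB.eval (s.2:ℂ))) := by
      ext i j
      rw [hE']
      exact mob2_eval (hd1 i j) (cB_ne _) (cB_ne _)
    have h2 : F'.map (ev2 s) = ((cB.eval (s.1:ℂ))^d * (cB.eval (s.2:ℂ))^d) • F.map (e2 (cA.eval (s.1:ℂ) / cB.eval (s.1:ℂ)) (cA.eval (s.2:ℂ) / cB.eval (s.2:ℂ))) := by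
      ext i j
      rw [hF']
      exact mob2_eval (hd2 i j) (cB_ne _) (cB_ne _)
    rw [Matrix.map_sub _ (fun x y => map_sub _ x y), Matrix.map_mul, Matrix.map_mul, conj_map_ev2, conj_map_ev2, h1, h2, smul_gram, smul_gram, smul_sub]
  obtain ⟨J, iJ, H, b, hb, hH⟩ := sos2_line n (E'ᴴ * E' - F'ᴴ * F') (by
    intro s
    rw [key s _ _ rfl rfl]
    exact (h _ _ (cayley_circle _) (cayley_circle _)).smul (star_mul_nonneg _))
  obtain ⟨dH, hdH⟩ := exists_DB_fin (fun x : J × Fin n => H x.1 x.2)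
  obtain ⟨M, hM1, hM2, hM3⟩ : ∃ M, (∀ i j, DB M (H i j)) ∧ d ≤ M ∧ b.natDegree ≤ M :=
    ⟨dH + d + b.natDegree, fun i j => (hdH (i,j)).mono (by omega), by omega, by omega⟩
  obtain ⟨b', hb'1, hb'2⟩ := outer_flip (mob M iA iB b) (by
    intro h0
    apply hb
    refine Polynomial.eq_zero_of_infinite_isRoot _ ?_
    refine Set.Infinite.mono (s := Set.image Complex.ofReal (Set.Ioi 0)) ?_ ((Set.Ioi_infinite _).image Complex.ofReal_injective.injOn)
    rintro _ ⟨s, -, rfl⟩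
    have hs : ((s:ℂ) + Complex.I) ≠ 0 := by simpa [cB] using cB_ne s
    have h3 : iB.eval (cA.eval (s:ℂ) / cB.eval (s:ℂ)) = 2 * Complex.I / (s + Complex.I) := by
      simp only [iB, cA, cB, Polynomial.eval_add, Polynomial.eval_sub, Polynomial.eval_X, Polynomial.eval_C, Polynomial.eval_one]
      field_simp; ring
    have h4 : iA.eval (cA.eval (s:ℂ) / cB.eval (s:ℂ)) = 2 * Complex.I * s / (s + Complex.I) := by
      simp only [iA, cA, cB, Polynomial.eval_add, Polynomial.eval_sub, Polynomial.eval_X, Polynomial.eval_C, Polynomial.eval_one, Polynomial.eval_mul]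
      field_simp; ring
    have hne : iB.eval (cA.eval (s:ℂ) / cB.eval (s:ℂ)) ≠ 0 := by
      rw [h3]; exact div_ne_zero (by simp) hs
    have h5 := mob_eval (a := iA) hM3 hne
    rw [h0, Polynomial.eval_zero, eq_comm, mul_eq_zero] at h5
    have h6 := h5.resolve_left (pow_ne_zero _ hne)
    rw [h3, h4] at h6
    have : 2 * Complex.I * s / (s + Complex.I) / (2 * Complex.I / (s + Complex.I)) = s := by
      field_simp
    rw [this] at h6
    exact h6)
  refine ⟨J, iJ, Matrix.of fun i j => Polynomial.C ((1 - Polynomial.X)^(M+1)) * (1 - Polynomial.X) * mob2 M iA iB (H i j),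
    Polynomial.C (Polynomial.C ((2 * Complex.I)^(d+d)) * (1 - Polynomial.X)^(M-d+1) * b') * (1 - Polynomial.X)^(M-d+1), ?_, ?_⟩
  · intro ζ z hζ hz
    have hn : ∀ x : ℂ, ‖x‖ < 1 → 1 - x ≠ 0 := by
      intro x hx h0
      rw [← sub_eq_zero.1 h0] at hx; simp at hx
    simp only [Polynomial.coe_evalEvalRingHom, Polynomial.evalEval_mul, Polynomial.evalEval_C, Polynomial.evalEval_pow, Polynomial.evalEval_sub,
      Polynomial.evalEval_one, Polynomial.evalEval_X, Polynomial.eval_mul, Polynomial.eval_C, Polynomial.eval_pow, Polynomial.eval_sub, Polynomial.eval_one,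
      Polynomial.eval_X]
    exact mul_ne_zero (mul_ne_zero (mul_ne_zero (by simp) (pow_ne_zero _ (hn _ hζ))) (hb'1 _ hζ)) (pow_ne_zero _ (hn _ hz))
  · intro ζ z hζ hz
    by_cases h1 : ζ = 1 ∨ z = 1
    · have e0 : e2 ζ z (Polynomial.C (Polynomial.C ((2 * Complex.I)^(d+d)) * (1 - Polynomial.X)^(M-d+1) * b') * (1 - Polynomial.X)^(M-d+1)) = 0 := by
        rcases h1 with rfl | rfl <;> simp
      rw [e0]
      have e1 : (Matrix.of fun i j => Polynomial.C ((1 - Polynomial.X)^(M+1)) * (1 - Polynomial.X) * mob2 M iA iB (H i j)).map (e2 ζ z) = 0 := by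
        ext i j
        rcases h1 with rfl | rfl <;> simp
      rw [e1]; simp
    · push Not at h1
      obtain ⟨s, hs1, hs2, hs3⟩ := cayley_inv hζ h1.1
      obtain ⟨x, hx1, hx2, hx3⟩ := cayley_inv hz h1.2
      have hζn : iB.eval ζ ≠ 0 := by simpa [iB, sub_eq_zero] using h1.1.symm
      have hzn : iB.eval z ≠ 0 := by simpa [iB, sub_eq_zero] using h1.2.symm
      have ebb : ‖b'.eval ζ‖ = ‖(1 - ζ)^M * b.eval (s:ℂ)‖ := by
        rw [hb'2 ζ hζ, mob_eval hM3 hζn, hs1]; simp [iB]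
      have eH : (Matrix.of fun i j => Polynomial.C ((1 - Polynomial.X)^(M+1)) * (1 - Polynomial.X) * mob2 M iA iB (H i j)).map (e2 ζ z) =
          ((1-ζ)^(M+1) * (1 - z) * ((1-ζ)^M * (1-z)^M)) • H.map (ev2 (s, x)) := by
        ext i j
        have := mob2_eval (a := iA) (hM1 i j) hζn hzn
        rw [hs1, hx1] at this
        simp only [Matrix.map_apply, Matrix.of_apply, Matrix.smul_apply, Polynomial.coe_evalEvalRingHom, Polynomial.evalEval_mul, Polynomial.evalEval_C,
          Polynomial.evalEval_sub, Polynomial.evalEval_one, Polynomial.evalEval_X, Polynomial.eval_pow, Polynomial.eval_sub, Polynomial.eval_one,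
          Polynomial.eval_X, this, smul_eq_mul]
        simp [iB]; ring
      have hHs := congrArg (fun A => A.map (ev2 (s,x))) hH
      simp only [Matrix.map_mul, conj_map_ev2] at hHs
      have hsm : (Polynomial.C (star b * b) • (E'ᴴ * E' - F'ᴴ * F')).map (ev2 (s,x)) = (star (b.eval (s:ℂ)) * b.eval (s:ℂ)) • (E'ᴴ * E' - F'ᴴ * F').map (ev2 (s,x)) := by
        ext i j
        have : (ev2 (s,x)) (Polynomial.C (star b * b)) = star (b.eval (s:ℂ)) * b.eval (s:ℂ) := by
          rw [Polynomial.coe_evalEvalRingHom, Polynomial.evalEval_C, Polynomial.eval_mul]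
          congr 1
          exact ev1_star s b
        rw [Matrix.map_apply, Matrix.smul_apply, Matrix.smul_apply, smul_eq_mul, smul_eq_mul, map_mul, this, Matrix.map_apply]
      rw [hsm, key (s,x) ζ z hs2 hx2, smul_smul] at hHs
      rw [eH, smul_gram, hHs, smul_smul]
      congr 1
      have n1 : ∀ c : ℂ, star c * c = ((‖c‖^2 : ℝ) : ℂ) := by
        intro c
        rw [mul_comm]
        have := Complex.mul_conj c
        rw [Complex.normSq_eq_norm_sq] at this
        exact this
      simp only [n1, ← Complex.ofReal_mul]
      congr 1
      have sqq : ∀ A B C D : ℝ, A * (B * C) = D → A^2 * (B^2 * C^2) = D^2 := by rintro A B C D rfl; ring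
      apply sqq
      simp only [Polynomial.coe_evalEvalRingHom, Polynomial.evalEval_mul, Polynomial.evalEval_C, Polynomial.evalEval_pow, Polynomial.evalEval_sub,
      Polynomial.evalEval_one, Polynomial.evalEval_X, Polynomial.eval_mul, Polynomial.eval_C, Polynomial.eval_pow, Polynomial.eval_sub, Polynomial.eval_one,
      Polynomial.eval_X]
      rw [norm_mul (_ * _ * Polynomial.eval ζ b'), norm_mul _ (Polynomial.eval ζ b'), ebb]
      simp only [← norm_mul]
      congr 1
      have e2I : (2 * Complex.I)^(d+d) = ((1 - ζ) * cB.eval (s:ℂ))^d * ((1 - z) * cB.eval (x:ℂ))^d := by rw [hs3, hx3, pow_add]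
      rw [e2I]
      obtain ⟨r, rfl⟩ := Nat.exists_eq_add_of_le hM2
      have : d + r - d = r := by omega
      rw [this, mul_pow, mul_pow]
      generalize 1 - ζ = u
      generalize 1 - z = v
      ring

theorem sos2_circle {a b n : Type} [Fintype a] [Fintype b] [Fintype n]
    (E : Matrix a n ℂ[X][X]) (F : Matrix b n ℂ[X][X])
    (h : ∀ ζ z : ℂ, ‖ζ‖ = 1 → ‖z‖ = 1 → ((E.map (e2 ζ z))ᴴ * E.map (e2 ζ z) - (F.map (e2 ζ z))ᴴ * F.map (e2 ζ z)).PosSemidef) :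
    ∃ (J : Type) (_ : Fintype J) (H : Matrix J n ℂ[X][X]) (μ : ℂ[X][X]),
      (∀ ζ z : ℂ, ‖ζ‖ < 1 → ‖z‖ < 1 → e2 ζ z μ ≠ 0) ∧
      ∀ ζ z : ℂ, ‖ζ‖ = 1 → ‖z‖ = 1 → (H.map (e2 ζ z))ᴴ * H.map (e2 ζ z) =
        (star (e2 ζ z μ) * e2 ζ z μ) • ((E.map (e2 ζ z))ᴴ * E.map (e2 ζ z) - (F.map (e2 ζ z))ᴴ * F.map (e2 ζ z)) := by
  let e := Fintype.equivFin n
  obtain ⟨J, iJ, H, μ, h1, h2⟩ := sos2_circle_fin (E.submatrix id e.symm) (F.submatrix id e.symm)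
    (fun ζ z hζ hz => (h ζ z hζ hz).submatrix e.symm)
  refine ⟨J, iJ, H.submatrix id e, μ, h1, fun ζ z hζ hz => ?_⟩
  have := congrArg (fun A => A.submatrix e e) (h2 ζ z hζ hz)
  ext i j
  have h3 := congrFun (congrFun this i) j
  simpa [Matrix.submatrix_apply, Matrix.mul_apply, Matrix.map_apply] using h3

end Part11

section Part12
open scoped Polynomial
open Matrix
open scoped ComplexOrder

lemma circle_dense {S : Set ℂ} (hS : S.Finite) {P : Set ℂ} (hP : IsClosed P)
    (h : ∀ z : ℂ, ‖z‖ = 1 → z ∉ S → z ∈ P) (z : ℂ) (hz : ‖z‖ = 1) : z ∈ P := by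
  let u : ℕ → ℂ := fun n => z * Complex.exp (((1 / ((n:ℝ)+1) : ℝ) : ℂ) * Complex.I)
  have hz0 : z ≠ 0 := by rintro rfl; simp at hz
  have hu : Filter.Tendsto u Filter.atTop (nhds z) := by
    have h1 : Filter.Tendsto (fun n : ℕ => (1 / ((n:ℝ)+1) : ℝ)) Filter.atTop (nhds 0) := tendsto_one_div_add_atTop_nhds_zero_nat
    have h2 : Continuous fun t : ℝ => z * Complex.exp ((t:ℂ) * Complex.I) := by fun_prop
    have := (h2.tendsto 0).comp h1
    simp only [Complex.ofReal_zero, zero_mul, Complex.exp_zero, mul_one] at this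
    exact this
  have hinj : Function.Injective u := by
    intro n m hnm
    have h1 := mul_left_cancel₀ hz0 hnm
    have hb : ∀ n : ℕ, (1 / ((n:ℝ)+1) : ℝ) ∈ Set.Ioc (-Real.pi) Real.pi := by
      intro n
      have h0 : 0 < (1 / ((n:ℝ)+1) : ℝ) := by positivity
      have h1 : (1 / ((n:ℝ)+1) : ℝ) ≤ 1 := by
        rw [div_le_one (by positivity)]; linarith [(Nat.cast_nonneg n : (0:ℝ) ≤ n)]
      constructor <;> linarith [Real.pi_gt_three]
    have h2 := congrArg Complex.arg h1
    rw [Complex.arg_exp_mul_I, Complex.arg_exp_mul_I, (toIocMod_eq_self Real.two_pi_pos).2 (by simpa [two_mul] using hb n),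
      (toIocMod_eq_self Real.two_pi_pos).2 (by simpa [two_mul] using hb m)] at h2
    have h3 : (n:ℝ) + 1 = m + 1 := by
      have := congrArg (fun x => x⁻¹) h2
      simpa using this
    exact_mod_cast (add_right_cancel h3)
  refine hP.mem_of_tendsto hu ?_
  have h3 : ∀ᶠ n in Filter.atTop, u n ∉ S := by
    have := hinj.tendsto_cofinite.eventually (hS.compl_mem_cofinite)
    rwa [Nat.cofinite_eq_atTop] at this
  filter_upwards [h3] with n hn
  refine h _ ?_ hn
  simp only [u, norm_mul, hz, Complex.norm_exp_ofReal_mul_I, mul_one]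

lemma star_mul_circle {z : ℂ} (hz : ‖z‖ = 1) : star z * z = 1 := by
  have := Complex.mul_conj z
  rw [Complex.normSq_eq_norm_sq, hz] at this
  rw [mul_comm]
  simpa using this

lemma circle_infinite : {z : ℂ | ‖z‖ = 1}.Infinite := by
  intro hf
  have := circle_dense hf (P := ∅) isClosed_empty (fun z h1 h2 => absurd h1 h2) 1 (by simp)
  exact this

lemma poly_zero_of_circle (p : ℂ[X]) (h : ∀ z : ℂ, ‖z‖ = 1 → p.eval z = 0) : p = 0 :=
  Polynomial.eq_zero_of_infinite_isRoot _ (circle_infinite.mono fun z hz => h z hz)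

lemma cont_map1 {a n : Type} [Fintype a] [Fintype n] (B : Matrix a n ℂ[X]) : Continuous fun z : ℂ => B.map (e1 z) :=
  continuous_matrix fun i j => (B i j).continuous

lemma cont_gram1 {a n : Type} [Fintype a] [Fintype n] (B : Matrix a n ℂ[X]) : Continuous fun z : ℂ => (B.map (e1 z))ᴴ * B.map (e1 z) :=
  (cont_map1 B).matrix_conjTranspose.matrix_mul (cont_map1 B)

lemma gram_row {J : Type} [Fintype J] [DecidableEq J] {n : Type} [Fintype n] (A : Matrix J n ℂ) (h : ∀ y : J → ℂ, y ᵥ* A = 0 → y = 0) :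
    (A * Aᴴ).det ≠ 0 := by
  intro hd
  obtain ⟨v, hv, hv0⟩ := Matrix.exists_vecMul_eq_zero_iff.2 hd
  apply hv
  apply h
  rw [← Matrix.vecMul_vecMul] at hv0
  have h1 : (v ᵥ* A) ⬝ᵥ star (v ᵥ* A) = 0 := by
    have h2 : star (v ᵥ* A) = Aᴴ *ᵥ star v := by rw [Matrix.star_vecMul]
    rw [h2, Matrix.dotProduct_mulVec, hv0, zero_dotProduct]
  exact dotProduct_self_star_eq_zero.1 h1

lemma row_of_det {J : Type} [Fintype J] [DecidableEq J] {n : Type} [Fintype n] (A : Matrix J n ℂ) (R : Matrix n J ℂ) (h : (A * R).det ≠ 0) :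
    ∀ y : J → ℂ, y ᵥ* A = 0 → y = 0 := by
  intro y hy
  by_contra hne
  exact h (Matrix.exists_vecMul_eq_zero_iff.1 ⟨y, hne, by rw [← Matrix.vecMul_vecMul, hy, Matrix.zero_vecMul]⟩)

/-- one variable on the line -/
theorem sos1_line (n : ℕ) (T : Matrix (Fin n) (Fin n) ℂ[X]) (hT : ∀ s, (T.map (ev1 s)).PosSemidef) :
    ∃ (J : Type) (_ : Fintype J) (_ : DecidableEq J) (C : Matrix J (Fin n) ℂ[X]), Cᴴ * C = T ∧
      ∃ s : ℝ, ∀ y : J → ℂ, y ᵥ* C.map (ev1 s) = 0 → y = 0 := by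
  obtain ⟨J, i1, i2, H, hH, hrow⟩ := matrix_sos1 n T hT
  obtain ⟨G, G', C, hG, hC, hCC⟩ := cassels (k := ℂ) (F := kC) fracStar_algebraMap aniso_C H T hH
  refine ⟨J, i1, i2, C, hCC, ?_⟩
  have hG' : G * G' = 1 := hG
  have hd : (C * Cᴴ).det ≠ 0 := by
    intro hd
    obtain ⟨v, hv, hv0⟩ := Matrix.exists_vecMul_eq_zero_iff.2 hd
    apply hv
    rw [← Matrix.vecMul_vecMul] at hv0
    have h1 : (v ᵥ* C) = 0 := by
      have h2 : star (v ᵥ* C) = Cᴴ *ᵥ star v := by rw [Matrix.star_vecMul]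
      apply aniso_poly
      have : star (v ᵥ* C) ⬝ᵥ (v ᵥ* C) = 0 := by
        rw [dotProduct_comm, h2, Matrix.dotProduct_mulVec, hv0, zero_dotProduct]
      exact this
    let v' : J → kC := fun j => algebraMap ℂ[X] kC (v j)
    have h3 : v' ᵥ* (G * H) = 0 := by
      rw [← hC]
      ext j
      have := congrArg (algebraMap ℂ[X] kC) (congrFun h1 j)
      simpa [Matrix.vecMul, dotProduct, map_sum, v'] using this
    rw [← Matrix.vecMul_vecMul] at h3
    have h4 := hrow _ h3
    have h5 : v' = 0 := by
      have : (v' ᵥ* G) ᵥ* G' = 0 := by rw [h4, Matrix.zero_vecMul]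
      rwa [Matrix.vecMul_vecMul, hG', Matrix.vecMul_one] at this
    ext1 j
    exact IsFractionRing.injective ℂ[X] kC (by simpa [v'] using congrFun h5 j)
  have : ∃ s : ℝ, (C * Cᴴ).det.eval (s:ℂ) ≠ 0 := by
    by_contra hcon
    push Not at hcon
    exact hd (poly_zero_of_real _ hcon)
  obtain ⟨s, hs⟩ := this
  refine ⟨s, row_of_det _ ((C.map (ev1 s))ᴴ) ?_⟩
  rw [← conj_map_ev1, ← Matrix.map_mul]
  have : ((C * Cᴴ).map (ev1 s)).det = ev1 s (C * Cᴴ).det := ((ev1 s).map_det _).symm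
  rw [this]
  exact hs

theorem fr_pre {a b : Type} {n : ℕ} [Fintype a] [Fintype b]
    (E : Matrix a (Fin n) ℂ[X]) (F : Matrix b (Fin n) ℂ[X])
    (h : ∀ z : ℂ, ‖z‖ = 1 → ((E.map (e1 z))ᴴ * E.map (e1 z) - (F.map (e1 z))ᴴ * F.map (e1 z)).PosSemidef) :
    ∃ (J : Type) (_ : Fintype J) (_ : DecidableEq J) (H : Matrix J (Fin n) ℂ[X]) (M : ℕ),
      (∃ z : ℂ, ∀ y : J → ℂ, y ᵥ* H.map (e1 z) = 0 → y = 0) ∧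
      ∀ z : ℂ, ‖z‖ = 1 → (H.map (e1 z))ᴴ * H.map (e1 z) =
        (star ((1 - z)^M) * (1 - z)^M) • ((E.map (e1 z))ᴴ * E.map (e1 z) - (F.map (e1 z))ᴴ * F.map (e1 z)) := by
  obtain ⟨dE, hdE⟩ := exists_deg_fin (fun x : a × Fin n => E x.1 x.2)
  obtain ⟨dF, hdF⟩ := exists_deg_fin (fun x : b × Fin n => F x.1 x.2)
  obtain ⟨d, hd1, hd2⟩ : ∃ d, (∀ i j, (E i j).natDegree ≤ d) ∧ (∀ i j, (F i j).natDegree ≤ d) :=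
    ⟨max dE dF, fun i j => (hdE (i,j)).trans (le_max_left _ _), fun i j => (hdF (i,j)).trans (le_max_right _ _)⟩
  obtain ⟨E', hE'⟩ : ∃ E' : Matrix a (Fin n) ℂ[X], E' = E.map (mob d cA cB) := ⟨_, rfl⟩
  obtain ⟨F', hF'⟩ : ∃ F' : Matrix b (Fin n) ℂ[X], F' = F.map (mob d cA cB) := ⟨_, rfl⟩
  have key : ∀ s : ℝ, ∀ z : ℂ, cA.eval (s:ℂ) / cB.eval (s:ℂ) = z →
      (E'ᴴ * E' - F'ᴴ * F').map (ev1 s) = (star ((cB.eval (s:ℂ))^d) * ((cB.eval (s:ℂ))^d)) •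
        ((E.map (e1 z))ᴴ * E.map (e1 z) - (F.map (e1 z))ᴴ * F.map (e1 z)) := by
    rintro s z rfl
    have h1 : E'.map (ev1 s) = ((cB.eval (s:ℂ))^d) • E.map (e1 (cA.eval (s:ℂ) / cB.eval (s:ℂ))) := by
      ext i j
      rw [hE']
      exact mob_eval (hd1 i j) (cB_ne _)
    have h2 : F'.map (ev1 s) = ((cB.eval (s:ℂ))^d) • F.map (e1 (cA.eval (s:ℂ) / cB.eval (s:ℂ))) := by
      ext i j
      rw [hF']
      exact mob_eval (hd2 i j) (cB_ne _)
    rw [Matrix.map_sub _ (fun x y => map_sub _ x y), Matrix.map_mul, Matrix.map_mul, conj_map_ev1, conj_map_ev1, h1, h2, smul_gram, smul_gram, smul_sub]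
  obtain ⟨J, iJ, iD, H, hH, s0, hs0⟩ := sos1_line n (E'ᴴ * E' - F'ᴴ * F') (by
    intro s
    rw [key s _ rfl]
    exact (h _ (cayley_circle _)).smul (star_mul_nonneg _))
  obtain ⟨dH, hdH⟩ := exists_deg_fin (fun x : J × Fin n => H x.1 x.2)
  obtain ⟨M, hM1, hM2⟩ : ∃ M, (∀ i j, (H i j).natDegree ≤ M) ∧ d ≤ M :=
    ⟨dH + d, fun i j => (hdH (i,j)).trans (by omega), by omega⟩
  have c2 : (2 * Complex.I)^d ≠ 0 := by simp
  have eH : ∀ z s : ℂ, z ≠ 1 → iA.eval z / iB.eval z = s →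
    (Matrix.of fun i j => Polynomial.C ((2 * Complex.I)^d)⁻¹ * (1 - Polynomial.X) * mob M iA iB (H i j)).map (e1 z) =
          (((2 * Complex.I)^d)⁻¹ * (1 - z) * (1 - z)^M) • H.map (e1 s) := by
    rintro z s hz rfl
    have hzn : iB.eval z ≠ 0 := by simpa [iB, sub_eq_zero] using hz.symm
    ext i j
    have := mob_eval (a := iA) (hM1 i j) hzn
    simp only [Matrix.map_apply, Matrix.of_apply, Matrix.smul_apply, Polynomial.coe_evalRingHom, Polynomial.eval_mul, Polynomial.eval_C,
          Polynomial.eval_pow, Polynomial.eval_sub, Polynomial.eval_one,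
          Polynomial.eval_X, this, smul_eq_mul]
    simp [iB]; ring
  refine ⟨J, iJ, iD, Matrix.of fun i j => Polynomial.C ((2 * Complex.I)^d)⁻¹ * (1 - Polynomial.X) * mob M iA iB (H i j), M-d+1, ?_, ?_⟩
  · have hs : ((s0:ℂ) + Complex.I) ≠ 0 := by simpa [cB] using cB_ne s0
    have h3 : 1 - (cA.eval (s0:ℂ) / cB.eval (s0:ℂ)) = 2 * Complex.I / (s0 + Complex.I) := by
      simp only [iB, cA, cB, Polynomial.eval_add, Polynomial.eval_sub, Polynomial.eval_X, Polynomial.eval_C, Polynomial.eval_one]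
      field_simp; ring
    have h4 : 1 + (cA.eval (s0:ℂ) / cB.eval (s0:ℂ)) = 2 * s0 / (s0 + Complex.I) := by
      simp only [iB, cA, cB, Polynomial.eval_add, Polynomial.eval_sub, Polynomial.eval_X, Polynomial.eval_C, Polynomial.eval_one]
      field_simp; ring
    have hne : 1 - (cA.eval (s0:ℂ) / cB.eval (s0:ℂ)) ≠ 0 := by rw [h3]; exact div_ne_zero (by simp) hs
    refine ⟨cA.eval (s0:ℂ) / cB.eval (s0:ℂ), fun y hy => hs0 y ?_⟩
    rw [eH _ s0 (fun h => hne (by rw [h, sub_self])) (by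
      simp only [iA, iB, Polynomial.eval_add, Polynomial.eval_sub, Polynomial.eval_X, Polynomial.eval_C, Polynomial.eval_one, Polynomial.eval_mul]
      rw [h3, h4]
      field_simp), Matrix.vecMul_smul] at hy
    exact (smul_eq_zero.1 hy).resolve_left (mul_ne_zero (mul_ne_zero (inv_ne_zero c2) hne) (pow_ne_zero _ hne))
  · intro z hz
    by_cases h1 : z = 1
    · subst h1
      have e1 : (Matrix.of fun i j => Polynomial.C ((2 * Complex.I)^d)⁻¹ * (1 - Polynomial.X) * mob M iA iB (H i j)).map (e1 1) = 0 := by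
        ext i j
        simp
      rw [e1]; simp
    · obtain ⟨s, hs1, hs2, hs3⟩ := cayley_inv hz h1
      have hHs := congrArg (fun A => A.map (ev1 s)) hH
      simp only [Matrix.map_mul, conj_map_ev1] at hHs
      rw [key s z hs2] at hHs
      rw [eH z s h1 hs1, smul_gram, hHs, smul_smul]
      congr 1
      have : ((2 * Complex.I)^d)⁻¹ * (1 - z) * (1 - z)^M * (cB.eval (s:ℂ))^d = (1 - z)^(M-d+1) := by
        rw [← hs3]
        obtain ⟨r, rfl⟩ := Nat.exists_eq_add_of_le hM2
        have h2 : 1 - z ≠ 0 := sub_ne_zero.2 (Ne.symm h1)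
        have h3 := cB_ne s
        have : d + r - d = r := by omega
        have h4 : ((1 - z)^d * (cB.eval (s:ℂ))^d) ≠ 0 := mul_ne_zero (pow_ne_zero _ h2) (pow_ne_zero _ h3)
        rw [this, mul_pow, mul_assoc, mul_assoc, inv_mul_eq_iff_eq_mul₀ h4]
        generalize 1 - z = u
        ring
      rw [← this, star_mul _ (Polynomial.eval (s:ℂ) cB ^ d)]
      ring

theorem fr_div {n : Type} [Fintype n] {J : Type} [Fintype J] [DecidableEq J] (G : ℂ → Matrix n n ℂ) (hG : Continuous G) (M : ℕ) :
    ∀ (H : Matrix J n ℂ[X]),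
      (∃ z : ℂ, ∀ y : J → ℂ, y ᵥ* H.map (e1 z) = 0 → y = 0) →
      (∀ z : ℂ, ‖z‖ = 1 → (H.map (e1 z))ᴴ * H.map (e1 z) = (star ((1 - z)^M) * (1 - z)^M) • G z) →
    ∃ (H : Matrix J n ℂ[X]), 
      (∃ z : ℂ, ∀ y : J → ℂ, y ᵥ* H.map (e1 z) = 0 → y = 0) ∧
      ∀ z : ℂ, ‖z‖ = 1 → (H.map (e1 z))ᴴ * H.map (e1 z) = G z := by
  induction M with
  | zero => intro H h1 h2; exact ⟨H, h1, fun z hz => by simpa using h2 z hz⟩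
  | succ M ih =>
    intro H h1 h2
    have h3 : H.map (e1 1) = 0 := by
      apply Matrix.conjTranspose_mul_self_eq_zero.1
      rw [h2 1 (by simp)]; simp
    have h4 : ∀ i j, ∃ r : ℂ[X], H i j = (1 - Polynomial.X) * r := by
      intro i j
      have : (H i j).IsRoot 1 := congrFun (congrFun h3 i) j
      obtain ⟨r, hr⟩ := Polynomial.dvd_iff_isRoot.2 this
      exact ⟨-r, by rw [hr]; simp; ring⟩
    choose r hr using h4
    have e : ∀ z, H.map (e1 z) = (1 - z) • (Matrix.of r).map (e1 z) := by
      intro z; ext i j; simp [hr]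
    apply ih (Matrix.of r)
    · obtain ⟨z, hz⟩ := h1
      refine ⟨z, fun y hy => hz y ?_⟩
      rw [e, Matrix.vecMul_smul, hy, smul_zero]
    · intro z hz
      refine circle_dense (S := {1}) (Set.finite_singleton _) (P := {z : ℂ | ((Matrix.of r).map (e1 z))ᴴ * (Matrix.of r).map (e1 z) = (star ((1 - z)^M) * (1 - z)^M) • G z})
        (isClosed_eq (cont_gram1 _) ?_) ?_ z hz
      · exact Continuous.smul (f := fun z : ℂ => star ((1 - z)^M) * (1 - z)^M) (by fun_prop) hG
      · intro z hz h1
        have h5 := h2 z hz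
        rw [e, smul_gram] at h5
        have h6 : 1 - z ≠ 0 := sub_ne_zero.2 (Ne.symm h1)
        have h7 : star (1 - z) * (1 - z) ≠ 0 := mul_ne_zero (star_ne_zero.2 h6) h6
        have h8 : star ((1 - z)^(M+1)) * (1 - z)^(M+1) = (star (1 - z) * (1 - z)) * (star ((1 - z)^M) * (1 - z)^M) := by
          rw [pow_succ, star_mul]; ring
        rw [h8, mul_smul (star (1 - z) * (1 - z))] at h5
        exact smul_right_injective _ h7 h5

lemma roots_countP_one_sub (a : ℂ) (ha : ‖a‖ < 1) :
    (1 - Polynomial.C (star a) * Polynomial.X : ℂ[X]).roots.countP (fun x => ‖x‖ < 1) = 0 := by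
  rw [Multiset.countP_eq_zero]
  intro x hx hlt
  have := (Polynomial.mem_roots'.1 hx).2
  simp only [Polynomial.IsRoot, Polynomial.eval_sub, Polynomial.eval_one, Polynomial.eval_mul, Polynomial.eval_C, Polynomial.eval_X] at this
  have h3 : ‖star a * x‖ = 1 := by rw [← sub_eq_zero.1 this, norm_one]
  rw [norm_mul, norm_star] at h3
  nlinarith [norm_nonneg a, norm_nonneg x]

lemma flip_step {n : Type} [Fintype n] {J : Type} [Fintype J] [DecidableEq J] (B : Matrix J n ℂ[X]) (R : Matrix n J ℂ[X])
    (hR : (B * R).det ≠ 0) (a : ℂ) (ha : ‖a‖ < 1) (y : J → ℂ) (hy : y ≠ 0) (hya : y ᵥ* B.map (e1 a) = 0) :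
    ∃ B' : Matrix J n ℂ[X], (∀ z : ℂ, ‖z‖ = 1 → (B'.map (e1 z))ᴴ * B'.map (e1 z) = (B.map (e1 z))ᴴ * B.map (e1 z)) ∧
      (B' * R).det ≠ 0 ∧ (B' * R).det.roots.countP (fun x => ‖x‖ < 1) < (B * R).det.roots.countP (fun x => ‖x‖ < 1) := by
  obtain ⟨e, he, hea⟩ : ∃ e : J → ℂ, ∑ i, e i * star (e i) = 1 ∧ e ᵥ* B.map (e1 a) = 0 := by
    have h1 : 0 < ∑ i, ‖y i‖^2 := by
      have : ∃ i, y i ≠ 0 := by by_contra hc; push Not at hc; exact hy (funext hc)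
      obtain ⟨i, hi⟩ := this
      exact Finset.sum_pos' (fun _ _ => by positivity) ⟨i, Finset.mem_univ _, by positivity⟩
    refine ⟨(((Real.sqrt (∑ i, ‖y i‖^2))⁻¹ : ℝ) : ℂ) • y, ?_, by rw [Matrix.smul_vecMul, hya, smul_zero]⟩
    have : ∀ i, (((Real.sqrt (∑ i, ‖y i‖^2))⁻¹ : ℝ) : ℂ) * y i * star ((((Real.sqrt (∑ i, ‖y i‖^2))⁻¹ : ℝ) : ℂ) * y i) =
      (((∑ i, ‖y i‖^2)⁻¹ * ‖y i‖^2 : ℝ) : ℂ) := by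
      intro i
      have := Complex.mul_conj ((((Real.sqrt (∑ i, ‖y i‖^2))⁻¹ : ℝ) : ℂ) * y i)
      rw [Complex.normSq_eq_norm_sq, norm_mul, mul_pow, Complex.norm_real, Real.norm_eq_abs, sq_abs, inv_pow, Real.sq_sqrt h1.le] at this
      exact this
    simp only [Pi.smul_apply, smul_eq_mul, this]
    rw [← Complex.ofReal_sum, ← Finset.mul_sum, inv_mul_cancel₀ h1.ne', Complex.ofReal_one]
  let r : n → ℂ[X] := fun j => ∑ i, Polynomial.C (e i) * B i j
  have hr : ∀ j, ∃ r' : ℂ[X], r j = (Polynomial.X - Polynomial.C a) * r' := by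
    intro j
    have : (r j).IsRoot a := by
      have := congrFun hea j
      simpa [r, Polynomial.IsRoot, Polynomial.eval_finset_sum, Matrix.vecMul, dotProduct] using this
    exact Polynomial.dvd_iff_isRoot.2 this
  choose r' hr' using hr
  let w : ℂ[X] := 1 - Polynomial.C (star a) * Polynomial.X
  let B' : Matrix J n ℂ[X] := Matrix.of fun i j => B i j + Polynomial.C (star (e i)) * (w * r' j - r j)
  have hee : ∑ i, Polynomial.C (e i) * Polynomial.C (star (e i)) = 1 := by
    simp_rw [← Polynomial.C_mul]; rw [← map_sum, he, Polynomial.C_1]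
  have heB' : ∀ j, ∑ i, Polynomial.C (e i) * B' i j = w * r' j := by
    intro j
    simp only [B', Matrix.of_apply, mul_add, Finset.sum_add_distrib, ← mul_assoc, ← Finset.sum_mul, hee]
    simp only [r]; ring
  have hdet : (Polynomial.X - Polynomial.C a) * (B' * R).det = w * (B * R).det := by
    have hd : ∀ c : ℂ[X], (1 + Matrix.replicateCol Unit (fun i => Polynomial.C (star (e i)) * c) * Matrix.replicateRow Unit (fun i => Polynomial.C (e i))).det = 1 + c := by
      intro c
      rw [Matrix.det_one_add_replicateCol_mul_replicateRow]
      congr 1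
      simp only [dotProduct]
      conv_rhs => rw [← one_mul c, ← hee, Finset.sum_mul]
      refine Finset.sum_congr rfl fun i _ => by ring
    have h1 : (1 + Matrix.replicateCol Unit (fun i => Polynomial.C (star (e i)) * (Polynomial.X - Polynomial.C a - 1)) * Matrix.replicateRow Unit (fun i => Polynomial.C (e i))) * B' =
      (1 + Matrix.replicateCol Unit (fun i => Polynomial.C (star (e i)) * (w - 1)) * Matrix.replicateRow Unit (fun i => Polynomial.C (e i))) * B := by
      rw [Matrix.add_mul, Matrix.add_mul, Matrix.one_mul, Matrix.one_mul, Matrix.mul_assoc, Matrix.mul_assoc]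
      ext1 i j
      have e1 : (Matrix.replicateRow Unit (fun i => Polynomial.C (e i)) * B') () j = w * r' j := heB' j
      have e2 : (Matrix.replicateRow Unit (fun i => Polynomial.C (e i)) * B) () j = r j := rfl
      simp only [Matrix.add_apply, Matrix.mul_apply (M := Matrix.replicateCol Unit _), Finset.univ_unique, Finset.sum_singleton, PUnit.default_eq_unit, e1, e2,
        Matrix.replicateCol_apply]
      simp only [B', Matrix.of_apply, hr']
      ring
    have h2 := congrArg (fun A => (A * R).det) h1
    simp only [Matrix.mul_assoc _ _ R, Matrix.det_mul, hd] at h2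
    rw [← sub_eq_zero] at h2 ⊢
    rw [← h2]
    ring
  have hw : w ≠ 0 := by
    intro h
    have := congrArg (Polynomial.eval 0) h
    simp [w] at this
  have hne : (Polynomial.X - Polynomial.C a) * (B' * R).det ≠ 0 := by rw [hdet]; exact mul_ne_zero hw hR
  refine ⟨B', fun z hz => ?_, right_ne_zero_of_mul hne, ?_⟩
  · ext j l
    simp only [Matrix.mul_apply, Matrix.conjTranspose_apply, Matrix.map_apply]
    let d : n → ℂ := fun j => e1 z (w * r' j - r j)
    have hB' : ∀ i j, e1 z (B' i j) = e1 z (B i j) + star (e i) * d j := by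
      intro i j; simp [B', d]
    have hrz : ∀ j, e1 z (r j) = ∑ i, e i * e1 z (B i j) := by
      intro j; simp [r, Polynomial.eval_finset_sum]
    have hd : ∀ j, e1 z (r j) + d j = e1 z w * e1 z (r' j) := by intro j; simp [d]
    have hrr : ∀ j, e1 z (r j) = (z - a) * e1 z (r' j) := by intro j; simp [hr']
    have hwz : star (e1 z w) * e1 z w = star (z - a) * (z - a) := by
      have h1 := star_mul_circle hz
      have : e1 z w = z * star (z - a) := by
        simp only [w, Polynomial.coe_evalRingHom, Polynomial.eval_sub, Polynomial.eval_one, Polynomial.eval_mul, Polynomial.eval_C, Polynomial.eval_X, star_sub]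
        rw [← h1]; ring
      rw [this, star_mul, star_star]
      calc _ = (star z * z) * (star (z - a) * (z - a)) := by ring
        _ = _ := by rw [h1, one_mul]
    calc ∑ x, star (e1 z (B' x j)) * e1 z (B' x l) = ∑ x, (star (e1 z (B x j)) * e1 z (B x l) + star (e x * e1 z (B x j)) * d l + star (d j) * (e x * e1 z (B x l))
            + (e x * star (e x)) * (star (d j) * d l)) := by
          refine Finset.sum_congr rfl fun x _ => ?_
          rw [hB', hB']; simp only [star_add, star_mul, star_star]; ring
      _ = ∑ x, star (e1 z (B x j)) * e1 z (B x l) + (star (e1 z (r j) + d j) * (e1 z (r l) + d l) - star (e1 z (r j)) * e1 z (r l)) := by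
          rw [Finset.sum_add_distrib, Finset.sum_add_distrib, Finset.sum_add_distrib, ← Finset.sum_mul, ← Finset.mul_sum, ← Finset.sum_mul, he, ← star_sum, ← hrz, ← hrz]
          simp only [star_add]; ring
      _ = _ := by
          rw [hd, hd, hrr, hrr, star_mul, star_mul]
          have : star (e1 z (r' j)) * star (e1 z w) * (e1 z w * e1 z (r' l)) - star (e1 z (r' j)) * star (z - a) * ((z - a) * e1 z (r' l)) =
            (star (e1 z w) * e1 z w - star (z - a) * (z - a)) * (star (e1 z (r' j)) * e1 z (r' l)) := by ring
          rw [this, hwz, sub_self, zero_mul, add_zero]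
  · have h1 := congrArg (fun p : ℂ[X] => p.roots.countP (fun x => ‖x‖ < 1)) hdet
    rw [Polynomial.roots_mul hne, Polynomial.roots_mul (mul_ne_zero hw hR), Multiset.countP_add, Multiset.countP_add, roots_countP_one_sub a ha,
      Polynomial.roots_X_sub_C, zero_add] at h1
    rw [← h1]
    have : Multiset.countP (fun x : ℂ => ‖x‖ < 1) {a} = 1 := by
      rw [← Multiset.cons_zero, Multiset.countP_cons_of_pos (p := fun x : ℂ => ‖x‖ < 1) _ ha, Multiset.countP_zero]
    omega

theorem flip_all {n : Type} [Fintype n] {J : Type} [Fintype J] [DecidableEq J] (R : Matrix n J ℂ[X]) (N : ℕ) :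
    ∀ (B : Matrix J n ℂ[X]) (hR : (B * R).det ≠ 0) (hN : (B * R).det.roots.countP (fun x => ‖x‖ < 1) = N),
    ∃ B' : Matrix J n ℂ[X], (∀ z : ℂ, ‖z‖ = 1 → (B'.map (e1 z))ᴴ * B'.map (e1 z) = (B.map (e1 z))ᴴ * B.map (e1 z)) ∧
      ∀ z : ℂ, ‖z‖ < 1 → ∀ y : J → ℂ, y ᵥ* B'.map (e1 z) = 0 → y = 0 := by
  induction N using Nat.strong_induction_on with
  | _ N ih =>
    intro B hR hN
    by_cases h : ∀ z : ℂ, ‖z‖ < 1 → ∀ y : J → ℂ, y ᵥ* B.map (e1 z) = 0 → y = 0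
    · exact ⟨B, fun _ _ => rfl, h⟩
    · push Not at h
      obtain ⟨a, ha, y, hy, hy0⟩ := h
      obtain ⟨B', h1, h2, h3⟩ := flip_step B R hR a ha y hy0 hy
      obtain ⟨Bnew, h4, h5⟩ := ih _ (hN ▸ h3) B' h2 rfl
      exact ⟨Bnew, fun z hz => (h4 z hz).trans (h1 z hz), h5⟩

theorem fr_outer {a b n : Type} [Fintype a] [Fintype b] [Fintype n]
    (E : Matrix a n ℂ[X]) (F : Matrix b n ℂ[X])
    (h : ∀ z : ℂ, ‖z‖ = 1 → ((E.map (e1 z))ᴴ * E.map (e1 z) - (F.map (e1 z))ᴴ * F.map (e1 z)).PosSemidef) :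
    ∃ (J : Type) (_ : Fintype J) (_ : DecidableEq J) (B : Matrix J n ℂ[X]),
      (∀ z : ℂ, ‖z‖ = 1 → (B.map (e1 z))ᴴ * B.map (e1 z) = (E.map (e1 z))ᴴ * E.map (e1 z) - (F.map (e1 z))ᴴ * F.map (e1 z)) ∧
      ∀ z : ℂ, ‖z‖ < 1 → ∀ y : J → ℂ, y ᵥ* B.map (e1 z) = 0 → y = 0 := by
  let e := Fintype.equivFin n
  obtain ⟨J, iJ, iD, H, M, h1, h2⟩ := fr_pre (E.submatrix id e.symm) (F.submatrix id e.symm)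
    (fun z hz => (h z hz).submatrix e.symm)
  obtain ⟨H', ⟨z0, hz0⟩, h3⟩ := fr_div (fun z => _) ((cont_gram1 _).sub (cont_gram1 _)) M H h1 h2
  obtain ⟨B, h4, h5⟩ := flip_all (((H'.map (e1 z0))ᴴ).map Polynomial.C) _ H' (by
    intro h0
    apply gram_row _ hz0
    have := congrArg (e1 z0) h0
    rw [map_zero, RingHom.map_det] at this
    rw [← this]
    congr 1
    rw [RingHom.mapMatrix_apply, Matrix.map_mul]
    congr 1
    ext i j; simp) rfl
  refine ⟨J, iJ, iD, B.submatrix id e, fun z hz => ?_, fun z hz y hy => h5 z hz y ?_⟩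
  · have := congrArg (fun A => A.submatrix e e) ((h4 z hz).trans (h3 z hz))
    ext i j
    have h3 := congrFun (congrFun this i) j
    simpa [Matrix.submatrix_apply, Matrix.mul_apply, Matrix.map_apply] using h3
  · ext j
    have := congrFun hy (e.symm j)
    simpa [Matrix.vecMul, dotProduct] using this

theorem right_inv_poly {J n : Type} [Fintype J] [DecidableEq J] [Fintype n] (A : Matrix J n ℂ[X])
    (hA : ∀ z : ℂ, ‖z‖ < 1 → ∀ y : J → ℂ, y ᵥ* A.map (e1 z) = 0 → y = 0) :
    ∃ (R : Matrix n J ℂ[X]) (δ : ℂ[X]), (∀ z : ℂ, ‖z‖ < 1 → δ.eval z ≠ 0) ∧ A * R = δ • (1 : Matrix J J ℂ[X]) := by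
  let I : Ideal ℂ[X] :=
    { carrier := {δ | ∃ R : Matrix n J ℂ[X], A * R = δ • (1 : Matrix J J ℂ[X])}
      zero_mem' := ⟨0, by simp⟩
      add_mem' := by
        rintro x y ⟨R, hR⟩ ⟨S, hS⟩
        exact ⟨R + S, by rw [Matrix.mul_add, hR, hS, add_smul]⟩
      smul_mem' := by
        rintro c x ⟨R, hR⟩
        exact ⟨c • R, by rw [Matrix.mul_smul, hR, smul_smul, smul_eq_mul]⟩ }
  obtain ⟨δ, hδ⟩ := (IsPrincipalIdealRing.principal I).principal
  have hmem : δ ∈ I := by rw [hδ]; exact Submodule.mem_span_singleton_self δ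
  obtain ⟨R, hR⟩ := hmem
  refine ⟨R, δ, fun z hz h0 => ?_, hR⟩
  have hd : (A * ((A.map (e1 z))ᴴ).map Polynomial.C).det ∈ I :=
    ⟨((A.map (e1 z))ᴴ).map Polynomial.C * (A * ((A.map (e1 z))ᴴ).map Polynomial.C).adjugate, by
      rw [← Matrix.mul_assoc, Matrix.mul_adjugate]⟩
  rw [hδ] at hd
  obtain ⟨c, hc⟩ := Submodule.mem_span_singleton.1 hd
  apply gram_row _ (hA z hz)
  have := congrArg (e1 z) hc
  rw [RingHom.map_det] at this
  have h2 : e1 z (c • δ) = 0 := by simp [h0]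
  rw [h2] at this
  rw [this]
  congr 1
  rw [RingHom.mapMatrix_apply, Matrix.map_mul]
  congr 1
  ext i j; simp

end Part12

section Part13
open scoped Polynomial
open Matrix
open scoped ComplexOrder

def nsq (p : ℂ[X]) : ℝ := Real.circleAverage (fun z => ‖p.eval z‖ ^ 2) 0 1

theorem nsq_int (p : ℂ[X]) : CircleIntegrable (fun z => ‖p.eval z‖ ^ 2) 0 1 := by
  apply ContinuousOn.circleIntegrable zero_le_one
  exact (by fun_prop : Continuous fun z => ‖p.eval z‖ ^ 2).continuousOn

theorem nsq_eq (p : ℂ[X]) : nsq p = ∑ i ∈ p.support, ‖p.coeff i‖ ^ 2 :=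
  (Polynomial.sum_sq_norm_coeff_eq_circleAverage p).symm

theorem nsq_ge (p : ℂ[X]) (n : ℕ) : ∑ l ∈ Finset.range n, ‖p.coeff l‖ ^ 2 ≤ nsq p := by
  rw [nsq_eq]
  calc ∑ l ∈ Finset.range n, ‖p.coeff l‖ ^ 2 ≤ ∑ l ∈ Finset.range n ∪ p.support, ‖p.coeff l‖ ^ 2 :=
        Finset.sum_le_sum_of_subset_of_nonneg Finset.subset_union_left (fun _ _ _ => by positivity)
    _ = _ := by
        symm
        apply Finset.sum_subset Finset.subset_union_right
        intro x _ hx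
        simp [Polynomial.notMem_support_iff.1 hx]

theorem nsq_of_lt (p : ℂ[X]) (n : ℕ) (h : ∀ l, n ≤ l → p.coeff l = 0) :
    nsq p = ∑ l ∈ Finset.range n, ‖p.coeff l‖ ^ 2 := by
  rw [nsq_eq]
  apply Finset.sum_subset
  · intro i hi
    rw [Finset.mem_range]
    by_contra h2
    exact (Polynomial.mem_support_iff.1 hi) (h i (not_lt.1 h2))
  · intro x _ hx
    simp [Polynomial.notMem_support_iff.1 hx]

theorem nsq_le (p r s : ℂ[X]) (A B : ℝ) (h : ∀ z : ℂ, ‖z‖ = 1 → ‖p.eval z‖ ^ 2 ≤ A * ‖r.eval z‖ ^ 2 + B * ‖s.eval z‖ ^ 2) :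
    nsq p ≤ A * nsq r + B * nsq s := by
  unfold nsq
  rw [← smul_eq_mul, ← smul_eq_mul, ← Real.circleAverage_fun_smul, ← Real.circleAverage_fun_smul,
    ← Real.circleAverage_fun_add]
  · apply Real.circleAverage_mono
    · exact nsq_int p
    · apply ContinuousOn.circleIntegrable zero_le_one
      exact (by fun_prop : Continuous fun z => A • ‖r.eval z‖ ^ 2 + B • ‖s.eval z‖ ^ 2).continuousOn
    · intro x hx
      simpa using h x (by simpa using hx)
  · apply ContinuousOn.circleIntegrable zero_le_one
    exact (by fun_prop : Continuous fun z => A • ‖r.eval z‖ ^ 2).continuousOn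
  · apply ContinuousOn.circleIntegrable zero_le_one
    exact (by fun_prop : Continuous fun z => B • ‖s.eval z‖ ^ 2).continuousOn

theorem nsq_sum_eq {a b : Type} [Fintype a] [Fintype b] (p : a → ℂ[X]) (r : b → ℂ[X])
    (h : ∀ z : ℂ, ‖z‖ = 1 → ∑ i, ‖(p i).eval z‖ ^ 2 = ∑ j, ‖(r j).eval z‖ ^ 2) :
    ∑ i, nsq (p i) = ∑ j, nsq (r j) := by
  unfold nsq
  rw [← Real.circleAverage_fun_sum (fun i _ => nsq_int _), ← Real.circleAverage_fun_sum (fun i _ => nsq_int _)]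
  apply Real.circleAverage_congr_sphere
  intro z hz
  exact h z (by simpa using hz)

theorem nsq_nonneg (p : ℂ[X]) : 0 ≤ nsq p := by
  rw [nsq_eq]; positivity

theorem circle_bdd (p : ℂ[X]) : ∃ K : ℝ, 0 < K ∧ ∀ z : ℂ, ‖z‖ = 1 → ‖p.eval z‖ ^ 2 ≤ K := by
  obtain ⟨K, hK⟩ := (isCompact_sphere (0:ℂ) 1).exists_bound_of_continuousOn
    (f := fun z => p.eval z) (by fun_prop)
  refine ⟨K ^ 2 + 1, by positivity, fun z hz => ?_⟩
  have := hK z (by simpa using hz)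
  have h0 := norm_nonneg (p.eval z)
  nlinarith

theorem fejer (v : ℂ) (hv : ‖v‖ ≤ 1) (m : ℕ) (hm : 0 < m) :
    nsq (Polynomial.C (1 / (m:ℂ)) * ∑ j ∈ Finset.range m, (Polynomial.C v * Polynomial.X) ^ (j + 1)) ≤ (m + 1) / m ^ 2 := by
  have hc : ∀ l, (Polynomial.C (1 / (m:ℂ)) * ∑ j ∈ Finset.range m, (Polynomial.C v * Polynomial.X) ^ (j + 1)).coeff l
      = if 1 ≤ l ∧ l < m + 1 then (1 / (m:ℂ)) * v ^ l else 0 := by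
    intro l
    rw [Polynomial.coeff_C_mul, Polynomial.finset_sum_coeff]
    simp_rw [mul_pow, ← Polynomial.C_pow, Polynomial.coeff_C_mul, Polynomial.coeff_X_pow]
    split_ifs with h
    · congr 1
      rw [Finset.sum_eq_single (l - 1)]
      · rw [Nat.sub_add_cancel h.1]; simp
      · intro b _ hb
        rw [if_neg (by omega)]; simp
      · intro h2; exfalso; apply h2; simp; omega
    · rw [Finset.sum_eq_zero, mul_zero]
      intro j hj
      rw [Finset.mem_range] at hj
      rw [if_neg (by omega)]; simp
  rw [nsq_of_lt _ (m + 1) (fun l hl => by rw [hc, if_neg (by omega)])]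
  have hm' : (0:ℝ) < m := by exact_mod_cast hm
  calc _ ≤ ∑ l ∈ Finset.range (m + 1), (1 / (m:ℝ) ^ 2) := by
        apply Finset.sum_le_sum
        intro l _
        rw [hc]
        split_ifs
        · rw [norm_mul, norm_div, norm_pow, norm_one, Complex.norm_natCast, mul_pow]
          have : (‖v‖ ^ l) ^ 2 ≤ 1 := by
            apply pow_le_one₀ (by positivity)
            exact pow_le_one₀ (by positivity) hv
          have h2 : (1 / (m:ℝ)) ^ 2 = 1 / (m:ℝ)^2 := by ring
          rw [h2]
          have h3 : 0 ≤ 1 / (m:ℝ)^2 := by positivity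
          nlinarith
        · simp
    _ = _ := by simp; field_simp

theorem sq_add_le (x y : ℂ) : ‖x + y‖ ^ 2 ≤ 2 * ‖x‖ ^ 2 + 2 * ‖y‖ ^ 2 := by
  have := norm_add_le x y
  have h1 := norm_nonneg (x + y)
  nlinarith [sq_nonneg (‖x‖ - ‖y‖)]

theorem outer_approx (d : ℕ) : ∀ q : ℂ[X], q.natDegree = d → (∀ z : ℂ, ‖z‖ < 1 → q.eval z ≠ 0) →
    ∀ ε : ℝ, 0 < ε → ∃ p, nsq (q * p - 1) < ε := by
  induction d with
  | zero =>
    intro q hd hq ε hε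
    obtain ⟨c, rfl⟩ := Polynomial.natDegree_eq_zero.1 hd
    have hc : c ≠ 0 := by simpa using hq 0 (by simp)
    refine ⟨Polynomial.C c⁻¹, ?_⟩
    rw [← Polynomial.C_mul, mul_inv_cancel₀ hc, Polynomial.C_1, sub_self]
    simpa [nsq_eq] using hε
  | succ d ih =>
    intro q hd hq ε hε
    obtain ⟨z0, hz0⟩ := Complex.exists_root (f := q) (Polynomial.natDegree_pos_iff_degree_pos.1 (by omega))
    obtain ⟨q1, rfl⟩ := Polynomial.dvd_iff_isRoot.2 hz0
    have hq1 : q1 ≠ 0 := by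
      rintro rfl
      simp at hd
    have hz1 : 1 ≤ ‖z0‖ := by
      by_contra h
      exact hq z0 (not_le.1 h) hz0
    have hz00 : z0 ≠ 0 := by rintro rfl; simp at hz1; linarith
    have hd1 : q1.natDegree = d := by
      rw [Polynomial.natDegree_mul (Polynomial.X_sub_C_ne_zero z0) hq1, Polynomial.natDegree_X_sub_C] at hd
      omega
    obtain ⟨p1, hp1⟩ := ih q1 hd1 (fun z hz h0 => hq z hz (by simp [h0])) (ε / 4) (by linarith)
    obtain ⟨K, hK0, hK⟩ := circle_bdd (q1 * p1)
    obtain ⟨m, hm⟩ := exists_nat_gt (16 * K / ε + 1)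
    have hm1 : (1:ℝ) < m := by
      have : 0 < 16 * K / ε := by positivity
      linarith
    have hm0 : 0 < m := by exact_mod_cast (by linarith : (0:ℝ) < m)
    set v := z0⁻¹ with hv
    set S := Polynomial.C (1 / (m:ℂ)) * ∑ j ∈ Finset.range m, (Polynomial.C v * Polynomial.X) ^ (j + 1) with hS
    set p' : ℂ[X] := - Polynomial.C v * (Polynomial.C (1 / (m:ℂ)) * ∑ j ∈ Finset.range m, ∑ i ∈ Finset.range (j+1), (Polynomial.C v * Polynomial.X) ^ i) with hp'
    have key : (Polynomial.X - Polynomial.C z0) * p' - 1 = - S := by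
      have e1 : (Polynomial.X - Polynomial.C z0) * -Polynomial.C v = 1 - Polynomial.C v * Polynomial.X := by
        have : Polynomial.C z0 * Polynomial.C v = 1 := by
          rw [← Polynomial.C_mul, hv, mul_inv_cancel₀ hz00, Polynomial.C_1]
        linear_combination this
      have e2 : ∀ j, (1 - Polynomial.C v * Polynomial.X) * ∑ i ∈ Finset.range (j+1), (Polynomial.C v * Polynomial.X) ^ i = 1 - (Polynomial.C v * Polynomial.X : ℂ[X]) ^ (j+1) := fun j => mul_neg_geom_sum _ _
      rw [hp', ← mul_assoc, e1, mul_left_comm, Finset.mul_sum, Finset.sum_congr rfl (fun j _ => e2 j),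
        Finset.sum_sub_distrib, mul_sub, ← hS]
      have : Polynomial.C (1 / (m:ℂ)) * ∑ j ∈ Finset.range m, (1:ℂ[X]) = 1 := by
        rw [Finset.sum_const, Finset.card_range, nsmul_eq_mul, mul_one, ← Polynomial.C_eq_natCast, ← Polynomial.C_mul,
          one_div, inv_mul_cancel₀ (by exact_mod_cast hm0.ne'), Polynomial.C_1]
      rw [this]; ring
    refine ⟨p1 * p', ?_⟩
    have e3 : (Polynomial.X - Polynomial.C z0) * q1 * (p1 * p') - 1 = (q1 * p1) * (-S) + (q1 * p1 - 1) := by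
      rw [← key]; ring
    rw [e3]
    have h1 : nsq ((q1 * p1) * (-S) + (q1 * p1 - 1)) ≤ (2 * K) * nsq S + 2 * nsq (q1 * p1 - 1) := by
      apply nsq_le
      intro z hz
      rw [Polynomial.eval_add]
      refine (sq_add_le _ _).trans ?_
      have := hK z hz
      rw [Polynomial.eval_mul (p := q1 * p1), norm_mul, mul_pow, Polynomial.eval_neg, norm_neg]
      have h2 : 0 ≤ ‖S.eval z‖ ^ 2 := by positivity
      nlinarith [mul_le_mul_of_nonneg_right this h2]
    have h2 : nsq S ≤ (m + 1) / m ^ 2 := fejer v (by rw [hv, norm_inv]; exact inv_le_one_of_one_le₀ hz1) m hm0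
    have h3 : ((m:ℝ) + 1) / m ^ 2 ≤ 2 / m := by
      rw [div_le_div_iff₀ (by positivity) (by positivity)]
      nlinarith
    have h4 : (2 * K) * (2 / m) < ε / 4 := by
      rw [← mul_div_assoc, div_lt_iff₀ (by linarith)]
      have : 16 * K / ε < m := by linarith
      rw [div_lt_iff₀ hε] at this
      nlinarith
    nlinarith [mul_le_mul_of_nonneg_left (h2.trans h3) (by positivity : 0 ≤ 2 * K)]

end Part13

section Part14
open scoped Polynomial
open Matrix
open scoped ComplexOrder
open Filter Topology in
theorem coeff_tendsto (g : ℂ[X]) (h : ℕ → ℂ[X]) (hh : ∀ m, nsq (h m) < 1 / ((m:ℝ) + 1)) (l : ℕ) :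
    Tendsto (fun m => (g * h m).coeff l) atTop (𝓝 0) := by
  have h0 : ∀ i, Tendsto (fun m => (h m).coeff i) atTop (𝓝 0) := by
    intro i
    rw [tendsto_zero_iff_norm_tendsto_zero]
    have h2 : Tendsto (fun m => ‖(h m).coeff i‖ ^ 2) atTop (𝓝 0) := by
      apply squeeze_zero (fun _ => by positivity) (g := fun m : ℕ => 1 / ((m:ℝ) + 1)) _ tendsto_one_div_add_atTop_nhds_zero_nat
      intro m
      refine le_trans ?_ (hh m).le
      refine le_trans ?_ (nsq_ge (h m) (i + 1))
      exact Finset.single_le_sum (f := fun l => ‖(h m).coeff l‖ ^ 2) (fun _ _ => by positivity) (by simp)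
    have := h2.sqrt
    simpa using this
  simp_rw [Polynomial.coeff_mul]
  have : (0:ℂ) = ∑ x ∈ Finset.HasAntidiagonal.antidiagonal l, g.coeff x.1 * 0 := by simp
  rw [this]
  exact tendsto_finset_sum _ (fun x _ => (h0 x.2).const_mul _)

theorem sq_add_le' (x y : ℂ) (t : ℝ) (ht : 0 < t) : ‖x + y‖ ^ 2 ≤ (1 + t) * ‖x‖ ^ 2 + (1 + 1 / t) * ‖y‖ ^ 2 := by
  have := norm_add_le x y
  have h1 := norm_nonneg (x + y)
  have h2 : ‖x + y‖ ^ 2 ≤ (‖x‖ + ‖y‖) ^ 2 := by gcongr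
  refine h2.trans ?_
  have h3 : 0 ≤ (1/t) * (t * ‖x‖ - ‖y‖) ^ 2 := by positivity
  have : (1/t) * (t * ‖x‖ - ‖y‖) ^ 2 = t * ‖x‖ ^ 2 - 2 * ‖x‖ * ‖y‖ + (1/t) * ‖y‖ ^ 2 := by
    field_simp
    ring
  nlinarith

open Filter Topology in
theorem K1 {p k : Type} [Fintype p] [Fintype k] [DecidableEq k] (q : ℂ[X]) (hq : ∀ z : ℂ, ‖z‖ < 1 → q.eval z ≠ 0)
    (N : Matrix p k ℂ[X])
    (hN : ∀ z : ℂ, ‖z‖ = 1 → (N.map (e1 z))ᴴ * N.map (e1 z) = (star (q.eval z) * q.eval z) • (1 : Matrix k k ℂ))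
    (c : k → ℂ[X]) (n : ℕ) :
    ∑ α, ∑ l ∈ Finset.range n, ‖(∑ β, N α β * c β).coeff l‖ ^ 2 ≤
    ∑ β, ∑ l ∈ Finset.range n, ‖(q * c β).coeff l‖ ^ 2 := by
  have hiso : ∀ c : k → ℂ[X], ∑ α, nsq (∑ β, N α β * c β) = ∑ β, nsq (q * c β) := by
    intro c
    apply nsq_sum_eq
    intro z hz
    have h1 := congrArg (fun M => star (fun β => (c β).eval z) ⬝ᵥ (M *ᵥ (fun β => (c β).eval z))) (hN z hz)
    beta_reduce at h1
    rw [← Matrix.mulVec_mulVec, Matrix.dotProduct_mulVec, ← Matrix.star_mulVec, Matrix.smul_mulVec, Matrix.one_mulVec] at h1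
    have e1 : ∀ x : ℂ, star x * x = ((‖x‖ ^ 2 : ℝ) : ℂ) := by
      intro x; rw [mul_comm]; simpa using Complex.mul_conj' x
    simp only [dotProduct, Pi.star_apply, e1, Pi.smul_apply, smul_eq_mul] at h1
    have h2 : ∀ α, (N.map (_root_.e1 z) *ᵥ fun β => (c β).eval z) α = (∑ β, N α β * c β).eval z := by
      intro α
      simp [Matrix.mulVec, dotProduct, Polynomial.eval_finset_sum]
    simp_rw [h2] at h1
    have h3 : ∀ β, star ((c β).eval z) * (((‖q.eval z‖ ^ 2 : ℝ) : ℂ) * (c β).eval z) = ((‖(q * c β).eval z‖ ^ 2 : ℝ) : ℂ) := by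
      intro β
      rw [mul_left_comm, e1, ← Complex.ofReal_mul, Polynomial.eval_mul, norm_mul, mul_pow]
    simp_rw [h3] at h1
    exact_mod_cast h1
  have hcop : IsCoprime q (Polynomial.X ^ n) := by
    apply IsCoprime.pow_right
    apply IsCoprime.symm
    rw [Polynomial.irreducible_X.coprime_iff_not_dvd, Polynomial.X_dvd_iff, Polynomial.coeff_zero_eq_eval_zero]
    exact hq 0 (by simp)
  obtain ⟨u, s, hus⟩ := hcop
  set e : k → ℂ[X] := fun β => (q * c β) %ₘ (Polynomial.X ^ n) with he
  set r : k → ℂ[X] := fun β => (q * c β) /ₘ (Polynomial.X ^ n) with hr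
  have her : ∀ β, e β = q * c β - Polynomial.X ^ n * r β := by
    intro β
    have := Polynomial.modByMonic_add_div (q * c β) (Polynomial.X ^ n)
    simp only [he, hr]; linear_combination this
  have hco : ∀ (f : ℂ[X]) (l : ℕ), l < n → (Polynomial.X ^ n * f).coeff l = 0 := by
    intro f l hl
    rw [Polynomial.coeff_X_pow_mul', if_neg (by omega)]
  have hec : ∀ β l, l < n → (e β).coeff l = (q * c β).coeff l := by
    intro β l hl
    rw [her, Polynomial.coeff_sub, hco _ _ hl, sub_zero]
  have hed : ∀ β l, n ≤ l → (e β).coeff l = 0 := by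
    intro β l hl
    apply Polynomial.coeff_eq_zero_of_degree_lt
    refine lt_of_lt_of_le (Polynomial.degree_modByMonic_lt _ (Polynomial.monic_X_pow n)) ?_
    rw [Polynomial.degree_X_pow]; exact_mod_cast hl
  have hne : ∀ β, nsq (e β) = ∑ l ∈ Finset.range n, ‖(q * c β).coeff l‖ ^ 2 := by
    intro β
    rw [nsq_of_lt _ n (hed β)]
    exact Finset.sum_congr rfl (fun l hl => by rw [hec β l (Finset.mem_range.1 hl)])
  simp_rw [← hne]
  choose pm hpm using fun m : ℕ => outer_approx _ q rfl hq (1 / ((m:ℝ) + 1)) (by positivity)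
  have hcoef : ∀ α l, l < n → ∀ m, (∑ β, N α β * (e β * pm m)).coeff l =
      (∑ β, N α β * c β).coeff l + ((u * ∑ β, N α β * e β) * (q * pm m - 1)).coeff l := by
    intro α l hl m
    rw [← Polynomial.coeff_add, ← sub_eq_zero, ← Polynomial.coeff_sub]
    have hz : (∑ β, N α β * (e β * pm m)) - ((∑ β, N α β * c β) + (u * ∑ β, N α β * e β) * (q * pm m - 1))
      = Polynomial.X ^ n * (s * (∑ β, N α β * (e β * pm m)) - s * (∑ β, N α β * c β) - u * ∑ β, N α β * r β) := by
      have a1 : ∑ β, N α β * (e β * pm m) = (∑ β, N α β * e β) * pm m := by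
        rw [Finset.sum_mul]; exact Finset.sum_congr rfl (fun _ _ => by ring)
      have a2 : ∑ β, N α β * e β = q * (∑ β, N α β * c β) - Polynomial.X ^ n * ∑ β, N α β * r β := by
        rw [Finset.mul_sum, Finset.mul_sum, ← Finset.sum_sub_distrib]
        exact Finset.sum_congr rfl (fun _ _ => by rw [her]; ring)
      rw [a1, a2]
      generalize (∑ β, N α β * c β) = x
      generalize (∑ β, N α β * r β) = y
      linear_combination -((q * x - Polynomial.X ^ n * y) * pm m - x) * hus
    rw [hz, hco _ _ hl]
  have hlim : Tendsto (fun m => ∑ α, ∑ l ∈ Finset.range n, ‖(∑ β, N α β * (e β * pm m)).coeff l‖ ^ 2) atTop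
      (𝓝 (∑ α, ∑ l ∈ Finset.range n, ‖(∑ β, N α β * c β).coeff l‖ ^ 2)) := by
    apply tendsto_finset_sum
    intro α _
    apply tendsto_finset_sum
    intro l hl
    apply Tendsto.pow
    apply Tendsto.norm
    simp_rw [hcoef α l (Finset.mem_range.1 hl)]
    have := (tendsto_const_nhds (x := (∑ β, N α β * c β).coeff l) (f := atTop (α := ℕ))).add (coeff_tendsto (u * ∑ β, N α β * e β) (fun m => q * pm m - 1) hpm l)
    simpa using this
  choose K hK0 hK using fun β => circle_bdd (e β)
  have hbound : ∀ t : ℝ, 0 < t → ∑ α, ∑ l ∈ Finset.range n, ‖(∑ β, N α β * c β).coeff l‖ ^ 2 ≤ (1 + t) * ∑ β, nsq (e β) := by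
    intro t ht
    have hr : Tendsto (fun m : ℕ => ∑ β, ((1 + t) * nsq (e β) + ((1 + 1/t) * K β) * (1 / ((m:ℝ) + 1)))) atTop
        (𝓝 (∑ β, ((1 + t) * nsq (e β) + ((1 + 1/t) * K β) * 0))) := by
      apply tendsto_finset_sum
      intro β _
      exact tendsto_const_nhds.add (tendsto_one_div_add_atTop_nhds_zero_nat.const_mul _)
    have := le_of_tendsto_of_tendsto' hlim hr (fun m => ?_)
    · simpa [Finset.mul_sum] using this
    · calc _ ≤ ∑ α, nsq (∑ β, N α β * (e β * pm m)) := Finset.sum_le_sum (fun α _ => nsq_ge _ n)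
        _ = ∑ β, nsq (q * (e β * pm m)) := hiso _
        _ ≤ _ := by
          apply Finset.sum_le_sum
          intro β _
          have h1 : nsq (q * (e β * pm m)) ≤ (1 + t) * nsq (e β) + ((1 + 1/t) * K β) * nsq (q * pm m - 1) := by
            apply nsq_le
            intro z hz
            have : q * (e β * pm m) = e β + e β * (q * pm m - 1) := by ring
            rw [this, Polynomial.eval_add]
            refine (sq_add_le' _ _ t ht).trans ?_
            rw [Polynomial.eval_mul, norm_mul, mul_pow, mul_assoc (1 + 1/t)]
            gcongr
            exact hK β z hz
          refine h1.trans ?_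
          have := hK0 β
          gcongr
          exact (hpm m).le
  by_contra hcon
  push Not at hcon
  set R := ∑ β, nsq (e β)
  have hR : 0 ≤ R := Finset.sum_nonneg (fun β _ => nsq_nonneg _)
  set Lh := ∑ α, ∑ l ∈ Finset.range n, ‖(∑ β, N α β * c β).coeff l‖ ^ 2
  have h1 := hbound ((Lh - R) / (2 * (R + 1))) (by apply div_pos <;> linarith)
  have h2 : (Lh - R) / (2 * (R + 1)) * R ≤ (Lh - R) / 2 := by
    rw [div_mul_eq_mul_div, div_le_div_iff₀ (by linarith) (by norm_num)]
    nlinarith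
  linarith

end Part14

section Part15
open scoped Polynomial
open Matrix
open scoped ComplexOrder

def toep {R p k : Type} [CommRing R] (n : ℕ) (N : Matrix p k R[X]) : Matrix (Fin n × p) (Fin n × k) R :=
  Matrix.of fun x y => if (x.1 : ℕ) ≤ y.1 then (N x.2 y.2).coeff (y.1 - x.1) else 0

def Xmat {R p k ρ : Type} [CommRing R] (n : ℕ) (Q : Matrix p k R[X]) (B : Matrix ρ (Fin n × k) R) :
    Matrix (p ⊕ ρ) (Fin (n + 1) × k) R :=
  Matrix.of fun x y => Sum.elim (fun α => (Q α y.2).coeff y.1)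
    (fun r => if h : (y.1 : ℕ) = 0 then 0 else B r (⟨y.1 - 1, by have := y.1.2; omega⟩, y.2)) x

def Ymat {R p k ρ : Type} [CommRing R] (n : ℕ) (Q : Matrix p k R[X]) (B : Matrix ρ (Fin n × k) R) :
    Matrix (p ⊕ ρ) (Fin (n + 1) × k) R :=
  Matrix.of fun x y => Sum.elim (fun α => (Q α y.2).coeff y.1)
    (fun r => if h : (y.1 : ℕ) < n then B r (⟨y.1, h⟩, y.2) else 0) x

theorem toep_map {R S p k : Type} [CommRing R] [CommRing S] (φ : R →+* S) (n : ℕ) (N : Matrix p k R[X]) :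
    (toep n N).map φ = toep n (N.map (Polynomial.mapRingHom φ)) := by
  ext x y
  simp only [toep, Matrix.map_apply, Matrix.of_apply]
  split_ifs <;> simp

theorem Xmat_map {R S p k ρ : Type} [CommRing R] [CommRing S] (φ : R →+* S) (n : ℕ) (N : Matrix p k R[X])
    (B : Matrix ρ (Fin n × k) R) :
    (Xmat n N B).map φ = Xmat n (N.map (Polynomial.mapRingHom φ)) (B.map φ) := by
  ext x y
  rcases x with x | x
  · simp [Xmat]
  · simp only [Xmat, Matrix.map_apply, Matrix.of_apply, Sum.elim_inr]
    split_ifs <;> simp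

theorem Ymat_map {R S p k ρ : Type} [CommRing R] [CommRing S] (φ : R →+* S) (n : ℕ) (N : Matrix p k R[X])
    (B : Matrix ρ (Fin n × k) R) :
    (Ymat n N B).map φ = Ymat n (N.map (Polynomial.mapRingHom φ)) (B.map φ) := by
  ext x y
  rcases x with x | x
  · simp [Ymat]
  · simp only [Ymat, Matrix.map_apply, Matrix.of_apply, Sum.elim_inr]
    split_ifs <;> simp

theorem star_mul_self_norm (x : ℂ) : star x * x = ((‖x‖ ^ 2 : ℝ) : ℂ) := by
  rw [mul_comm]; simpa using Complex.mul_conj' x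

theorem gram_quad {a n : Type} [Fintype a] [Fintype n] (A : Matrix a n ℂ) (x : n → ℂ) :
    star x ⬝ᵥ ((Aᴴ * A) *ᵥ x) = ((∑ i, ‖(A *ᵥ x) i‖ ^ 2 : ℝ) : ℂ) := by
  rw [← Matrix.mulVec_mulVec, Matrix.dotProduct_mulVec, ← Matrix.star_mulVec]
  simp only [dotProduct, Pi.star_apply, star_mul_self_norm]
  push_cast; rfl

theorem psd_of_norm {a b n : Type} [Fintype a] [Fintype b] [Fintype n] (A : Matrix a n ℂ) (B : Matrix b n ℂ)
    (h : ∀ x : n → ℂ, ∑ i, ‖(B *ᵥ x) i‖ ^ 2 ≤ ∑ i, ‖(A *ᵥ x) i‖ ^ 2) : (Aᴴ * A - Bᴴ * B).PosSemidef := by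
  apply Matrix.PosSemidef.of_dotProduct_mulVec_nonneg
  · exact (Matrix.isHermitian_conjTranspose_mul_self A).sub (Matrix.isHermitian_conjTranspose_mul_self B)
  · intro x
    rw [Matrix.sub_mulVec, dotProduct_sub, gram_quad, gram_quad, ← Complex.ofReal_sub]
    have := h x
    exact_mod_cast sub_nonneg.2 this

theorem toep_mulVec {p k : Type} [Fintype k] (n : ℕ) (N : Matrix p k ℂ[X]) (a : Fin n × k → ℂ) (x : Fin n × p) :
    (toep n N *ᵥ a) x = (∑ β, N x.2 β * (∑ j : Fin n, Polynomial.C (a (j, β)) * Polynomial.X ^ (n - 1 - (j:ℕ)))).coeff (n - 1 - (x.1:ℕ)) := by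
  simp only [Matrix.mulVec, dotProduct, toep, Matrix.of_apply, Fintype.sum_prod_type, Polynomial.finset_sum_coeff, Finset.mul_sum]
  rw [Finset.sum_comm]
  apply Finset.sum_congr rfl
  intro β _
  apply Finset.sum_congr rfl
  intro j _
  rw [mul_left_comm, Polynomial.coeff_C_mul, Polynomial.coeff_mul_X_pow', mul_comm]
  have h1 := j.2
  have h2 := x.1.2
  congr 1
  by_cases h : (x.1 : ℕ) ≤ j
  · rw [if_pos h, if_pos (by omega)]
    congr 1; omega
  · rw [if_neg h, if_neg (by omega)]

theorem toep_psd {p k : Type} [Fintype p] [Fintype k] [DecidableEq k] (q : ℂ[X]) (hq : ∀ z : ℂ, ‖z‖ < 1 → q.eval z ≠ 0)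
    (N : Matrix p k ℂ[X])
    (hN : ∀ z : ℂ, ‖z‖ = 1 → (N.map (e1 z))ᴴ * N.map (e1 z) = (star (q.eval z) * q.eval z) • (1 : Matrix k k ℂ)) (n : ℕ) :
    ((toep n (q • (1 : Matrix k k ℂ[X])))ᴴ * toep n (q • (1 : Matrix k k ℂ[X])) - (toep n N)ᴴ * toep n N).PosSemidef := by
  apply psd_of_norm
  intro a
  have h := K1 q hq N hN (fun β => ∑ j : Fin n, Polynomial.C (a (j, β)) * Polynomial.X ^ (n - 1 - (j:ℕ))) n
  have key : ∀ f : ℕ → ℝ, ∑ l ∈ Finset.range n, f l = ∑ l : Fin n, f (n - 1 - (l:ℕ)) := by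
    intro f
    rw [← Finset.sum_range_reflect, Finset.sum_range]
  simp only [toep_mulVec, Fintype.sum_prod_type]
  rw [Finset.sum_comm, Finset.sum_comm (s := Finset.univ (α := Fin n))]
  simp_rw [key] at h
  refine h.trans (le_of_eq ?_)
  apply Finset.sum_congr rfl
  intro β _
  apply Finset.sum_congr rfl
  intro l _
  congr 3
  simp [Matrix.one_apply]

theorem diag_zero {s : Type} [Fintype s] (a b : s → ℂ[X]) (n : ℕ) (ha : ∀ i, (a i).natDegree ≤ n)
    (h : ∀ z : ℂ, ‖z‖ = 1 → ∑ i, star ((a i).eval z) * (b i).eval z = 0) (j : ℕ) (hj : j ≤ n) :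
    ∑ l ∈ Finset.range (j + 1), ∑ i, star ((a i).coeff (n - l)) * (b i).coeff (j - l) = 0 := by
  let rv : s → ℂ[X] := fun i => ∑ t ∈ Finset.range (n + 1), Polynomial.C (star ((a i).coeff (n - t))) * Polynomial.X ^ t
  have hrc : ∀ i t, t ≤ n → (rv i).coeff t = star ((a i).coeff (n - t)) := by
    intro i t ht
    simp only [rv, Polynomial.finset_sum_coeff, Polynomial.coeff_C_mul_X_pow]
    rw [Finset.sum_eq_single t]
    · simp
    · intro u _ hu; rw [if_neg (Ne.symm hu)]
    · intro h; simp at h; omega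
  have hre : ∀ i (z : ℂ), ‖z‖ = 1 → (rv i).eval z = z ^ n * star ((a i).eval z) := by
    intro i z hz
    rw [Polynomial.eval_eq_sum_range' (Nat.lt_succ_of_le (ha i)), star_sum, Finset.mul_sum, ← Finset.sum_range_reflect]
    simp only [rv, Polynomial.eval_finset_sum, Polynomial.eval_mul, Polynomial.eval_C, Polynomial.eval_pow, Polynomial.eval_X]
    apply Finset.sum_congr rfl
    intro t ht
    rw [Finset.mem_range] at ht
    have e : n + 1 - 1 - t = n - t := by omega
    rw [e, star_mul', star_pow]
    have h1 := star_mul_circle hz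
    have h2 : z ^ n = z ^ t * z ^ (n - t) := by rw [← pow_add]; congr 1; omega
    have h3 : z ^ (n - t) * star z ^ (n - t) = 1 := by rw [← mul_pow, mul_comm, h1, one_pow]
    rw [h2]
    linear_combination (-(star ((a i).coeff (n - t)) * z ^ t)) * h3
  have h0 : ∑ i, rv i * b i = 0 := by
    apply poly_zero_of_circle
    intro z hz
    rw [Polynomial.eval_finset_sum]
    simp_rw [Polynomial.eval_mul, hre _ z hz, mul_assoc]
    rw [← Finset.mul_sum, h z hz, mul_zero]
  have h1 := congrArg (fun p : ℂ[X] => p.coeff j) h0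
  simp only [Polynomial.finset_sum_coeff, Polynomial.coeff_zero, Polynomial.coeff_mul, Finset.Nat.sum_antidiagonal_eq_sum_range_succ_mk] at h1
  rw [Finset.sum_comm, ← h1]
  apply Finset.sum_congr rfl
  intro i _
  apply Finset.sum_congr rfl
  intro l hl
  rw [Finset.mem_range] at hl
  rw [hrc i l (by omega)]

end Part15

section Part16
open scoped Polynomial
open Matrix
open scoped ComplexOrder

def Cf {p1 p2 k : Type} [Fintype p1] [Fintype p2] (Q : Matrix p1 k ℂ[X]) (N : Matrix p2 k ℂ[X]) (β γ : k) (i j : ℕ) : ℂ :=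
  ∑ α, star ((Q α β).coeff i) * (Q α γ).coeff j - ∑ α, star ((N α β).coeff i) * (N α γ).coeff j

def Gf {p1 p2 k : Type} [Fintype p1] [Fintype p2] (Q : Matrix p1 k ℂ[X]) (N : Matrix p2 k ℂ[X]) (β γ : k) (i j : ℕ) : ℂ :=
  ∑ l ∈ Finset.range (min i j + 1), Cf Q N β γ (i - l) (j - l)

theorem Cf_star {p1 p2 k : Type} [Fintype p1] [Fintype p2] (Q : Matrix p1 k ℂ[X]) (N : Matrix p2 k ℂ[X]) (β γ : k) (i j : ℕ) :
    star (Cf Q N β γ i j) = Cf Q N γ β j i := by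
  simp only [Cf, star_sub, star_sum, star_mul', star_star]
  congr 1 <;> exact Finset.sum_congr rfl (fun _ _ => mul_comm _ _)

theorem Gf_star {p1 p2 k : Type} [Fintype p1] [Fintype p2] (Q : Matrix p1 k ℂ[X]) (N : Matrix p2 k ℂ[X]) (β γ : k) (i j : ℕ) :
    star (Gf Q N β γ i j) = Gf Q N γ β j i := by
  simp only [Gf, star_sum, Cf_star, min_comm]

theorem Gf_succ {p1 p2 k : Type} [Fintype p1] [Fintype p2] (Q : Matrix p1 k ℂ[X]) (N : Matrix p2 k ℂ[X]) (β γ : k) (i j : ℕ) :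
    Gf Q N β γ (i + 1) (j + 1) = Cf Q N β γ (i + 1) (j + 1) + Gf Q N β γ i j := by
  simp only [Gf]
  have : min (i + 1) (j + 1) + 1 = (min i j + 1) + 1 := by omega
  rw [this, Finset.sum_range_succ', add_comm]
  simp

theorem Gf_top {p1 p2 k : Type} [Fintype p1] [Fintype p2] (Q : Matrix p1 k ℂ[X]) (N : Matrix p2 k ℂ[X]) (β γ : k)
    (n : ℕ) (hQ : ∀ α β, (Q α β).natDegree ≤ n) (hN : ∀ α β, (N α β).natDegree ≤ n)
    (hT : ∀ z : ℂ, ‖z‖ = 1 → (Q.map (e1 z))ᴴ * Q.map (e1 z) = (N.map (e1 z))ᴴ * N.map (e1 z)) (j : ℕ) (hj : j ≤ n) :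
    Gf Q N β γ n j = 0 := by
  have h := diag_zero (s := p1 ⊕ p2) (Sum.elim (fun α => Q α β) (fun α => N α β))
    (Sum.elim (fun α => Q α γ) (fun α => - N α γ)) n (by rintro (i | i); exacts [hQ _ _, hN _ _]) (by
      intro z hz
      have := congrFun (congrFun (hT z hz) β) γ
      simp only [Matrix.mul_apply, Matrix.conjTranspose_apply, Matrix.map_apply] at this
      simp only [Fintype.sum_sum_type, Sum.elim_inl, Sum.elim_inr, Polynomial.eval_neg, mul_neg, Finset.sum_neg_distrib]
      rw [← sub_eq_add_neg, sub_eq_zero]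
      simpa using this) j hj
  rw [← h]
  simp only [Gf, Cf]
  rw [min_eq_right hj]
  apply Finset.sum_congr rfl
  intro l _
  simp [sub_eq_add_neg]

theorem toep_gram {p1 p2 k : Type} [Fintype p1] [Fintype p2] [Fintype k] (Q : Matrix p1 k ℂ[X]) (N : Matrix p2 k ℂ[X]) (n : ℕ) (x y : Fin n × k) :
    ((toep n Q)ᴴ * toep n Q - (toep n N)ᴴ * toep n N) x y = Gf Q N x.2 y.2 x.1 y.1 := by
  simp only [Matrix.sub_apply, Matrix.mul_apply, Matrix.conjTranspose_apply, toep, Matrix.of_apply, Fintype.sum_prod_type]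
  rw [← Finset.sum_sub_distrib]
  have h : ∀ l : Fin n, (∑ α, star (if (l:ℕ) ≤ x.1 then (Q α x.2).coeff (x.1 - l) else 0) * (if (l:ℕ) ≤ y.1 then (Q α y.2).coeff (y.1 - l) else 0)
     - ∑ α, star (if (l:ℕ) ≤ x.1 then (N α x.2).coeff (x.1 - l) else 0) * (if (l:ℕ) ≤ y.1 then (N α y.2).coeff (y.1 - l) else 0))
     = (fun l : ℕ => if l ≤ min (x.1:ℕ) y.1 then Cf Q N x.2 y.2 (x.1 - l) (y.1 - l) else 0) l := by
    intro l
    beta_reduce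
    by_cases h1 : (l:ℕ) ≤ x.1 <;> by_cases h2 : (l:ℕ) ≤ y.1
    · simp [h1, h2, Cf]
    all_goals simp [h1, h2]
  rw [Finset.sum_congr rfl (fun l _ => h l), ← Finset.sum_range (fun l : ℕ => if l ≤ min (x.1:ℕ) y.1 then Cf Q N x.2 y.2 (x.1 - l) (y.1 - l) else 0)]
  rw [Gf, ← Finset.sum_filter]
  apply Finset.sum_congr _ (fun _ _ => rfl)
  ext l
  have := x.1.2
  simp only [Finset.mem_filter, Finset.mem_range]
  omega

theorem XY_id {p1 p2 k ρ : Type} [Fintype p1] [Fintype p2] [Fintype k] [Fintype ρ] (Q : Matrix p1 k ℂ[X]) (N : Matrix p2 k ℂ[X])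
    (n : ℕ) (hQ : ∀ α β, (Q α β).natDegree ≤ n) (hN : ∀ α β, (N α β).natDegree ≤ n)
    (hT : ∀ z : ℂ, ‖z‖ = 1 → (Q.map (e1 z))ᴴ * Q.map (e1 z) = (N.map (e1 z))ᴴ * N.map (e1 z))
    (B : Matrix ρ (Fin n × k) ℂ) (hB : Bᴴ * B = (toep n Q)ᴴ * toep n Q - (toep n N)ᴴ * toep n N) :
    (Xmat n Q B)ᴴ * Xmat n Q B = (Ymat n N B)ᴴ * Ymat n N B := by
  have hB' : ∀ x y, ∑ r, star (B r x) * B r y = Gf Q N x.2 y.2 x.1 y.1 := by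
    intro x y
    rw [← toep_gram, ← hB]; simp [Matrix.mul_apply]
  ext ⟨⟨i, hi⟩, β⟩ ⟨⟨j, hj⟩, γ⟩
  simp only [Matrix.mul_apply, Matrix.conjTranspose_apply, Fintype.sum_sum_type, Xmat, Ymat, Matrix.of_apply, Sum.elim_inl, Sum.elim_inr]
  rw [← sub_eq_zero]
  have hY : (∑ r, star (if h : i < n then B r (⟨i, h⟩, β) else 0) * (if h : j < n then B r (⟨j, h⟩, γ) else 0)) = Gf Q N β γ i j := by
    by_cases h1 : i < n
    · by_cases h2 : j < n
      · simp only [h1, h2, dif_pos]; exact hB' _ _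
      · have : j = n := by omega
        subst this
        rw [← star_star (Gf Q N β γ i j), Gf_star, Gf_top Q N γ β j hQ hN hT i h1.le]
        simp
    · have : i = n := by omega
      subst this
      rw [Gf_top Q N β γ i hQ hN hT j (by omega)]
      simp
  rw [hY]
  have hC : ∀ a b c d : ℂ, a + b - (c + d) = (a - c) + b - d := by intros; ring
  rw [hC]
  change Cf Q N β γ i j + _ - _ = 0
  rcases i with _ | i
  · simp [Gf]
  · rcases j with _ | j
    · simp [Gf]
    · rw [Gf_succ]
      simp only [Nat.add_eq_zero_iff, one_ne_zero, and_false, dif_neg, not_false_eq_true, Nat.add_sub_cancel]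
      rw [hB']
      simp

end Part16

section Part17
open scoped Polynomial
open Matrix
open scoped ComplexOrder

theorem norm_of_psd {a b n : Type} [Fintype a] [Fintype b] [Fintype n] (A : Matrix a n ℂ) (B : Matrix b n ℂ)
    (h : (Aᴴ * A - Bᴴ * B).PosSemidef) (x : n → ℂ) : ∑ i, ‖(B *ᵥ x) i‖ ^ 2 ≤ ∑ i, ‖(A *ᵥ x) i‖ ^ 2 := by
  have := h.dotProduct_mulVec_nonneg x
  rw [Matrix.sub_mulVec, dotProduct_sub, gram_quad, gram_quad, ← Complex.ofReal_sub] at this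
  exact sub_nonneg.1 (Complex.zero_le_real.1 this)

theorem lower_bd (d : ℕ) : ∀ q : ℂ[X], q.natDegree = d → (∀ z : ℂ, ‖z‖ < 1 → q.eval z ≠ 0) →
    ∀ a : ℂ, ‖a‖ < 1 → ‖q.leadingCoeff‖ * (1 - ‖a‖) ^ d ≤ ‖q.eval a‖ := by
  induction d with
  | zero =>
    intro q hd hq a ha
    obtain ⟨c, rfl⟩ := Polynomial.natDegree_eq_zero.1 hd
    simp
  | succ d ih =>
    intro q hd hq a ha
    obtain ⟨z0, hz0⟩ := Complex.exists_root (f := q) (Polynomial.natDegree_pos_iff_degree_pos.1 (by omega))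
    obtain ⟨q1, rfl⟩ := Polynomial.dvd_iff_isRoot.2 hz0
    have hq1 : q1 ≠ 0 := by
      rintro rfl
      simp at hd
    have hz1 : 1 ≤ ‖z0‖ := by
      by_contra h
      exact hq z0 (not_le.1 h) hz0
    have hd1 : q1.natDegree = d := by
      rw [Polynomial.natDegree_mul (Polynomial.X_sub_C_ne_zero z0) hq1, Polynomial.natDegree_X_sub_C] at hd
      omega
    have h1 := ih q1 hd1 (fun z hz h0 => hq z hz (by simp [h0])) a ha
    have h2 : 1 - ‖a‖ ≤ ‖a - z0‖ := by
      have := norm_sub_norm_le z0 a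
      rw [norm_sub_rev] at this
      linarith
    rw [Polynomial.leadingCoeff_mul, Polynomial.leadingCoeff_X_sub_C, one_mul, pow_succ, ← mul_assoc, Polynomial.eval_mul, norm_mul, mul_comm]
    simp only [Polynomial.eval_sub, Polynomial.eval_X, Polynomial.eval_C]
    apply mul_le_mul h2 h1 (by have : 0 ≤ 1 - ‖a‖ := by linarith
                               positivity) (norm_nonneg _)

theorem e2_eq (t x : ℂ) (p : ℂ[X][X]) : e2 t x p = (p.map (e1 t)).eval x := by
  simp [Polynomial.evalEval, Polynomial.map_evalRingHom_eval]

open Filter Topology in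
theorem bd_nonvanish (q : ℂ[X][X]) (hq : ∀ ζ z : ℂ, ‖ζ‖ < 1 → ‖z‖ < 1 → e2 ζ z q ≠ 0) (ζ : ℂ) (hζ : ‖ζ‖ = 1)
    (hl : q.leadingCoeff.eval ζ ≠ 0) (a : ℂ) (ha : ‖a‖ < 1) : (q.map (e1 ζ)).eval a ≠ 0 := by
  have h1 : ∀ w : ℂ, ‖w‖ < 1 → ‖q.leadingCoeff.eval w‖ * (1 - ‖a‖) ^ q.natDegree ≤ ‖(q.eval (Polynomial.C a)).eval w‖ := by
    intro w hw
    have hev : (q.eval (Polynomial.C a)).eval w = (q.map (e1 w)).eval a := by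
      rw [← e2_eq]; rfl
    rw [hev]
    by_cases h0 : q.leadingCoeff.eval w = 0
    · rw [h0]; simp
    · have hd : (q.map (e1 w)).natDegree = q.natDegree := Polynomial.natDegree_map_of_leadingCoeff_ne_zero _ h0
      have := lower_bd _ (q.map (e1 w)) hd (fun z hz => by rw [← e2_eq]; exact hq w z hw hz) a ha
      rw [Polynomial.leadingCoeff_map_of_leadingCoeff_ne_zero _ h0] at this
      exact this
  have h2 : ‖q.leadingCoeff.eval ζ‖ * (1 - ‖a‖) ^ q.natDegree ≤ ‖(q.eval (Polynomial.C a)).eval ζ‖ := by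
    have hcl : IsClosed {w : ℂ | ‖q.leadingCoeff.eval w‖ * (1 - ‖a‖) ^ q.natDegree ≤ ‖(q.eval (Polynomial.C a)).eval w‖} :=
      isClosed_le (by fun_prop) (by fun_prop)
    have hsub : Metric.ball (0:ℂ) 1 ⊆ {w : ℂ | ‖q.leadingCoeff.eval w‖ * (1 - ‖a‖) ^ q.natDegree ≤ ‖(q.eval (Polynomial.C a)).eval w‖} := by
      intro w hw
      exact h1 w (by simpa using hw)
    have := closure_minimal hsub hcl
    rw [closure_ball _ one_ne_zero] at this
    exact this (by simp [hζ])
  have hev : (q.eval (Polynomial.C a)).eval ζ = (q.map (e1 ζ)).eval a := by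
    rw [← e2_eq]; rfl
  rw [← hev]
  intro h0
  rw [h0, norm_zero] at h2
  have : 0 < ‖q.leadingCoeff.eval ζ‖ * (1 - ‖a‖) ^ q.natDegree := by
    have : 0 < 1 - ‖a‖ := by linarith
    have : 0 < ‖q.leadingCoeff.eval ζ‖ := norm_pos_iff.2 hl
    positivity
  linarith

theorem smul_one_map {R S k : Type} [CommRing R] [CommRing S] [DecidableEq k] (φ : R →+* S) (q : R) :
    (q • (1 : Matrix k k R)).map φ = φ q • (1 : Matrix k k S) := by
  ext i j
  by_cases h : i = j
  · subst h; simp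
  · simp [Matrix.one_apply_ne h]

theorem smul_one_gram {k : Type} [Fintype k] [DecidableEq k] (q : ℂ) :
    (q • (1 : Matrix k k ℂ))ᴴ * (q • (1 : Matrix k k ℂ)) = (star q * q) • (1 : Matrix k k ℂ) := by
  rw [smul_gram]; simp

theorem toep_psd_all {p k : Type} [Fintype p] [Fintype k] [DecidableEq k] (q : ℂ[X][X])
    (hq : ∀ ζ z : ℂ, ‖ζ‖ < 1 → ‖z‖ < 1 → e2 ζ z q ≠ 0)
    (N : Matrix p k ℂ[X][X])
    (hN : ∀ ζ z : ℂ, ‖ζ‖ = 1 → ‖z‖ = 1 → (N.map (e2 ζ z))ᴴ * N.map (e2 ζ z) = (star (e2 ζ z q) * e2 ζ z q) • (1 : Matrix k k ℂ)) (n : ℕ)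
    (ζ : ℂ) (hζ : ‖ζ‖ = 1) :
    (((toep n (q • (1 : Matrix k k ℂ[X][X]))).map (e1 ζ))ᴴ * (toep n (q • (1 : Matrix k k ℂ[X][X]))).map (e1 ζ)
      - ((toep n N).map (e1 ζ))ᴴ * (toep n N).map (e1 ζ)).PosSemidef := by
  have hq0 : q ≠ 0 := by
    rintro rfl
    exact hq 0 0 (by simp) (by simp) (by simp)
  have hl0 : q.leadingCoeff ≠ 0 := Polynomial.leadingCoeff_ne_zero.2 hq0
  apply psd_of_norm
  refine circle_dense (S := {z | q.leadingCoeff.IsRoot z}) (Polynomial.finite_setOf_isRoot hl0)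
    (P := {ζ : ℂ | ∀ x, ∑ i, ‖((toep n N).map (e1 ζ) *ᵥ x) i‖ ^ 2 ≤ ∑ i, ‖((toep n (q • (1 : Matrix k k ℂ[X][X]))).map (e1 ζ) *ᵥ x) i‖ ^ 2}) ?_ ?_ ζ hζ
  · rw [Set.setOf_forall]
    apply isClosed_iInter
    intro x
    have hc : ∀ {a b : Type} [Fintype a] [Fintype b] (M : Matrix a b ℂ[X]) (x : b → ℂ), Continuous fun ζ : ℂ => ∑ i, ‖(M.map (e1 ζ) *ᵥ x) i‖ ^ 2 := by
      intro a b _ _ M x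
      apply continuous_finset_sum
      intro i _
      apply Continuous.pow
      apply Continuous.norm
      exact (continuous_apply i).comp ((cont_map1 M).matrix_mulVec continuous_const)
    exact isClosed_le (hc _ x) (hc _ x)
  · intro z hz hzl
    apply norm_of_psd
    rw [toep_map, toep_map, smul_one_map]
    apply toep_psd
    · intro a ha
      exact bd_nonvanish q hq z hz hzl a ha
    · intro w hw
      have := hN z w hz hw
      rw [e2_eq] at this
      have h3 : N.map (e2 z w) = (N.map (Polynomial.mapRingHom (e1 z))).map (e1 w) := by
        ext i j
        simp only [Matrix.map_apply]
        exact e2_eq _ _ _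
      rw [h3] at this
      exact this

theorem Xmat_rank {k ρ : Type} [Fintype k] [DecidableEq k] [Fintype ρ] (n : ℕ) (q : ℂ[X]) (hq : q.coeff 0 ≠ 0)
    (B : Matrix ρ (Fin n × k) ℂ) (hB : ∀ y : ρ → ℂ, y ᵥ* B = 0 → y = 0) (y : k ⊕ ρ → ℂ)
    (hy : y ᵥ* Xmat n (q • (1 : Matrix k k ℂ[X])) B = 0) : y = 0 := by
  have h : ∀ (j : Fin (n + 1)) β, (∑ α, y (Sum.inl α) * ((q • (1 : Matrix k k ℂ[X])) α β).coeff j) + (∑ r, y (Sum.inr r) * Xmat n (q • (1 : Matrix k k ℂ[X])) B (Sum.inr r) (j, β)) = 0 := by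
    intro j β
    have := congrFun hy (j, β)
    simpa only [Matrix.vecMul, dotProduct, Fintype.sum_sum_type, Xmat, Matrix.of_apply, Sum.elim_inl, Sum.elim_inr, Pi.zero_apply] using this
  have h1 : ∀ (j : ℕ) β, (∑ α, y (Sum.inl α) * ((q • (1 : Matrix k k ℂ[X])) α β).coeff j) = y (Sum.inl β) * q.coeff j := by
    intro j β
    rw [Finset.sum_eq_single β]
    · simp
    · intro b _ hb
      simp [Matrix.one_apply_ne hb]
    · simp
  have h2 : ∀ β, y (Sum.inl β) = 0 := by
    intro β
    have := h 0 β
    rw [h1] at this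
    simp [Xmat] at this
    exact this.resolve_right hq
  have h3 : (fun r => y (Sum.inr r)) = 0 := by
    apply hB
    ext ⟨j, β⟩
    have := h ⟨j + 1, by have := j.2; omega⟩ β
    rw [h1, h2] at this
    simpa [Xmat, Matrix.vecMul, dotProduct] using this
  ext (i | i)
  · exact h2 i
  · exact congrFun h3 i

theorem deg_bound2 {a b : Type} [Fintype a] [Fintype b] (N : Matrix a b ℂ[X][X]) : ∃ n, ∀ i j, (N i j).natDegree ≤ n := by
  refine ⟨∑ i, ∑ j, (N i j).natDegree, fun i j => ?_⟩
  refine le_trans ?_ (Finset.single_le_sum (f := fun i => ∑ j, (N i j).natDegree) (fun _ _ => Nat.zero_le _) (Finset.mem_univ i))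
  exact Finset.single_le_sum (f := fun j => (N i j).natDegree) (fun _ _ => Nat.zero_le _) (Finset.mem_univ j)

theorem z1_step {p k : Type} [Fintype p] [Fintype k] [DecidableEq k] (q : ℂ[X][X])
    (hq : ∀ ζ z : ℂ, ‖ζ‖ < 1 → ‖z‖ < 1 → e2 ζ z q ≠ 0)
    (N : Matrix p k ℂ[X][X])
    (hN : ∀ ζ z : ℂ, ‖ζ‖ = 1 → ‖z‖ = 1 → (N.map (e2 ζ z))ᴴ * N.map (e2 ζ z) = (star (e2 ζ z q) * e2 ζ z q) • (1 : Matrix k k ℂ)) :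
    ∃ (n : ℕ) (J : Type) (_ : Fintype J) (_ : DecidableEq J) (B : Matrix J (Fin n × k) ℂ[X]) (δ : ℂ[X]) (M : Matrix (p ⊕ J) (k ⊕ J) ℂ[X]),
      q.natDegree ≤ n ∧ (∀ i j, (N i j).natDegree ≤ n) ∧ (∀ z : ℂ, ‖z‖ < 1 → δ.eval z ≠ 0) ∧
      (∀ z : ℂ, ‖z‖ = 1 → (M.map (e1 z))ᴴ * M.map (e1 z) = (star (δ.eval z) * δ.eval z) • (1 : Matrix (k ⊕ J) (k ⊕ J) ℂ)) ∧
      M * Xmat n (q • (1 : Matrix k k ℂ[X][X])) B = δ • Ymat n N B := by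
  obtain ⟨n0, hn0⟩ := deg_bound2 N
  obtain ⟨n, hqn, hNn⟩ : ∃ n, q.natDegree ≤ n ∧ (∀ i j, (N i j).natDegree ≤ n) :=
    ⟨max q.natDegree n0, le_max_left _ _, fun i j => (hn0 i j).trans (le_max_right _ _)⟩
  obtain ⟨J, iJ, iD, B, hB, hBr⟩ := fr_outer _ _ (toep_psd_all q hq N hN n)
  have hXY : ∀ z : ℂ, ‖z‖ = 1 → ((Xmat n (q • (1 : Matrix k k ℂ[X][X])) B).map (e1 z))ᴴ * (Xmat n (q • (1 : Matrix k k ℂ[X][X])) B).map (e1 z)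
      = ((Ymat n N B).map (e1 z))ᴴ * (Ymat n N B).map (e1 z) := by
    intro z hz
    rw [Xmat_map, Ymat_map]
    apply XY_id
    · intro α β
      rw [smul_one_map]
      by_cases h : α = β
      · subst h
        simp only [Matrix.smul_apply, Matrix.one_apply_eq, smul_eq_mul, mul_one]
        exact (Polynomial.natDegree_map_le).trans hqn
      · simp [Matrix.one_apply_ne h]
    · intro α β
      exact (Polynomial.natDegree_map_le).trans (hNn α β)
    · intro w hw
      have h3 : ∀ {a b : Type} (N : Matrix a b ℂ[X][X]), (N.map (Polynomial.mapRingHom (e1 z))).map (e1 w) = N.map (e2 z w) := by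
        intro a b N
        ext i j
        simp only [Matrix.map_apply]
        exact (e2_eq _ _ _).symm
      rw [h3, h3, hN z w hz hw, smul_one_map, smul_one_gram]
    · rw [hB z hz, toep_map, toep_map]
  have hXr : ∀ z : ℂ, ‖z‖ < 1 → ∀ y : k ⊕ J → ℂ, y ᵥ* (Xmat n (q • (1 : Matrix k k ℂ[X][X])) B).map (e1 z) = 0 → y = 0 := by
    intro z hz y hy
    rw [Xmat_map, smul_one_map] at hy
    refine Xmat_rank n _ ?_ _ (hBr z hz) y hy
    rw [Polynomial.coeff_zero_eq_eval_zero]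
    have := hq z 0 hz (by simp)
    rw [e2_eq] at this
    exact this
  obtain ⟨R, δ, hδ, hR⟩ := right_inv_poly _ hXr
  generalize hX : Xmat n (q • (1 : Matrix k k ℂ[X][X])) B = X at *
  generalize hY : Ymat n N B = Y at *
  refine ⟨n, J, iJ, iD, B, δ, Y * R, hqn, hNn, hδ, fun z hz => ?_, ?_⟩
  · rw [Matrix.map_mul, Matrix.conjTranspose_mul, Matrix.mul_assoc, ← Matrix.mul_assoc _ (Y.map _), ← hXY z hz, Matrix.mul_assoc (X.map _)ᴴ,
      ← Matrix.mul_assoc, ← Matrix.conjTranspose_mul, ← Matrix.map_mul, hR, smul_one_map, smul_one_gram]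
    rfl
  · rw [hX, hY]
    have key : ∀ z : ℂ, ‖z‖ = 1 → ((Y * R * X - δ • Y).map (e1 z)) = 0 := by
      intro z hz
      have h1 : X * (R * X - δ • (1 : Matrix _ _ ℂ[X])) = 0 := by
        rw [Matrix.mul_sub, ← Matrix.mul_assoc, hR, Matrix.smul_mul, Matrix.one_mul, Matrix.mul_smul, Matrix.mul_one, sub_self]
      have h2 : Y * R * X - δ • Y = Y * (R * X - δ • (1 : Matrix _ _ ℂ[X])) := by
        rw [Matrix.mul_sub, ← Matrix.mul_assoc, Matrix.mul_smul, Matrix.mul_one]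
      rw [h2, Matrix.map_mul]
      rw [← Matrix.conjTranspose_mul_self_eq_zero, Matrix.conjTranspose_mul, Matrix.mul_assoc, ← Matrix.mul_assoc _ (Y.map _), ← hXY z hz, Matrix.mul_assoc (X.map _)ᴴ,
        ← Matrix.map_mul, h1]
      simp
    rw [← sub_eq_zero]
    ext i j : 1
    apply poly_zero_of_circle
    intro z hz
    exact congrFun (congrFun (key z hz) i) j

end Part17

section Part18
open scoped Polynomial
open Matrix
open scoped ComplexOrder

theorem gram_norm_eq {a b n : Type} [Fintype a] [Fintype b] [Fintype n] (X : Matrix a n ℂ) (Y : Matrix b n ℂ)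
    (h : Xᴴ * X = Yᴴ * Y) (x : n → ℂ) : ∑ i, ‖(X *ᵥ x) i‖ ^ 2 = ∑ i, ‖(Y *ᵥ x) i‖ ^ 2 := by
  have := gram_quad X x
  rw [h, gram_quad] at this
  exact_mod_cast this.symm

theorem douglas {a b n : Type} [Fintype a] [Fintype b] [Fintype n] [DecidableEq a] (X : Matrix a n ℂ) (Y : Matrix b n ℂ)
    (h : Xᴴ * X = Yᴴ * Y) : ∃ U : Matrix b a ℂ, (∀ x, ∑ i, ‖(U *ᵥ x) i‖ ^ 2 ≤ ∑ i, ‖x i‖ ^ 2) ∧ U * X = Y := by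
  classical
  let f : (n → ℂ) →ₗ[ℂ] EuclideanSpace ℂ a := (WithLp.linearEquiv 2 ℂ (a → ℂ)).symm.toLinearMap ∘ₗ X.mulVecLin
  let g : (n → ℂ) →ₗ[ℂ] EuclideanSpace ℂ b := (WithLp.linearEquiv 2 ℂ (b → ℂ)).symm.toLinearMap ∘ₗ Y.mulVecLin
  have hfg : ∀ x, ‖f x‖ = ‖g x‖ := by
    intro x
    rw [EuclideanSpace.norm_eq, EuclideanSpace.norm_eq]
    congr 1
    exact gram_norm_eq X Y h x
  obtain ⟨s, hs⟩ := LinearMap.exists_rightInverse_of_surjective f.rangeRestrict (LinearMap.range_rangeRestrict f)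
  have hs' : ∀ y : LinearMap.range f, f (s y) = y := fun y => congrArg Subtype.val (LinearMap.congr_fun hs y)
  let V : EuclideanSpace ℂ a →ₗ[ℂ] EuclideanSpace ℂ b := g ∘ₗ s ∘ₗ ((LinearMap.range f).orthogonalProjection).toLinearMap
  have hV1 : ∀ e, ‖V e‖ ≤ ‖e‖ := by
    intro e
    change ‖g (s _)‖ ≤ _
    rw [← hfg, hs']
    exact Submodule.norm_orthogonalProjection_apply_le _ e
  have hV2 : ∀ x, V (f x) = g x := by
    intro x
    change g (s ((LinearMap.range f).orthogonalProjection (f x))) = g x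
    rw [← sub_eq_zero, ← map_sub, ← norm_eq_zero, ← hfg, map_sub, hs', norm_eq_zero, sub_eq_zero]
    exact congrArg Subtype.val (Submodule.orthogonalProjectionOnto_mem_subspace_eq_self (K := LinearMap.range f) ⟨f x, LinearMap.mem_range_self f x⟩)
  refine ⟨Matrix.toEuclideanLin.symm V, fun x => ?_, ?_⟩
  · have h1 := hV1 (WithLp.toLp 2 x)
    have h2 : Matrix.toEuclideanLin (Matrix.toEuclideanLin.symm V) (WithLp.toLp 2 x) = V (WithLp.toLp 2 x) := by simp
    rw [← h2] at h1
    have h3 : ‖Matrix.toEuclideanLin (Matrix.toEuclideanLin.symm V) (WithLp.toLp 2 x)‖ ^ 2 ≤ ‖(WithLp.toLp 2 x : EuclideanSpace ℂ a)‖ ^ 2 := by gcongr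
    rw [EuclideanSpace.norm_sq_eq, EuclideanSpace.norm_sq_eq] at h3
    exact h3
  · apply Matrix.ext_of_mulVec_single
    intro j
    rw [← Matrix.mulVec_mulVec]
    have h2 : Matrix.toEuclideanLin (Matrix.toEuclideanLin.symm V) (f (Pi.single j 1)) = g (Pi.single j 1) := by rw [← hV2]; simp
    exact congrArg WithLp.ofLp h2

def vmat (k : Type) [DecidableEq k] (n : ℕ) (z : ℂ) : Matrix (Fin n × k) k ℂ :=
  Matrix.of fun x y => if x.2 = y then z ^ (x.1 : ℕ) else 0

theorem row_v {k : Type} [Fintype k] [DecidableEq k] (n : ℕ) (z : ℂ) (g : Fin n × k → ℂ) (β : k) :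
    ∑ y, g y * vmat k n z y β = ∑ j : Fin n, g (j, β) * z ^ (j : ℕ) := by
  rw [Fintype.sum_prod_type]
  apply Finset.sum_congr rfl
  intro j _
  simp [vmat]

theorem Xmat_v {p k ρ : Type} [Fintype k] [DecidableEq k] [Fintype ρ] (n : ℕ) (Q : Matrix p k ℂ[X]) (hQ : ∀ α β, (Q α β).natDegree ≤ n)
    (B : Matrix ρ (Fin n × k) ℂ) (z : ℂ) :
    Xmat n Q B * vmat k (n + 1) z = Matrix.fromRows (Q.map (e1 z)) (z • (B * vmat k n z)) := by
  ext (i | i) β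
  · rw [Matrix.mul_apply, row_v]
    simp only [Xmat, Matrix.of_apply, Sum.elim_inl, Matrix.fromRows_apply_inl, Matrix.map_apply, Polynomial.coe_evalRingHom]
    rw [Polynomial.eval_eq_sum_range' (Nat.lt_succ_of_le (hQ i β)), Finset.sum_range]
  · rw [Matrix.mul_apply, row_v, Fin.sum_univ_succ]
    simp only [Xmat, Matrix.of_apply, Sum.elim_inr, Matrix.fromRows_apply_inr, Matrix.smul_apply, Matrix.mul_apply, row_v]
    simp [Finset.mul_sum]
    apply Finset.sum_congr rfl
    intro j _
    ring

theorem Ymat_v {p k ρ : Type} [Fintype k] [DecidableEq k] [Fintype ρ] (n : ℕ) (Q : Matrix p k ℂ[X]) (hQ : ∀ α β, (Q α β).natDegree ≤ n)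
    (B : Matrix ρ (Fin n × k) ℂ) (z : ℂ) :
    Ymat n Q B * vmat k (n + 1) z = Matrix.fromRows (Q.map (e1 z)) (B * vmat k n z) := by
  ext (i | i) β
  · rw [Matrix.mul_apply, row_v]
    simp only [Ymat, Matrix.of_apply, Sum.elim_inl, Matrix.fromRows_apply_inl, Matrix.map_apply, Polynomial.coe_evalRingHom]
    rw [Polynomial.eval_eq_sum_range' (Nat.lt_succ_of_le (hQ i β)), Finset.sum_range]
  · rw [Matrix.mul_apply, row_v, Fin.sum_univ_castSucc]
    simp only [Ymat, Matrix.of_apply, Sum.elim_inr, Matrix.fromRows_apply_inr, Matrix.mul_apply, row_v]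
    simp

theorem psd_factor {n : Type} [Fintype n] [DecidableEq n] (A : Matrix n n ℂ) (h : A.PosSemidef) : ∃ B : Matrix n n ℂ, A = Bᴴ * B := by
  open scoped MatrixOrder Matrix.Norms.L2Operator in
  exact CStarAlgebra.nonneg_iff_eq_star_mul_self.mp h.nonneg

theorem deg_bound1 {a b : Type} [Fintype a] [Fintype b] (N : Matrix a b ℂ[X]) : ∃ n, ∀ i j, (N i j).natDegree ≤ n := by
  refine ⟨∑ i, ∑ j, (N i j).natDegree, fun i j => ?_⟩
  refine le_trans ?_ (Finset.single_le_sum (f := fun i => ∑ j, (N i j).natDegree) (fun _ _ => Nat.zero_le _) (Finset.mem_univ i))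
  exact Finset.single_le_sum (f := fun j => (N i j).natDegree) (fun _ _ => Nat.zero_le _) (Finset.mem_univ j)

theorem smul_one_deg {R k : Type} [CommRing R] [DecidableEq k] (q : R[X]) (n : ℕ) (hq : q.natDegree ≤ n) (α β : k) :
    ((q • (1 : Matrix k k R[X])) α β).natDegree ≤ n := by
  by_cases h : α = β
  · subst h; simpa using hq
  · simp [Matrix.one_apply_ne h]

theorem one_var {b a : Type} [Fintype a] [Fintype b] [DecidableEq a] (δ : ℂ[X]) (hδ : ∀ z : ℂ, ‖z‖ < 1 → δ.eval z ≠ 0)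
    (M : Matrix b a ℂ[X])
    (hM : ∀ z : ℂ, ‖z‖ = 1 → (M.map (e1 z))ᴴ * M.map (e1 z) = (star (δ.eval z) * δ.eval z) • (1 : Matrix a a ℂ)) :
    ∃ (ρ : Type) (_ : Fintype ρ) (_ : DecidableEq ρ) (W : ℂ → Matrix ρ a ℂ) (U : Matrix (b ⊕ ρ) (a ⊕ ρ) ℂ),
      (∀ x, ∑ i, ‖(U *ᵥ x) i‖ ^ 2 ≤ ∑ i, ‖x i‖ ^ 2) ∧
      ∀ z : ℂ, U * Matrix.fromRows (δ.eval z • (1 : Matrix a a ℂ)) (z • W z) = Matrix.fromRows (M.map (e1 z)) (W z) := by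
  obtain ⟨n0, hn0⟩ := deg_bound1 M
  obtain ⟨n, hqn, hNn⟩ : ∃ n, δ.natDegree ≤ n ∧ (∀ i j, (M i j).natDegree ≤ n) :=
    ⟨max δ.natDegree n0, le_max_left _ _, fun i j => (hn0 i j).trans (le_max_right _ _)⟩
  obtain ⟨B, hB⟩ := psd_factor _ (toep_psd δ hδ M hM n)
  have hXY := XY_id (δ • (1 : Matrix a a ℂ[X])) M n (smul_one_deg δ n hqn) hNn (by
    intro z hz
    rw [hM z hz, smul_one_map, smul_one_gram]; rfl) B hB.symm
  obtain ⟨U, hU1, hU2⟩ := douglas _ _ hXY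
  refine ⟨Fin n × a, inferInstance, inferInstance, fun z => B * vmat a n z, U, hU1, fun z => ?_⟩
  have := congrArg (fun A => A * vmat a (n + 1) z) hU2
  beta_reduce at this
  rw [Matrix.mul_assoc, Xmat_v n _ (smul_one_deg δ n hqn), Ymat_v n _ hNn, smul_one_map] at this
  exact this

end Part18

section Part19
open scoped Polynomial
open Matrix
open scoped ComplexOrder

theorem smul_fromRows' {a b n : Type} (c : ℂ) (A : Matrix a n ℂ) (B : Matrix b n ℂ) :
    c • Matrix.fromRows A B = Matrix.fromRows (c • A) (c • B) := by
  ext (i | i) j <;> simp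

theorem fromRows_gram {a b n : Type} [Fintype a] [Fintype b] [Fintype n] (A : Matrix a n ℂ) (B : Matrix b n ℂ) :
    (Matrix.fromRows A B)ᴴ * Matrix.fromRows A B = Aᴴ * A + Bᴴ * B := by
  ext i j
  simp [Matrix.mul_apply, Fintype.sum_sum_type]

theorem two_var {m k : Type} [Fintype m] [Fintype k] [DecidableEq k] (q : ℂ[X][X])
    (hq : ∀ ζ z : ℂ, ‖ζ‖ < 1 → ‖z‖ < 1 → e2 ζ z q ≠ 0) (P : Matrix m k ℂ[X][X])
    (hP : ∀ ζ z : ℂ, ‖ζ‖ = 1 → ‖z‖ = 1 → (((q • (1 : Matrix k k ℂ[X][X])).map (e2 ζ z))ᴴ * (q • (1 : Matrix k k ℂ[X][X])).map (e2 ζ z) - (P.map (e2 ζ z))ᴴ * P.map (e2 ζ z)).PosSemidef) :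
    ∃ (r1 r2 : Type) (_ : Fintype r1) (_ : Fintype r2) (_ : DecidableEq r1) (_ : DecidableEq r2)
      (U : Matrix ((m ⊕ r1) ⊕ r2) ((k ⊕ r1) ⊕ r2) ℂ),
      (∀ x, ∑ i, ‖(U *ᵥ x) i‖ ^ 2 ≤ ∑ i, ‖x i‖ ^ 2) ∧
      ∀ ζ z : ℂ, ‖ζ‖ < 1 → ‖z‖ < 1 → ∃ (ξ : Matrix r1 k ℂ) (η : Matrix r2 k ℂ),
        U * Matrix.fromRows (Matrix.fromRows (1 : Matrix k k ℂ) (z • ξ)) (ζ • η) =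
          Matrix.fromRows (Matrix.fromRows ((e2 ζ z q)⁻¹ • P.map (e2 ζ z)) ξ) η := by
  obtain ⟨J0, iJ0, H, μ, hμ, hH⟩ := sos2_circle _ _ hP
  have hgram : ∀ ζ z : ℂ, ‖ζ‖ = 1 → ‖z‖ = 1 → ((Matrix.fromRows (μ • P) H).map (e2 ζ z))ᴴ * (Matrix.fromRows (μ • P) H).map (e2 ζ z)
      = (star (e2 ζ z (μ * q)) * e2 ζ z (μ * q)) • (1 : Matrix k k ℂ) := by
    intro ζ z hζ hz
    have h1 : (Matrix.fromRows (μ • P) H).map (e2 ζ z) = Matrix.fromRows (e2 ζ z μ • P.map (e2 ζ z)) (H.map (e2 ζ z)) := by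
      ext (i | i) j <;> simp
    rw [h1, fromRows_gram, hH ζ z hζ hz, smul_gram, smul_one_map, smul_one_gram, smul_sub, add_sub_cancel, smul_smul, map_mul, star_mul']
    congr 1; ring
  obtain ⟨n, J, iJ, iD, B, δ, M, hqn, hNn, hδ, hM, hMX⟩ := z1_step (μ * q) (fun ζ z hζ hz => by
    rw [map_mul]; exact mul_ne_zero (hμ ζ z hζ hz) (hq ζ z hζ hz)) _ hgram
  obtain ⟨ρ, iρ, iDρ, W, U0, hU1, hU2⟩ := one_var δ hδ M hM
  refine ⟨J, ρ, iJ, iρ, iD, iDρ, U0.submatrix (Sum.map (Sum.map Sum.inl id) id) id, fun x => ?_, fun ζ z hζ hz => ?_⟩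
  · refine le_trans ?_ (hU1 x)
    simp only [Fintype.sum_sum_type]
    have hs : ∀ i, (U0.submatrix (Sum.map (Sum.map Sum.inl id) id) id *ᵥ x) i = (U0 *ᵥ x) (Sum.map (Sum.map Sum.inl id) id i) := fun i => rfl
    simp only [hs, Sum.map_inl, Sum.map_inr, id]
    have : 0 ≤ ∑ i, ‖(U0 *ᵥ x) (Sum.inl (Sum.inl (Sum.inr i)))‖ ^ 2 := by positivity
    linarith
  · have hq0 := hq ζ z hζ hz
    have hμ0 := hμ ζ z hζ hz
    have hδ0 := hδ ζ hζ
    set Bv := B.map (e1 ζ) * vmat k n z with hBv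
    have h3 : ∀ {a b : Type} (N : Matrix a b ℂ[X][X]), (N.map (Polynomial.mapRingHom (e1 ζ))).map (e1 z) = N.map (e2 ζ z) := by
      intro a b N
      ext i j
      simp only [Matrix.map_apply]
      exact (e2_eq _ _ _).symm
    set S := (Xmat n ((μ * q) • (1 : Matrix k k ℂ[X][X])) B).map (e1 ζ) * vmat k (n + 1) z with hS
    have hS1 : S = Matrix.fromRows (e2 ζ z (μ * q) • (1 : Matrix k k ℂ)) (z • Bv) := by
      rw [hS, Xmat_map, Xmat_v, h3, smul_one_map]
      intro α β
      exact (Polynomial.natDegree_map_le).trans (smul_one_deg _ n hqn α β)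
    have hS2 : M.map (e1 ζ) * S = δ.eval ζ • Matrix.fromRows (Matrix.fromRows (e2 ζ z μ • P.map (e2 ζ z)) (H.map (e2 ζ z))) Bv := by
      rw [hS, ← Matrix.mul_assoc, ← Matrix.map_mul, hMX]
      have : (δ • Ymat n (Matrix.fromRows (μ • P) H) B).map (e1 ζ) = δ.eval ζ • (Ymat n (Matrix.fromRows (μ • P) H) B).map (e1 ζ) := by
        ext i j; simp
      rw [this, Matrix.smul_mul, Ymat_map, Ymat_v, h3]
      · have h1 : (Matrix.fromRows (μ • P) H).map (e2 ζ z) = Matrix.fromRows (e2 ζ z μ • P.map (e2 ζ z)) (H.map (e2 ζ z)) := by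
          ext (i | i) j <;> simp
        rw [h1]
      · intro α β
        exact (Polynomial.natDegree_map_le).trans (hNn α β)
    have h4 := congrArg (fun A => (δ.eval ζ * e2 ζ z (μ * q))⁻¹ • (A * S)) (hU2 ζ)
    beta_reduce at h4
    rw [Matrix.mul_assoc, Matrix.fromRows_mul, Matrix.fromRows_mul, hS2, Matrix.smul_mul, Matrix.one_mul, Matrix.smul_mul, ← Matrix.mul_smul] at h4
    refine ⟨(e2 ζ z (μ * q))⁻¹ • Bv, (δ.eval ζ * e2 ζ z (μ * q))⁻¹ • (W ζ * S), ?_⟩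
    have hq' : e2 ζ z (μ * q) ≠ 0 := by rw [map_mul]; exact mul_ne_zero hμ0 hq0
    have h5 : (δ.eval ζ * e2 ζ z (μ * q))⁻¹ * δ.eval ζ = (e2 ζ z (μ * q))⁻¹ := by field_simp
    have h6 : (e2 ζ z (μ * q))⁻¹ * e2 ζ z μ = (e2 ζ z q)⁻¹ := by rw [map_mul]; field_simp
    have e1 : Matrix.fromRows (Matrix.fromRows (1 : Matrix k k ℂ) (z • (e2 ζ z (μ * q))⁻¹ • Bv)) (ζ • (δ.eval ζ * e2 ζ z (μ * q))⁻¹ • (W ζ * S))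
       = (δ.eval ζ * e2 ζ z (μ * q))⁻¹ • Matrix.fromRows (δ.eval ζ • S) (ζ • (W ζ * S)) := by
      rw [smul_fromRows', smul_smul _ _ S, h5]
      congr 1
      · rw [hS1, smul_fromRows', smul_smul _ _ (1 : Matrix k k ℂ), inv_mul_cancel₀ hq', one_smul, smul_comm _ z]
      · rw [smul_comm _ ζ]
    rw [e1]
    ext (( i | i) | i) j
    · have := congrFun (congrFun h4 (Sum.inl (Sum.inl (Sum.inl i)))) j
      refine Eq.trans this ?_
      simp only [Matrix.smul_apply, Matrix.fromRows_apply_inl, smul_eq_mul, ← mul_assoc, h5, h6]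
    · have := congrFun (congrFun h4 (Sum.inl (Sum.inr i))) j
      refine Eq.trans this ?_
      simp only [Matrix.smul_apply, Matrix.fromRows_apply_inl, Matrix.fromRows_apply_inr, smul_eq_mul, ← mul_assoc, h5]
    · have := congrFun (congrFun h4 (Sum.inr i)) j
      refine Eq.trans this ?_
      simp only [Matrix.smul_apply, Matrix.fromRows_apply_inr, smul_eq_mul]

end Part19


set_option linter.all false
section Own
open scoped Polynomial
open Matrix
open scoped ComplexOrder

def mclm {a b : Type} [Fintype a] [Fintype b] [DecidableEq b] (M : Matrix a b ℂ) : EuclideanSpace ℂ b →L[ℂ] EuclideanSpace ℂ a :=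
  LinearMap.toContinuousLinearMap (Matrix.toEuclideanLin M)

theorem mclm_apply {a b : Type} [Fintype a] [Fintype b] [DecidableEq b] (M : Matrix a b ℂ) (x : EuclideanSpace ℂ b) (i : a) :
    mclm M x i = ∑ j, M i j * x j := rfl

def pack {k r1 r2 : Type} [Fintype k] [Fintype r1] [Fintype r2] (s : ℂ) (u : EuclideanSpace ℂ k) (g g' : EuclideanSpace ℂ (r1 ⊕ r2)) :
    (k ⊕ r1) ⊕ r2 → ℂ :=
  Sum.elim (Sum.elim (fun j => s * u j) (fun r => g (Sum.inl r))) (fun r => g' (Sum.inr r))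

section
variable {m k r1 r2 : Type} [Fintype m] [Fintype k] [Fintype r1] [Fintype r2] [DecidableEq k] [DecidableEq r1] [DecidableEq r2]

def rA1 (U : Matrix ((m ⊕ r1) ⊕ r2) ((k ⊕ r1) ⊕ r2) ℂ) : EuclideanSpace ℂ (r1 ⊕ r2) →L[ℂ] EuclideanSpace ℂ (r1 ⊕ r2) :=
  mclm (Matrix.fromBlocks (U.submatrix (fun i => Sum.inl (Sum.inr i)) (fun i => Sum.inl (Sum.inr i))) 0 0 (U.submatrix Sum.inr Sum.inr))

def rA2 (U : Matrix ((m ⊕ r1) ⊕ r2) ((k ⊕ r1) ⊕ r2) ℂ) : EuclideanSpace ℂ (r1 ⊕ r2) →L[ℂ] EuclideanSpace ℂ (r1 ⊕ r2) :=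
  mclm (Matrix.fromBlocks 0 (U.submatrix (fun i => Sum.inl (Sum.inr i)) Sum.inr) (U.submatrix Sum.inr (fun i => Sum.inl (Sum.inr i))) 0)

def rB (s : ℂ) (U : Matrix ((m ⊕ r1) ⊕ r2) ((k ⊕ r1) ⊕ r2) ℂ) : EuclideanSpace ℂ k →L[ℂ] EuclideanSpace ℂ (r1 ⊕ r2) :=
  mclm (s • Matrix.fromRows (U.submatrix (fun i => Sum.inl (Sum.inr i)) (fun i => Sum.inl (Sum.inl i))) (U.submatrix Sum.inr (fun i => Sum.inl (Sum.inl i))))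

def rC (s : ℂ) (U : Matrix ((m ⊕ r1) ⊕ r2) ((k ⊕ r1) ⊕ r2) ℂ) : EuclideanSpace ℂ (r1 ⊕ r2) →L[ℂ] EuclideanSpace ℂ m :=
  mclm (s • Matrix.fromCols (U.submatrix (fun i => Sum.inl (Sum.inl i)) (fun i => Sum.inl (Sum.inr i))) (U.submatrix (fun i => Sum.inl (Sum.inl i)) Sum.inr))

def rD (U : Matrix ((m ⊕ r1) ⊕ r2) ((k ⊕ r1) ⊕ r2) ℂ) : EuclideanSpace ℂ k →L[ℂ] EuclideanSpace ℂ m :=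
  mclm (U.submatrix (fun i => Sum.inl (Sum.inl i)) (fun i => Sum.inl (Sum.inl i)))

theorem co_inl (s : ℂ) (U : Matrix ((m ⊕ r1) ⊕ r2) ((k ⊕ r1) ⊕ r2) ℂ) (u : EuclideanSpace ℂ k) (g g' : EuclideanSpace ℂ (r1 ⊕ r2)) (r : r1) :
    (rA1 U g + rA2 U g' + rB s U u) (Sum.inl r) = (U *ᵥ pack s u g g') (Sum.inl (Sum.inr r)) := by
  simp only [PiLp.add_apply, rA1, rA2, rB, mclm_apply, Matrix.mulVec, dotProduct, pack, Fintype.sum_sum_type, Matrix.fromBlocks_apply₁₁,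
    Matrix.fromBlocks_apply₁₂, Matrix.fromRows_apply_inl, Matrix.submatrix_apply, Matrix.zero_apply, zero_mul, Finset.sum_const_zero, Sum.elim_inl, Sum.elim_inr, Matrix.smul_apply, smul_eq_mul]
  have : ∀ j, s * U (Sum.inl (Sum.inr r)) (Sum.inl (Sum.inl j)) * u j = U (Sum.inl (Sum.inr r)) (Sum.inl (Sum.inl j)) * (s * u j) := fun j => by ring
  simp_rw [this]
  ring

theorem co_inr (s : ℂ) (U : Matrix ((m ⊕ r1) ⊕ r2) ((k ⊕ r1) ⊕ r2) ℂ) (u : EuclideanSpace ℂ k) (g g' : EuclideanSpace ℂ (r1 ⊕ r2)) (r : r2) :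
    (rA1 U g + rA2 U g' + rB s U u) (Sum.inr r) = (U *ᵥ pack s u g' g) (Sum.inr r) := by
  simp only [PiLp.add_apply, rA1, rA2, rB, mclm_apply, Matrix.mulVec, dotProduct, pack, Fintype.sum_sum_type, Matrix.fromBlocks_apply₂₁,
    Matrix.fromBlocks_apply₂₂, Matrix.fromRows_apply_inr, Matrix.submatrix_apply, Matrix.zero_apply, zero_mul, Finset.sum_const_zero, Sum.elim_inl, Sum.elim_inr, Matrix.smul_apply, smul_eq_mul]
  have : ∀ j, s * U (Sum.inr r) (Sum.inl (Sum.inl j)) * u j = U (Sum.inr r) (Sum.inl (Sum.inl j)) * (s * u j) := fun j => by ring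
  simp_rw [this]
  ring

theorem co_out (s : ℂ) (hs : 2 * s * s = 1) (U : Matrix ((m ⊕ r1) ⊕ r2) ((k ⊕ r1) ⊕ r2) ℂ) (u : EuclideanSpace ℂ k) (g g' : EuclideanSpace ℂ (r1 ⊕ r2)) (i : m) :
    (rC s U g + rC s U g' + rD U u) i = s * ((U *ᵥ pack s u g g') (Sum.inl (Sum.inl i)) + (U *ᵥ pack s u g' g) (Sum.inl (Sum.inl i))) := by
  simp only [PiLp.add_apply, rC, rD, mclm_apply, Matrix.mulVec, dotProduct, pack, Fintype.sum_sum_type, Matrix.fromCols_apply_inl,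
    Matrix.fromCols_apply_inr, Matrix.submatrix_apply, Sum.elim_inl, Sum.elim_inr, Matrix.smul_apply, smul_eq_mul, mul_assoc, ← Finset.mul_sum]
  have : ∀ j, U (Sum.inl (Sum.inl i)) (Sum.inl (Sum.inl j)) * (s * u j) = s * (U (Sum.inl (Sum.inl i)) (Sum.inl (Sum.inl j)) * u j) := fun j => by ring
  simp_rw [this, ← Finset.mul_sum]
  linear_combination (-(∑ j, U (Sum.inl (Sum.inl i)) (Sum.inl (Sum.inl j)) * u j)) * hs

theorem sym_contr (s : ℂ) (hs : 2 * s * s = 1) (hs2 : 2 * ‖s‖ ^ 2 = 1) (U : Matrix ((m ⊕ r1) ⊕ r2) ((k ⊕ r1) ⊕ r2) ℂ)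
    (hU : ∀ x, ∑ i, ‖(U *ᵥ x) i‖ ^ 2 ≤ ∑ i, ‖x i‖ ^ 2) :
    SymColligationContractive (rA1 U) (rA2 U) (rB s U) (rC s U) (rD U) := by
  intro h₁ h₂ u
  rw [add_comm (rA2 U h₁)]
  simp only [EuclideanSpace.norm_sq_eq, Fintype.sum_sum_type]
  simp only [co_inl, co_inr, co_out s hs]
  have h1 := hU (pack s u h₁ h₂)
  have h2 := hU (pack s u h₂ h₁)
  simp only [Fintype.sum_sum_type] at h1 h2
  have h3 : ∀ (y y' : m → ℂ), ∑ i, ‖s * (y i + y' i)‖ ^ 2 ≤ ∑ i, ‖y i‖ ^ 2 + ∑ i, ‖y' i‖ ^ 2 := by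
    intro y y'
    rw [← Finset.sum_add_distrib]
    apply Finset.sum_le_sum
    intro i _
    rw [norm_mul, mul_pow]
    have := sq_add_le (y i) (y' i)
    have h0 : ‖s‖ ^ 2 = 1 / 2 := by linarith
    rw [h0]; linarith
  have h4 := h3 (fun i => (U *ᵥ pack s u h₁ h₂) (Sum.inl (Sum.inl i))) (fun i => (U *ᵥ pack s u h₂ h₁) (Sum.inl (Sum.inl i)))
  have h5 : ∀ g g' : EuclideanSpace ℂ (r1 ⊕ r2), ∑ j, ‖pack s u g g' (Sum.inl (Sum.inl j))‖ ^ 2 = (1 / 2) * ∑ j, ‖u j‖ ^ 2 := by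
    intro g g'
    rw [Finset.mul_sum]
    apply Finset.sum_congr rfl
    intro j _
    simp only [pack, Sum.elim_inl, norm_mul, mul_pow]
    have h0 : ‖s‖ ^ 2 = 1 / 2 := by linarith
    rw [h0]
  rw [h5] at h1 h2
  simp only [pack, Sum.elim_inl, Sum.elim_inr] at h1 h2 h4 ⊢
  linarith

end

theorem sym_unit {H U Y : Type} [NormedAddCommGroup H] [InnerProductSpace ℂ H] [FiniteDimensional ℂ H]
    [NormedAddCommGroup U] [NormedSpace ℂ U] [NormedAddCommGroup Y] [NormedSpace ℂ Y]
    (A₁ A₂ : H →L[ℂ] H) (B : U →L[ℂ] H) (C : H →L[ℂ] Y) (D : U →L[ℂ] Y) (h : SymColligationContractive A₁ A₂ B C D)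
    (z ζ : ℂ) (hz : ‖z‖ < 1) (hζ : ‖ζ‖ < 1) : IsUnit (1 - symBlock A₁ A₂ * diagOp z ζ) := by
  have hinj : Function.Injective (1 - symBlock A₁ A₂ * diagOp z ζ : (H × H) →L[ℂ] (H × H)) := by
    rw [injective_iff_map_eq_zero]
    rintro ⟨x1, x2⟩ hx
    have e1 : A₁ (z • x1) + A₂ (ζ • x2) = x1 := by
      have := congrArg Prod.fst hx
      simp [symBlock, diagOp, sub_eq_zero] at this
      simpa using this.symm
    have e2 : A₂ (z • x1) + A₁ (ζ • x2) = x2 := by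
      have := congrArg Prod.snd hx
      simp [symBlock, diagOp, sub_eq_zero] at this
      simpa using this.symm
    have h1 := h (z • x1) (ζ • x2) 0
    rw [map_zero, add_zero, add_zero, e1, e2, norm_smul, norm_smul, mul_pow, mul_pow, norm_zero] at h1
    have h2 : 0 ≤ ‖C (z • x1) + C (ζ • x2) + D 0‖ ^ 2 := by positivity
    have hz2 : ‖z‖ ^ 2 < 1 := by have := norm_nonneg z; nlinarith
    have hζ2 : ‖ζ‖ ^ 2 < 1 := by have := norm_nonneg ζ; nlinarith
    have h3 : (1 - ‖z‖ ^ 2) * ‖x1‖ ^ 2 + (1 - ‖ζ‖ ^ 2) * ‖x2‖ ^ 2 ≤ 0 := by linarith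
    have h4 : 0 ≤ (1 - ‖z‖ ^ 2) * ‖x1‖ ^ 2 := mul_nonneg (by linarith) (by positivity)
    have h5 : 0 ≤ (1 - ‖ζ‖ ^ 2) * ‖x2‖ ^ 2 := mul_nonneg (by linarith) (by positivity)
    have h6 : (1 - ‖z‖ ^ 2) * ‖x1‖ ^ 2 = 0 := by linarith
    have h7 : (1 - ‖ζ‖ ^ 2) * ‖x2‖ ^ 2 = 0 := by linarith
    have h8 : x1 = 0 := by
      rcases mul_eq_zero.1 h6 with h | h
      · linarith
      · simpa using h
    have h9 : x2 = 0 := by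
      rcases mul_eq_zero.1 h7 with h | h
      · linarith
      · simpa using h
    rw [h8, h9]; rfl
  have : CompleteSpace H := FiniteDimensional.complete ℂ H
  rw [ContinuousLinearMap.isUnit_iff_bijective]
  exact ⟨hinj, (LinearMap.injective_iff_surjective (f := (1 - symBlock A₁ A₂ * diagOp z ζ : (H × H) →L[ℂ] (H × H)).toLinearMap)).1 hinj⟩

theorem sym_transfer_eq {H U Y : Type} [NormedAddCommGroup H] [NormedSpace ℂ H]
    [NormedAddCommGroup U] [NormedSpace ℂ U] [NormedAddCommGroup Y] [NormedSpace ℂ Y]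
    (A₁ A₂ : H →L[ℂ] H) (B : U →L[ℂ] H) (C : H →L[ℂ] Y) (D : U →L[ℂ] Y) 
    (z ζ : ℂ) (hu : IsUnit (1 - symBlock A₁ A₂ * diagOp z ζ)) (u : U) (g1 g2 : H)
    (e1 : A₁ (z • g1) + A₂ (ζ • g2) + B u = g1) (e2 : A₁ (ζ • g2) + A₂ (z • g1) + B u = g2) :
    symTransfer A₁ A₂ B C D z ζ u = C (z • g1) + C (ζ • g2) + D u := by
  have h1 : (1 - symBlock A₁ A₂ * diagOp z ζ : (H × H) →L[ℂ] (H × H)) (g1, g2) = (B u, B u) := by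
    ext
    · simp [symBlock, diagOp]
      nth_rewrite 1 [← e1]; simp
    · simp [symBlock, diagOp]
      nth_rewrite 1 [← e2]; simp; abel
  have h2 : (Ring.inverse (1 - symBlock A₁ A₂ * diagOp z ζ) : (H × H) →L[ℂ] (H × H)) (B u, B u) = (g1, g2) := by
    rw [← h1, ← ContinuousLinearMap.mul_apply, Ring.inverse_mul_cancel _ hu]; rfl
  simp only [symTransfer, ContinuousLinearMap.add_apply, ContinuousLinearMap.comp_apply, ContinuousLinearMap.prod_apply]
  rw [h2]
  simp [diagOp]
  abel

def toXX : MvPolynomial (Fin 2) ℂ →+* ℂ[X][X] :=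
  MvPolynomial.eval₂Hom (Polynomial.C.comp Polynomial.C) ![Polynomial.X, Polynomial.C Polynomial.X]

theorem e2_toXX (ζ z : ℂ) (p : MvPolynomial (Fin 2) ℂ) : e2 ζ z (toXX p) = eval ![z, ζ] p := by
  have : (e2 ζ z).comp toXX = eval ![z, ζ] := by
    apply MvPolynomial.ringHom_ext
    · intro r; simp [toXX, Polynomial.evalEval]
    · intro i; fin_cases i <;> simp [toXX, Polynomial.evalEval]
  exact congrFun (congrArg DFunLike.coe this) p

theorem psd_bd (m k : ℕ)
    (f : ℂ × ℂ → Matrix (Fin m) (Fin k) ℂ)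
    (P : Matrix (Fin m) (Fin k) (MvPolynomial (Fin 2) ℂ)) (q : MvPolynomial (Fin 2) ℂ)
    (hq : ∀ w ∈ bidisk, eval ![w.1, w.2] q ≠ 0)
    (hf : ∀ w ∈ bidisk, f w = (eval ![w.1, w.2] q)⁻¹ • P.map (eval ![w.1, w.2]))
    (hnorm : ∀ w ∈ bidisk, ‖matCLM (f w)‖ ≤ 1) (x : Fin k → ℂ) (w : ℂ × ℂ) (h1 : ‖w.1‖ = 1) (h2 : ‖w.2‖ = 1) :
    ∑ i, ‖(P.map (eval ![w.1, w.2]) *ᵥ x) i‖ ^ 2 ≤ ∑ i, ‖eval ![w.1, w.2] q * x i‖ ^ 2 := by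
  have hce : ∀ p : MvPolynomial (Fin 2) ℂ, Continuous fun w : ℂ × ℂ => eval ![w.1, w.2] p := by
    intro p
    apply (MvPolynomial.continuous_eval p).comp
    apply continuous_pi
    intro i
    fin_cases i
    · exact continuous_fst
    · exact continuous_snd
  have hcl : IsClosed {w : ℂ × ℂ | ∑ i, ‖(P.map (eval ![w.1, w.2]) *ᵥ x) i‖ ^ 2 ≤ ∑ i, ‖eval ![w.1, w.2] q * x i‖ ^ 2} := by
    apply isClosed_le
    · apply continuous_finset_sum
      intro i _
      apply Continuous.pow
      apply Continuous.norm
      simp only [Matrix.mulVec, dotProduct, Matrix.map_apply]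
      apply continuous_finset_sum
      intro j _
      exact (hce _).mul continuous_const
    · apply continuous_finset_sum
      intro i _
      apply Continuous.pow
      apply Continuous.norm
      exact (hce _).mul continuous_const
  have hsub : Metric.ball (0:ℂ) 1 ×ˢ Metric.ball (0:ℂ) 1 ⊆ {w : ℂ × ℂ | ∑ i, ‖(P.map (eval ![w.1, w.2]) *ᵥ x) i‖ ^ 2 ≤ ∑ i, ‖eval ![w.1, w.2] q * x i‖ ^ 2} := by
    rintro w ⟨hw1, hw2⟩
    have hw : w ∈ bidisk := ⟨by simpa using hw1, by simpa using hw2⟩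
    have h3 := (matCLM (f w)).le_of_opNorm_le (hnorm w hw) (WithLp.toLp 2 x)
    rw [one_mul] at h3
    have h4 : ‖matCLM (f w) (WithLp.toLp 2 x)‖ ^ 2 ≤ ‖(WithLp.toLp 2 x : EuclideanSpace ℂ (Fin k))‖ ^ 2 := by gcongr
    rw [EuclideanSpace.norm_sq_eq, EuclideanSpace.norm_sq_eq] at h4
    have h5 : ∀ i, (matCLM (f w) (WithLp.toLp 2 x)) i = (f w *ᵥ x) i := fun i => rfl
    simp_rw [h5] at h4
    have h6 : P.map (eval ![w.1, w.2]) = eval ![w.1, w.2] q • f w := by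
      rw [hf w hw, smul_smul, mul_inv_cancel₀ (hq w hw), one_smul]
    change ∑ i, ‖(P.map (eval ![w.1, w.2]) *ᵥ x) i‖ ^ 2 ≤ ∑ i, ‖eval ![w.1, w.2] q * x i‖ ^ 2
    rw [h6]
    simp only [Matrix.smul_mulVec, Pi.smul_apply, smul_eq_mul, norm_mul, mul_pow, ← Finset.mul_sum]
    exact mul_le_mul_of_nonneg_left h4 (by positivity)
  have := closure_minimal hsub hcl
  rw [closure_prod_eq, closure_ball _ one_ne_zero] at this
  exact this ⟨by simp [h1], by simp [h2]⟩

theorem main_aux (m k : ℕ)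
    (f : ℂ × ℂ → Matrix (Fin m) (Fin k) ℂ)
    (P : Matrix (Fin m) (Fin k) (MvPolynomial (Fin 2) ℂ)) (q : MvPolynomial (Fin 2) ℂ)
    (hq : ∀ w ∈ bidisk, eval ![w.1, w.2] q ≠ 0)
    (hf : ∀ w ∈ bidisk, f w = (eval ![w.1, w.2] q)⁻¹ • P.map (eval ![w.1, w.2]))
    (hnorm : ∀ w ∈ bidisk, ‖matCLM (f w)‖ ≤ 1) :
    ∃ (r1 r2 : Type) (_ : Fintype r1) (_ : Fintype r2) (_ : DecidableEq r1) (_ : DecidableEq r2)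
      (U : Matrix ((Fin m ⊕ r1) ⊕ r2) ((Fin k ⊕ r1) ⊕ r2) ℂ),
      (∀ x, ∑ i, ‖(U *ᵥ x) i‖ ^ 2 ≤ ∑ i, ‖x i‖ ^ 2) ∧
      ∀ w ∈ bidisk, ∃ (ξ : Matrix r1 (Fin k) ℂ) (η : Matrix r2 (Fin k) ℂ),
        U * Matrix.fromRows (Matrix.fromRows (1 : Matrix (Fin k) (Fin k) ℂ) (w.1 • ξ)) (w.2 • η) =
          Matrix.fromRows (Matrix.fromRows (f w) ξ) η := by
  have hmap : ∀ ζ z : ℂ, (P.map toXX).map (e2 ζ z) = P.map (eval ![z, ζ]) := by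
    intro ζ z
    ext i j
    simp only [Matrix.map_apply, e2_toXX]
  obtain ⟨r1, r2, i1, i2, d1, d2, U, hU, h⟩ := two_var (toXX q)
    (fun ζ z hζ hz => by rw [e2_toXX]; exact hq (z, ζ) ⟨hz, hζ⟩) (P.map toXX) (fun ζ z hζ hz => by
      apply psd_of_norm
      intro x
      rw [hmap, smul_one_map, e2_toXX]
      have := psd_bd m k f P q hq hf hnorm x (z, ζ) hz hζ
      simpa [Matrix.smul_mulVec] using this)
  refine ⟨r1, r2, i1, i2, d1, d2, U, hU, fun w hw => ?_⟩
  obtain ⟨ξ, η, hh⟩ := h w.2 w.1 hw.2 hw.1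
  refine ⟨ξ, η, ?_⟩
  rw [hh, hf w hw, hmap, e2_toXX]

theorem exists_s : ∃ s : ℂ, 2 * s * s = 1 ∧ 2 * ‖s‖ ^ 2 = 1 := by
  have h : √2 * √2 = (2:ℝ) := Real.mul_self_sqrt (by norm_num)
  have h0 : (√2 : ℝ) ≠ 0 := by positivity
  have h1 : 2 * (√2)⁻¹ * (√2)⁻¹ = (1:ℝ) := by field_simp; nlinarith
  refine ⟨(((√2 : ℝ)⁻¹ : ℝ) : ℂ), by exact_mod_cast h1, ?_⟩
  rw [Complex.norm_real, Real.norm_eq_abs, sq_abs, sq, ← mul_assoc, h1]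

end Own

theorem rational_symmetric_schur_class_admits_finite_dim_realization (m k : ℕ)
    (f : ℂ × ℂ → Matrix (Fin m) (Fin k) ℂ)
    (P : Matrix (Fin m) (Fin k) (MvPolynomial (Fin 2) ℂ)) (q : MvPolynomial (Fin 2) ℂ)
    (hq : ∀ w ∈ bidisk, eval ![w.1, w.2] q ≠ 0)
    (hf : ∀ w ∈ bidisk, f w = (eval ![w.1, w.2] q)⁻¹ • P.map (eval ![w.1, w.2]))
    (hsym : ∀ w ∈ bidisk, f (w.2, w.1) = f w)
    (hnorm : ∀ w ∈ bidisk, ‖matCLM (f w)‖ ≤ 1) :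
    ∃ (H : Type) (_ : NormedAddCommGroup H) (_ : InnerProductSpace ℂ H)
      (_ : FiniteDimensional ℂ H) (A₁ A₂ : H →L[ℂ] H)
      (B : EuclideanSpace ℂ (Fin k) →L[ℂ] H) (C : H →L[ℂ] EuclideanSpace ℂ (Fin m))
      (D : EuclideanSpace ℂ (Fin k) →L[ℂ] EuclideanSpace ℂ (Fin m)),
      SymColligationContractive A₁ A₂ B C D ∧
        ∀ w ∈ bidisk,
          IsUnit (1 - symBlock A₁ A₂ * diagOp w.1 w.2) ∧
            matCLM (f w) = symTransfer A₁ A₂ B C D w.1 w.2 := by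
  obtain ⟨r1, r2, i1, i2, d1, d2, U, hU, h⟩ := main_aux m k f P q hq hf hnorm
  obtain ⟨s, hs, hs2⟩ := exists_s
  have hcon := sym_contr s hs hs2 U hU
  refine ⟨EuclideanSpace ℂ (r1 ⊕ r2), inferInstance, inferInstance, inferInstance, rA1 U, rA2 U, rB s U, rC s U, rD U, hcon, ?_⟩
  intro w hw
  have hunit := sym_unit _ _ _ _ _ hcon w.1 w.2 hw.1 hw.2
  refine ⟨hunit, ?_⟩
  obtain ⟨ξ, η, h1⟩ := h w hw
  have hw' : (w.2, w.1) ∈ bidisk := ⟨hw.2, hw.1⟩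
  obtain ⟨ξ', η', h2⟩ := h (w.2, w.1) hw'
  rw [hsym w hw] at h2
  ext u i
  let g1 : EuclideanSpace ℂ (r1 ⊕ r2) := WithLp.toLp 2 (Sum.elim (fun r => s * (ξ.mulVec u) r) (fun r => s * (η'.mulVec u) r))
  let g2 : EuclideanSpace ℂ (r1 ⊕ r2) := WithLp.toLp 2 (Sum.elim (fun r => s * (ξ'.mulVec u) r) (fun r => s * (η.mulVec u) r))
  have p1 : pack s u (w.1 • g1) (w.2 • g2) = s • (Matrix.fromRows (Matrix.fromRows (1 : Matrix (Fin k) (Fin k) ℂ) (w.1 • ξ)) (w.2 • η)).mulVec u := by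
    ext ((j | j) | j)
    · simp [pack]
    · simp [pack, g1, Matrix.smul_mulVec]; ring
    · simp [pack, g2, Matrix.smul_mulVec]; ring
  have p2 : pack s u (w.2 • g2) (w.1 • g1) = s • (Matrix.fromRows (Matrix.fromRows (1 : Matrix (Fin k) (Fin k) ℂ) (w.2 • ξ')) (w.1 • η')).mulVec u := by
    ext ((j | j) | j)
    · simp [pack]
    · simp [pack, g2, Matrix.smul_mulVec]; ring
    · simp [pack, g1, Matrix.smul_mulVec]; ring
  have q1 : U.mulVec (pack s u (w.1 • g1) (w.2 • g2)) = s • (Matrix.fromRows (Matrix.fromRows (f w) ξ) η).mulVec u := by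
    rw [p1, Matrix.mulVec_smul, Matrix.mulVec_mulVec, h1]
  have q2 : U.mulVec (pack s u (w.2 • g2) (w.1 • g1)) = s • (Matrix.fromRows (Matrix.fromRows (f w) ξ') η').mulVec u := by
    rw [p2, Matrix.mulVec_smul, Matrix.mulVec_mulVec, ← h2]
  have s1 : rA1 U (w.1 • g1) + rA2 U (w.2 • g2) + rB s U u = g1 := by
    ext (r | r)
    · rw [co_inl, q1]; simp [g1]
    · rw [co_inr, q2]; simp [g1]
  have s2 : rA1 U (w.2 • g2) + rA2 U (w.1 • g1) + rB s U u = g2 := by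
    ext (r | r)
    · rw [co_inl, q2]; simp [g2]
    · rw [co_inr, q1]; simp [g2]
  rw [sym_transfer_eq _ _ _ _ _ w.1 w.2 hunit u g1 g2 s1 s2, co_out s hs, q1, q2]
  have hm : (matCLM (f w) u) i = ((f w).mulVec u) i := rfl
  rw [hm]
  simp only [Matrix.fromRows_mulVec, Pi.smul_apply, Sum.elim_inl, smul_eq_mul]
  linear_combination (-((f w).mulVec u) i) * hs
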